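/- arXiv:2206.06492 — 3 statements merged into one kernel-verified Lean document; each statement's English description precedes it below -/
import Mathlib

section
/- Assume that every Σ¹₂ subset of a Borel space is universally measurable. Let X and Y be Borel spaces, D ⊂ X × Y analytic, and f : D → [−∞, +∞] upper semianalytic, and define f*(x) := inf over y ∈ D_x of f(x, y) on proj_X(D), where D_x is the x-section of D. Then: (i) f* is universally measurable; (ii) the set E* := {x ∈ proj_X(D) : the infimum defining f*(x) is attained} is universally measurable, and for each ε > 0 there exists a universally measurable ψ : proj_X(D) → Y with ψ(x) ∈ D_x for all x ∈ proj_X(D), f(x, ψ(x)) = f*(x) for all x ∈ E*, and for all x ∈ proj_X(D) \ E*, f(x, ψ(x)) ≤ f*(x) + ε if f*(x) > −∞ and f(x, ψ(x)) ≤ −1/ε if f*(x) = −∞. -/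
open MeasureTheory

noncomputable section

namespace PaperStmt

/-- A set is universally measurable if it is measurable with respect to the completion of
every Borel probability measure. -/
def UniversallyMeasurableSet {α : Type*} [MeasurableSpace α] (s : Set α) : Prop :=
  ∀ μ : Measure α, IsProbabilityMeasure μ → NullMeasurableSet s μ

/-- A map between measurable spaces is universally measurable if preimages of measurable
sets are universally measurable. -/
def UniversallyMeasurable {α β : Type*} [MeasurableSpace α] [MeasurableSpace β]
    (f : α → β) : Prop :=
  ∀ s : Set β, MeasurableSet s → UniversallyMeasurableSet (f ⁻¹' s)

/-- A `Σ¹₂` set in a Borel space: the image of a coanalytic subset of some Polish space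
under a Borel measurable map. -/
def IsSigma12 {γ : Type*} [TopologicalSpace γ] [MeasurableSpace γ] (s : Set γ) : Prop :=
  ∃ (β : Type) (tβ : TopologicalSpace β), @PolishSpace β tβ ∧
    ∃ (C : Set β) (f : β → γ),
      @MeasureTheory.AnalyticSet β tβ Cᶜ ∧ @Measurable β γ (@borel β tβ) _ f ∧ f '' C = s

/-- Upper semianalyticity on a given domain. -/
def UpperSemianalyticOn {γ : Type*} [TopologicalSpace γ] (D : Set γ) (f : γ → EReal) :
    Prop :=
  ∀ r : ℝ, MeasureTheory.AnalyticSet {x | x ∈ D ∧ (r : EReal) ≤ f x}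

/-! ### Analytic sets -/

theorem _root_.MeasureTheory.AnalyticSet.inter {α : Type*} [TopologicalSpace α] [T2Space α]
    {s t : Set α} (hs : AnalyticSet s) (ht : AnalyticSet t) : AnalyticSet (s ∩ t) := by
  rw [Set.inter_eq_iInter]
  exact AnalyticSet.iInter fun b => by cases b <;> assumption

theorem _root_.MeasureTheory.AnalyticSet.union {α : Type*} [TopologicalSpace α]
    {s t : Set α} (hs : AnalyticSet s) (ht : AnalyticSet t) : AnalyticSet (s ∪ t) := by
  rw [Set.union_eq_iUnion]
  exact AnalyticSet.iUnion fun b => by cases b <;> assumption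

/-! ### Simulations between well-founded relations -/

/-- The rank of `a` with respect to `r`, with value `0` at inaccessible points. -/
def accRank {N : Type} (r : N → N → Prop) (a : N) : Ordinal.{0} :=
  open Classical in if h : Acc r a then h.rank else 0

theorem accRank_lt {N : Type} {r : N → N → Prop} {a b : N} (hb : Acc r b) (h : r a b) :
    accRank r a < accRank r b := by
  simp only [accRank, hb, hb.inv h, dif_pos]
  exact hb.rank_lt_of_rel h

theorem exists_le_accRank {N : Type} {r : N → N → Prop} {a : N} (ha : Acc r a) {o : Ordinal.{0}}
    (ho : o < accRank r a) : ∃ b, r b a ∧ o ≤ accRank r b := by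
  simp only [accRank, ha, dif_pos] at ho
  rw [ha.rank_eq, Ordinal.lt_iSup_iff] at ho
  obtain ⟨⟨b, hb⟩, ho⟩ := ho
  refine ⟨b, hb, ?_⟩
  simp only [accRank, ha.inv hb, dif_pos]
  exact Order.lt_succ_iff.1 ho

/-- There is a simulation of `r'` by `r` that relates `a` to `b`. -/
def Simulates {N : Type} (r' r : N → N → Prop) (a b : N) : Prop :=
  ∃ R : N → N → Bool,
    (∀ t u, R t u = true → ∀ t', r' t' t → ∃ u', r u' u ∧ R t' u' = true) ∧ R a b = true

theorem Simulates.acc_and_accRank_le {N : Type} {r' r : N → N → Prop} {a b : N}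
    (h : Simulates r' r a b) (hb : Acc r b) : Acc r' a ∧ accRank r' a ≤ accRank r b := by
  obtain ⟨R, hR, hab⟩ := h
  induction hb generalizing a with
  | intro b hb ih =>
    have hacc : Acc r' a := by
      refine Acc.intro a fun a' ha' => ?_
      obtain ⟨u, hu, hRu⟩ := hR a b hab a' ha'
      exact (ih u hu hRu).1
    refine ⟨hacc, le_of_not_gt fun hlt => ?_⟩
    obtain ⟨a', ha', hle⟩ := exists_le_accRank hacc hlt
    obtain ⟨u, hu, hRu⟩ := hR a b hab a' ha'
    exact absurd (hle.trans (ih u hu hRu).2) (not_le_of_gt (accRank_lt (Acc.intro b hb) hu))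

theorem simulates_iff {N : Type} {r' r : N → N → Prop} (h' : WellFounded r') (h : WellFounded r)
    (a b : N) : Simulates r' r a b ↔ accRank r' a ≤ accRank r b := by
  classical
  refine ⟨fun hs => (hs.acc_and_accRank_le (h.apply b)).2, fun hle => ?_⟩
  refine ⟨fun t u => decide (accRank r' t ≤ accRank r u), fun t u htu t' ht' => ?_, by simpa⟩
  simp only [decide_eq_true_eq] at htu ⊢
  exact exists_le_accRank (h.apply u) ((accRank_lt (h'.apply t) ht').trans_le htu)

/-- There is a simulation of `r'` by `r` that relates `a` to a point strictly below `b`. -/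
def StrictlySimulates {N : Type} (r' r : N → N → Prop) (a b : N) : Prop :=
  ∃ u, r u b ∧ Simulates r' r a u

theorem StrictlySimulates.acc {N : Type} {r' r : N → N → Prop} {a b : N}
    (h : StrictlySimulates r' r a b) (hb : Acc r b) : Acc r' a := by
  obtain ⟨u, hu, hs⟩ := h
  exact (hs.acc_and_accRank_le (hb.inv hu)).1

theorem strictlySimulates_iff {N : Type} {r' r : N → N → Prop} (h' : WellFounded r')
    (h : WellFounded r) (a b : N) :
    StrictlySimulates r' r a b ↔ accRank r' a < accRank r b := by
  refine ⟨fun ⟨u, hu, hs⟩ => ?_, fun hlt => ?_⟩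
  · exact ((simulates_iff h' h a u).1 hs).trans_lt (accRank_lt (h.apply b) hu)
  · obtain ⟨u, hu, hle⟩ := exists_le_accRank (h.apply b) hlt
    exact ⟨u, hu, (simulates_iff h' h a u).2 hle⟩

theorem analyticSet_simulates {V N : Type} [TopologicalSpace V] [PolishSpace V] [Countable N]
    (r : V → N → N → Prop) (hr : ∀ a b, IsOpen {v | r v a b}) (a b : N) :
    AnalyticSet {p : V × V | Simulates (r p.1) (r p.2) a b} := by
  borelize V
  have hmeas : ∀ a b, Measurable fun v => r v a b := fun a b =>
    measurableSet_setOfPred.1 (hr a b).measurableSet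
  have hR : ∀ t u, Measurable fun q : (V × V) × (N → N → Bool) => q.2 t u = true := fun t u =>
    have h : Measurable fun q : (V × V) × (N → N → Bool) => q.2 t u :=
      (measurable_pi_apply u).comp ((measurable_pi_apply t).comp measurable_snd)
    measurableSet_setOfPred.1 (h (measurableSet_singleton true))
  have : PolishSpace (N → N → Bool) := { }
  have : MeasurableSet {q : (V × V) × (N → N → Bool) |
      (∀ t u, q.2 t u = true → ∀ t', r q.1.1 t' t → ∃ u', r q.1.2 u' u ∧ q.2 t' u' = true) ∧
        q.2 a b = true} := by
    refine measurableSet_setOfPred.2 (Measurable.and (Measurable.forall fun t =>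
      Measurable.forall fun u => (hR t u).imp (Measurable.forall fun t' =>
        Measurable.imp ((hmeas t' t).comp (measurable_fst.comp measurable_fst))
          (Measurable.exists fun u' =>
            Measurable.and ((hmeas u' u).comp (measurable_snd.comp measurable_fst)) (hR t' u'))))
      (hR a b))
  convert this.analyticSet.image_of_continuous continuous_fst
  ext p
  simp [Simulates]

theorem analyticSet_strictlySimulates {V N : Type} [TopologicalSpace V] [PolishSpace V]
    [Countable N] (r : V → N → N → Prop) (hr : ∀ a b, IsOpen {v | r v a b}) (a b : N) :
    AnalyticSet {p : V × V | StrictlySimulates (r p.1) (r p.2) a b} := by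
  have h : ∀ u, AnalyticSet ({p : V × V | r p.2 u b} ∩ {p | Simulates (r p.1) (r p.2) a u}) := by
    intro u
    borelize V
    exact (((hr u b).measurableSet.preimage measurable_snd).analyticSet).inter
      (analyticSet_simulates r hr a u)
  convert AnalyticSet.iUnion h
  ext p
  simp [StrictlySimulates]

/-! ### Lexicographic minimization -/

/-- The points of `A` that successively minimize the first `n` of the functions `κ`. -/
def minStage {Y W : Type*} [LE W] (κ : ℕ → Y → W) (A : Set Y) : ℕ → Set Y
  | 0 => A
  | n + 1 => {y | y ∈ minStage κ A n ∧ ∀ y' ∈ minStage κ A n, κ n y ≤ κ n y'}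

theorem minStage_antitone {Y W : Type*} [LE W] (κ : ℕ → Y → W) (A : Set Y) :
    Antitone (minStage κ A) :=
  antitone_nat_of_succ_le fun _ _ hy => hy.1

theorem exists_lexMin {Y W : Type*} [LinearOrder W] [WellFoundedLT W] (κ : ℕ → Y → W)
    (A : Set Y) (hA : A.Nonempty)
    (hlim : ∀ (w : ℕ → Y) (l : ℕ → W), (∀ n, w n ∈ A) → (∀ n m, n < m → κ n (w m) = l n) →
      ∃ y ∈ A, ∀ n, κ n y ≤ l n) :
    ∃ y ∈ A, ∀ y' ∈ A, ∀ n, (∀ m < n, κ m y' ≤ κ m y) → κ n y ≤ κ n y' := by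
  have hne : ∀ n, (minStage κ A n).Nonempty := by
    intro n
    induction n with
    | zero => exact hA
    | succ n ih =>
      obtain ⟨w, ⟨y, hy, rfl⟩, hmin⟩ :=
        wellFounded_lt.has_min (κ n '' minStage κ A n) (ih.image _)
      exact ⟨y, hy, fun y' hy' => not_lt.1 (hmin _ ⟨y', hy', rfl⟩)⟩
  choose w hw using hne
  obtain ⟨y, hyA, hy⟩ := hlim w (fun n => κ n (w (n + 1)))
    (fun n => minStage_antitone κ A (Nat.zero_le n) (hw n)) (by
      intro n m hnm
      have hm : w m ∈ minStage κ A (n + 1) := minStage_antitone κ A hnm (hw m)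
      exact le_antisymm (hm.2 _ (hw (n + 1)).1) ((hw (n + 1)).2 _ hm.1))
  have hstage : ∀ y', y' ∈ A → ∀ n, (∀ m < n, κ m y' ≤ κ m (w (m + 1))) → y' ∈ minStage κ A n := by
    intro y' hy' n
    induction n with
    | zero => exact fun _ => hy'
    | succ n ih =>
      exact fun h => ⟨ih fun m hm => h m (hm.trans n.lt_succ_self), fun y'' hy'' =>
        (h n n.lt_succ_self).trans ((hw (n + 1)).2 _ hy'')⟩
  refine ⟨y, hyA, fun y' hy' n h => ?_⟩
  exact (hy n).trans ((hw (n + 1)).2 _ (hstage y' hy' n fun m hm => (h m hm).trans (hy m)))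

/-! ### Uniformization of coanalytic sets -/

open Filter Topology in
/-- A set presented by well-founded relations, depending on the point in an open way, has a
coanalytic uniformization. -/
theorem exists_uniformization_of_wellFounded {Z N : Type} [TopologicalSpace Z] [PolishSpace Z]
    [Countable N] (C : Set (Z × (ℕ → ℕ))) (hC : AnalyticSet Cᶜ)
    (r : Z × (ℕ → ℕ) → N → N → Prop) (hr : ∀ a b, IsOpen {v | r v a b}) (root : N)
    (hwf : ∀ v ∈ C, WellFounded (r v)) (hroot : ∀ v, Acc (r v) root → v ∈ C) :
    ∃ U ⊆ C, AnalyticSet Uᶜ ∧ (∀ z y, (z, y) ∈ C → ∃ x, (z, x) ∈ U) ∧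
      ∀ z x x', (z, x) ∈ U → (z, x') ∈ U → x = x' := by
  obtain ⟨e, he, he0⟩ : ∃ e : ℕ → N, Function.Surjective e ∧ e 0 = root := by
    have : Nonempty N := ⟨root⟩
    obtain ⟨e, he⟩ := exists_surjective_nat N
    exact ⟨fun n => n.casesOn root e, fun a => (he a).imp' (· + 1) fun _ h => h, rfl⟩
  -- the scale, and the relations comparing its values
  let κ : ℕ → Z × (ℕ → ℕ) → Ordinal.{0} ×ₗ ℕ := fun n v => toLex (accRank (r v) (e n), v.2 n)
  let L : ℕ → Set ((Z × (ℕ → ℕ)) × (Z × (ℕ → ℕ))) := fun n =>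
    {p | StrictlySimulates (r p.1) (r p.2) (e n) (e n)} ∪
      ({p | Simulates (r p.1) (r p.2) (e n) (e n)} ∩ {p | p.1.2 n ≤ p.2.2 n})
  let S : ℕ → Set ((Z × (ℕ → ℕ)) × (Z × (ℕ → ℕ))) := fun n =>
    {p | StrictlySimulates (r p.1) (r p.2) (e n) (e n)} ∪
      ({p | Simulates (r p.1) (r p.2) (e n) (e n)} ∩ {p | p.1.2 n < p.2.2 n})
  have hco1 : ∀ n, Continuous fun p : (Z × (ℕ → ℕ)) × (Z × (ℕ → ℕ)) => p.1.2 n := by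
    intro n; fun_prop
  have hco2 : ∀ n, Continuous fun p : (Z × (ℕ → ℕ)) × (Z × (ℕ → ℕ)) => p.2.2 n := by
    intro n; fun_prop
  have hLan : ∀ n, AnalyticSet (L n) := fun n =>
    (analyticSet_strictlySimulates r hr _ _).union
      ((analyticSet_simulates r hr _ _).inter (isClosed_le (hco1 n) (hco2 n)).analyticSet)
  have hSan : ∀ n, AnalyticSet (S n) := by
    intro n
    refine (analyticSet_strictlySimulates r hr _ _).union
      ((analyticSet_simulates r hr _ _).inter (IsClosed.analyticSet ?_))
    exact isClosed_le ((continuous_of_discreteTopology (f := Nat.succ)).comp (hco1 n)) (hco2 n)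
  have hL : ∀ n v' v, v' ∈ C → v ∈ C → ((v', v) ∈ L n ↔ κ n v' ≤ κ n v) := by
    intro n v' v hv' hv
    have h1 := simulates_iff (hwf v' hv') (hwf v hv) (e n) (e n)
    have h2 := strictlySimulates_iff (hwf v' hv') (hwf v hv) (e n) (e n)
    simp only [L, κ, Set.mem_union, Set.mem_inter_iff, Set.mem_ofPred_eq, h1, h2,
      Prod.Lex.toLex_le_toLex, le_iff_lt_or_eq (a := accRank _ _)]
    tauto
  have hS : ∀ n v' v, v' ∈ C → v ∈ C → ((v', v) ∈ S n ↔ κ n v' < κ n v) := by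
    intro n v' v hv' hv
    have h1 := simulates_iff (hwf v' hv') (hwf v hv) (e n) (e n)
    have h2 := strictlySimulates_iff (hwf v' hv') (hwf v hv) (e n) (e n)
    simp only [S, κ, Set.mem_union, Set.mem_inter_iff, Set.mem_ofPred_eq, h1, h2,
      Prod.Lex.toLex_lt_toLex, le_iff_lt_or_eq (a := accRank _ _)]
    tauto
  have hL0 : ∀ v' v, v ∈ C → (v', v) ∈ L 0 → v' ∈ C := by
    rintro v' v hv (h | ⟨h, -⟩)
    · exact hroot _ (he0 ▸ h.acc ((hwf v hv).apply _))
    · exact hroot _ (he0 ▸ (h.acc_and_accRank_le ((hwf v hv).apply _)).1)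
  have hS0 : ∀ v' v, v ∈ C → (v', v) ∈ S 0 → v' ∈ C := by
    rintro v' v hv (h | ⟨h, -⟩)
    · exact hroot _ (he0 ▸ h.acc ((hwf v hv).apply _))
    · exact hroot _ (he0 ▸ (h.acc_and_accRank_le ((hwf v hv).apply _)).1)
  have hbad : ∀ v' v n, v ∈ C → (∀ m < n, (v', v) ∈ L m) → (v', v) ∈ S n → v' ∈ C := by
    intro v' v n hv h1 h2
    rcases n.eq_zero_or_pos with rfl | hn
    · exact hS0 v' v hv h2
    · exact hL0 v' v hv (h1 0 hn)
  -- the lexicographically minimal points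
  refine ⟨{v | v ∈ C ∧ ∀ y' n, ¬ ((∀ m < n, ((v.1, y'), v) ∈ L m) ∧ ((v.1, y'), v) ∈ S n)},
    fun v hv => hv.1, ?_, ?_, ?_⟩
  · let g : (Z × (ℕ → ℕ)) × (ℕ → ℕ) → (Z × (ℕ → ℕ)) × (Z × (ℕ → ℕ)) :=
      fun q => ((q.1.1, q.2), q.1)
    have hg : Continuous g := by fun_prop
    have han : ∀ n, AnalyticSet ((⋂ m : ℕ, {p | m < n → p ∈ L m}) ∩ S n) := by
      intro n
      refine (AnalyticSet.iInter fun m => ?_).inter (hSan n)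
      by_cases hm : m < n
      · simpa [hm] using hLan m
      · simpa [hm] using isClosed_univ.analyticSet
    convert hC.union (AnalyticSet.iUnion fun n =>
      ((han n).preimage hg).image_of_continuous continuous_fst)
    ext v
    simp only [g, Set.mem_compl_iff, Set.mem_ofPred_eq, Set.mem_union, Set.mem_iUnion,
      Set.mem_image, Set.mem_preimage, Set.mem_inter_iff, Set.mem_iInter, Prod.exists,
      exists_and_right, exists_eq_right]
    constructor
    · intro h
      by_cases hv : v ∈ C
      · right
        push Not at h
        obtain ⟨y', n, h⟩ := h hv
        exact ⟨n, y', h⟩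
      · exact Or.inl hv
    · rintro (h | ⟨n, y', h⟩) ⟨hv, h'⟩
      · exact h hv
      · exact h' y' n h
  · intro z y hy
    obtain ⟨x, hx, hmin⟩ := exists_lexMin (fun n x => κ n (z, x)) {x | (z, x) ∈ C} ⟨y, hy⟩ (by
      intro w l hw hl
      have hl1 : ∀ n m, n < m → accRank (r (z, w m)) (e n) = (ofLex (l n)).1 := fun n m h => by
        rw [← hl n m h]; rfl
      have hl2 : ∀ n m, n < m → w m n = (ofLex (l n)).2 := fun n m h => by
        rw [← hl n m h]; rfl
      set x : ℕ → ℕ := fun n => (ofLex (l n)).2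
      have hlim : Tendsto (fun m => (z, w m)) atTop (𝓝 (z, x)) := by
        refine tendsto_const_nhds.prodMk_nhds (tendsto_pi_nhds.2 fun n => ?_)
        refine tendsto_const_nhds.congr' ?_
        filter_upwards [eventually_gt_atTop n] with m hm
        exact (hl2 n m hm).symm
      have hlt : ∀ a b, r (z, x) (e b) (e a) → (ofLex (l b)).1 < (ofLex (l a)).1 := by
        intro a b hab
        obtain ⟨m, hm, hma, hmb⟩ := ((hlim.eventually ((hr (e b) (e a)).mem_nhds hab)).and
          ((eventually_gt_atTop a).and (eventually_gt_atTop b))).exists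
        rw [← hl1 a m hma, ← hl1 b m hmb]
        exact accRank_lt ((hwf _ (hw m)).apply _) hm
      have hwfx : WellFounded (r (z, x)) := by
        refine Subrelation.wf (r := InvImage (· < ·)
          fun t => (ofLex (l (Function.surjInv he t))).1) ?_ (InvImage.wf _ wellFounded_lt)
        intro t u htu
        apply hlt
        rwa [Function.surjInv_eq he, Function.surjInv_eq he]
      have hle : ∀ t a, e a = t → accRank (r (z, x)) t ≤ (ofLex (l a)).1 := by
        intro t
        induction t using hwfx.induction with
        | _ t ih =>
          rintro a rfl
          refine le_of_not_gt fun h => ?_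
          obtain ⟨u, hu, hle⟩ := exists_le_accRank (hwfx.apply _) h
          obtain ⟨b, rfl⟩ := he u
          exact absurd ((hlt a b hu).trans_le hle) (not_lt_of_ge (ih _ hu b rfl))
      refine ⟨x, hroot _ (hwfx.apply _), fun n => ?_⟩
      rw [← toLex_ofLex (l n), Prod.Lex.toLex_le_toLex]
      rcases (hle _ n rfl).lt_or_eq with h | h
      · exact Or.inl h
      · exact Or.inr ⟨h, le_rfl⟩)
    refine ⟨x, hx, fun y' n ⟨h1, h2⟩ => ?_⟩
    have hy' : (z, y') ∈ C := hbad _ _ n hx h1 h2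
    exact not_lt_of_ge (hmin y' hy' n fun m hm => (hL m _ _ hy' hx).1 (h1 m hm))
      ((hS n _ _ hy' hx).1 h2)
  · rintro z x x' ⟨hx, hmin⟩ ⟨hx', hmin'⟩
    have hκ : ∀ n, κ n (z, x) = κ n (z, x') := by
      intro n
      induction n using Nat.strong_induction_on with
      | _ n ih =>
        apply le_antisymm
        · refine le_of_not_gt fun h => hmin x' n ⟨fun m hm => ?_, (hS n _ _ hx' hx).2 h⟩
          exact (hL m _ _ hx' hx).2 (ih m hm).ge
        · refine le_of_not_gt fun h => hmin' x n ⟨fun m hm => ?_, (hS n _ _ hx hx').2 h⟩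
          exact (hL m _ _ hx hx').2 (ih m hm).le
    funext n
    exact congrArg (fun k => (ofLex k).2) (hκ n)

open PiNat Filter Topology in
/-- **Kondo's uniformization theorem**, for coanalytic subsets of `Z × (ℕ → ℕ)`. -/
theorem exists_uniformization {Z : Type} [TopologicalSpace Z] [PolishSpace Z]
    (C : Set (Z × (ℕ → ℕ))) (hC : AnalyticSet Cᶜ) :
    ∃ U ⊆ C, AnalyticSet Uᶜ ∧ (∀ z y, (z, y) ∈ C → ∃ x, (z, x) ∈ U) ∧
      ∀ z x x', (z, x) ∈ U → (z, x') ∈ U → x = x' := by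
  have hC' := hC
  rw [AnalyticSet] at hC'
  rcases hC' with hemp | ⟨g, hg, hrange⟩
  · refine exists_uniformization_of_wellFounded C hC (N := Unit) (fun _ _ _ => False)
      (fun _ _ => by simp) () (fun _ _ => ⟨fun _ => ⟨_, fun _ h => h.elim⟩⟩) fun v _ => ?_
    rw [Set.compl_empty_iff] at hemp
    simp [hemp]
  let _ := TopologicalSpace.upgradeIsCompletelyMetrizable (Z × (ℕ → ℕ))
  -- the tree of attempts to find a preimage of `v` under `g`
  let T : Z × (ℕ → ℕ) → List ℕ → Prop := fun v s =>
    ∃ x, res x s.length = s ∧ dist v (g x) < 1 / ((s.length : ℝ) + 1)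
  have hT : ∀ v i s, T v (i :: s) → T v s := by
    rintro v i s ⟨x, hx, hd⟩
    rw [List.length_cons, res_succ, List.cons.injEq] at hx
    refine ⟨x, hx.2, hd.trans_le (one_div_le_one_div_of_le (by positivity) ?_)⟩
    push_cast [List.length_cons]
    linarith
  let r : Z × (ℕ → ℕ) → List ℕ → List ℕ → Prop := fun v s t => (∃ i, s = i :: t) ∧ T v s
  have hacc : ∀ v, Acc (r v) [] → v ∈ C := by
    intro v hv
    by_contra hvC
    rw [← Set.mem_compl_iff, ← hrange] at hvC
    obtain ⟨x, rfl⟩ := hvC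
    refine not_acc_iff_exists_descending_chain.2 ⟨res x, rfl, fun n => ⟨⟨x n, rfl⟩, x, ?_, ?_⟩⟩ hv
    · rw [res_length]
    · rw [dist_self]; positivity
  have hroot : ∀ v ∈ C, Acc (r v) [] := by
    intro v hv
    by_contra hna
    obtain ⟨f, hf0, hf⟩ := not_acc_iff_exists_descending_chain.1 hna
    choose i hi using fun n => (hf n).1
    have hfi : ∀ n, f n = res i n := by
      intro n
      induction n with
      | zero => rw [hf0, res_zero]
      | succ n ih => rw [hi, ih, res_succ]
    choose x hx hd using fun n => (hf n).2
    have hlen : ∀ n, (f n).length = n := fun n => by rw [hfi, res_length]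
    simp only [hlen] at hx hd
    have hxi : Tendsto x atTop (𝓝 i) := by
      refine tendsto_pi_nhds.2 fun k => tendsto_const_nhds.congr' ?_
      filter_upwards [eventually_ge_atTop k] with n hn
      have h := hx n
      rw [hfi, res_eq_res] at h
      exact (h (Nat.lt_succ_of_le hn)).symm
    have hgv : Tendsto (fun n => g (x n)) atTop (𝓝 v) := by
      rw [tendsto_iff_dist_tendsto_zero]
      refine squeeze_zero (fun _ => dist_nonneg) (fun n => ?_)
        ((tendsto_one_div_add_atTop_nhds_zero_nat (𝕜 := ℝ)).comp (tendsto_add_atTop_nat 1))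
      rw [dist_comm]
      exact (hd n).le
    have : g i = v := tendsto_nhds_unique ((hg.tendsto i).comp hxi) hgv
    have hmem : v ∈ Cᶜ := hrange ▸ ⟨i, this⟩
    exact hmem hv
  refine exists_uniformization_of_wellFounded C hC r ?_ [] ?_ hacc
  · intro s t
    by_cases hst : ∃ i, s = i :: t
    · simp only [r, hst, true_and, T, Set.ofPred_exists, Set.ofPred_and]
      refine isOpen_iUnion fun x => isOpen_const.inter ?_
      exact isOpen_lt (continuous_id.dist continuous_const) continuous_const
    · simp [r, hst]
  · intro v hv
    refine ⟨fun s => ?_⟩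
    induction s with
    | nil => exact hroot v hv
    | cons i s ih =>
      by_cases h : T v (i :: s)
      · exact ih.inv ⟨⟨i, rfl⟩, h⟩
      · refine ⟨_, ?_⟩
        rintro _ ⟨⟨j, rfl⟩, hj⟩
        exact absurd (hT _ _ _ hj) h

/-- A difference of analytic sets has a uniformization all of whose Borel restrictions have a
`Σ¹₂` projection. -/
theorem exists_uniformization_sdiff {Z Y : Type} [TopologicalSpace Z] [PolishSpace Z]
    [MeasurableSpace Z] [BorelSpace Z] [TopologicalSpace Y] [MeasurableSpace Y]
    [BorelSpace Y] [T2Space Y] (A B : Set (Z × Y)) (hA : AnalyticSet A) (hB : AnalyticSet B) :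
    ∃ U ⊆ A \ B, (∀ z y, (z, y) ∈ A \ B → ∃ x, (z, x) ∈ U) ∧
      (∀ z x x', (z, x) ∈ U → (z, x') ∈ U → x = x') ∧
      ∀ S : Set Y, MeasurableSet S → IsSigma12 {z | ∃ y ∈ S, (z, y) ∈ U} := by
  have hmeas : @Measurable (Z × (ℕ → ℕ)) Z (borel _) _ Prod.fst := by
    rw [← BorelSpace.measurable_eq (α := Z × (ℕ → ℕ))]
    exact measurable_fst
  rw [AnalyticSet] at hA
  rcases hA with rfl | ⟨g, hg, rfl⟩
  · refine ⟨∅, by simp, by simp, by simp, fun S _ => ?_⟩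
    refine ⟨Z × (ℕ → ℕ), inferInstance, inferInstance, ∅, Prod.fst, ?_, hmeas, by simp⟩
    rw [Set.compl_empty]
    exact isClosed_univ.analyticSet
  have hcont : Continuous fun v : Z × (ℕ → ℕ) => g v.2 := hg.comp continuous_snd
  obtain ⟨U, hUC, hU, hex, huniq⟩ :=
    exists_uniformization {v : Z × (ℕ → ℕ) | (g v.2).1 = v.1 ∧ g v.2 ∉ B} (by
      have h1 : AnalyticSet {v : Z × (ℕ → ℕ) | (g v.2).1 = v.1}ᶜ :=
        (isClosed_eq (continuous_fst.comp hcont) continuous_fst).measurableSet.compl.analyticSet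
      convert h1.union (hB.preimage hcont)
      ext v
      simp only [Set.mem_compl_iff, Set.mem_ofPred_eq, Set.mem_union, Set.mem_preimage]
      tauto)
  refine ⟨{p | ∃ x, (p.1, x) ∈ U ∧ (g x).2 = p.2}, ?_, ?_, ?_, fun S hS => ?_⟩
  · rintro ⟨z, y⟩ ⟨x, hx, rfl⟩
    obtain ⟨rfl : (g x).1 = z, h⟩ := hUC hx
    exact ⟨⟨x, rfl⟩, h⟩
  · rintro z y ⟨⟨x, hx⟩, hB'⟩
    obtain ⟨x', hx'⟩ := hex z x ⟨by rw [hx], by rwa [hx]⟩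
    exact ⟨_, x', hx', rfl⟩
  · rintro z _ _ ⟨x, hx, rfl⟩ ⟨x', hx', rfl⟩
    rw [huniq z x x' hx hx']
  · refine ⟨Z × (ℕ → ℕ), inferInstance, inferInstance, U ∩ {v | (g v.2).2 ∈ S}, Prod.fst, ?_,
      hmeas, ?_⟩
    · rw [Set.compl_inter]
      exact hU.union (((continuous_snd.comp hcont).measurable hS).compl.analyticSet)
    · ext z
      simp only [Set.mem_image, Set.mem_inter_iff, Set.mem_ofPred_eq, Prod.exists, exists_and_right,
        exists_eq_right]
      constructor
      · rintro ⟨x, hx, hS⟩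
        exact ⟨_, hS, x, hx, rfl⟩
      · rintro ⟨_, hS, x, hx, rfl⟩
        exact ⟨x, hx, hS⟩

/-! ### Universal measurability -/

theorem UniversallyMeasurableSet.preimage {α β : Type*} [MeasurableSpace α] [MeasurableSpace β]
    [MeasurableSpace.CountablyGenerated β] {f : α → β} (hf : UniversallyMeasurable f)
    {s : Set β} (hs : UniversallyMeasurableSet s) : UniversallyMeasurableSet (f ⁻¹' s) := by
  intro μ hμ
  obtain ⟨g, hg, hfg⟩ : AEMeasurable f μ :=
    NullMeasurable.aemeasurable fun t ht => hf t ht μ hμ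
  have hp := Measure.isProbabilityMeasure_map (μ := μ) hg.aemeasurable
  exact ((hs (μ.map g) hp).preimage (hg.quasiMeasurePreserving μ)).congr (hfg.symm.preimage s)

theorem universallyMeasurable_iff {α β : Type*} [MeasurableSpace α] [MeasurableSpace β]
    {f : α → β} : UniversallyMeasurable f ↔
      ∀ μ : Measure α, IsProbabilityMeasure μ → NullMeasurable f μ :=
  ⟨fun h μ hμ s hs => h s hs μ hμ, fun h _ hs μ hμ => h μ hμ hs⟩

theorem universallyMeasurable_of_aemeasurable {α β : Type*} [MeasurableSpace α]
    [MeasurableSpace β] {f : α → β}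
    (h : ∀ μ : Measure α, IsProbabilityMeasure μ → AEMeasurable f μ) : UniversallyMeasurable f :=
  universallyMeasurable_iff.2 fun μ hμ => (h μ hμ).nullMeasurable

theorem UniversallyMeasurable.aemeasurable {α β : Type*} [MeasurableSpace α]
    [MeasurableSpace β] [MeasurableSpace.CountablyGenerated β] {f : α → β}
    (hf : UniversallyMeasurable f) (μ : Measure α) [hμ : IsProbabilityMeasure μ] :
    AEMeasurable f μ :=
  (universallyMeasurable_iff.1 hf μ hμ).aemeasurable

theorem UniversallyMeasurable.ite {α β : Type*} [MeasurableSpace α]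
    [MeasurableSpace β] {p : α → Prop} [DecidablePred p] {f g : α → β}
    (hp : UniversallyMeasurableSet {x | p x}) (hf : UniversallyMeasurable f)
    (hg : UniversallyMeasurable g) : UniversallyMeasurable fun x => if p x then f x else g x := by
  refine universallyMeasurable_iff.2 fun μ hμ => ?_
  exact Measurable.ite (hp μ hμ) (universallyMeasurable_iff.1 hf μ hμ)
    (universallyMeasurable_iff.1 hg μ hμ)

/-- Proposition `prp-ext-sel`: assume every `Σ¹₂` subset of a Borel
space is universally measurable (a consequence of analytic determinacy). For an analytic
set `D ⊂ X × Y` and an upper semianalytic `f : D → [−∞,∞]`, the partial infimum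
`f*(x) = inf_{y ∈ D_x} f(x,y)` is universally measurable, the set `E*` of points where
the infimum is attained is universally measurable, and for each `ε > 0` there is a
universally measurable selection `ψ` of `D` that is exactly minimizing on `E*` and
`ε`-minimizing elsewhere. -/
theorem statement17
    (hAD : ∀ (γ : Type) [TopologicalSpace γ] [PolishSpace γ]
      [MeasurableSpace γ] [BorelSpace γ] (s : Set γ),
      IsSigma12 s → UniversallyMeasurableSet s)
    {X Y : Type} [TopologicalSpace X] [PolishSpace X] [MeasurableSpace X] [BorelSpace X]
    [TopologicalSpace Y] [PolishSpace Y] [MeasurableSpace Y] [BorelSpace Y]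
    (D : Set (X × Y)) (hD : MeasureTheory.AnalyticSet D)
    (f : X × Y → EReal) (hf : UpperSemianalyticOn D f) :
    -- (i) `f*` is universally measurable
    UniversallyMeasurable (fun x : X => ⨅ (y : Y) (_ : (x, y) ∈ D), f (x, y)) ∧
    -- (ii) `E*` is universally measurable and `ε`-optimal selections exist
    UniversallyMeasurableSet
      {x : X | ∃ y : Y, (x, y) ∈ D ∧
        f (x, y) = ⨅ (y' : Y) (_ : (x, y') ∈ D), f (x, y')} ∧
    ∀ ε : ℝ, 0 < ε →
      ∃ ψ : {x : X // ∃ y : Y, (x, y) ∈ D} → Y,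
        UniversallyMeasurable ψ ∧
        ∀ x : {x : X // ∃ y : Y, (x, y) ∈ D},
          ((x : X), ψ x) ∈ D ∧
          ((∃ y : Y, ((x : X), y) ∈ D ∧
              f ((x : X), y) = ⨅ (y' : Y) (_ : ((x : X), y') ∈ D), f ((x : X), y')) →
            f ((x : X), ψ x) = ⨅ (y' : Y) (_ : ((x : X), y') ∈ D), f ((x : X), y')) ∧
          (¬ (∃ y : Y, ((x : X), y) ∈ D ∧
              f ((x : X), y) = ⨅ (y' : Y) (_ : ((x : X), y') ∈ D), f ((x : X), y')) →
            ((⨅ (y' : Y) (_ : ((x : X), y') ∈ D), f ((x : X), y')) ≠ ⊥ →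
              f ((x : X), ψ x)
                ≤ (⨅ (y' : Y) (_ : ((x : X), y') ∈ D), f ((x : X), y')) + (ε : EReal)) ∧
            ((⨅ (y' : Y) (_ : ((x : X), y') ∈ D), f ((x : X), y')) = ⊥ →
              f ((x : X), ψ x) ≤ ((-ε⁻¹ : ℝ) : EReal))) := by
  classical
  set fs : X → EReal := fun x => ⨅ (y : Y) (_ : (x, y) ∈ D), f (x, y) with hfs
  have hfs_lt : ∀ x a, fs x < a ↔ ∃ y, (x, y) ∈ D ∧ f (x, y) < a := by
    intro x a
    simp only [hfs, iInf_lt_iff, exists_prop]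
  have hfs_le : ∀ x y, (x, y) ∈ D → fs x ≤ f (x, y) := fun x y h => iInf₂_le y h
  have hfsm : UniversallyMeasurable fs := by
    have hproj : ∀ q : ℚ, UniversallyMeasurableSet
        {x | ∃ y, (x, y) ∈ D ∧ f (x, y) < ((q : ℝ) : EReal)} := by
      intro q
      obtain ⟨U, hU, hex, -, hS⟩ := exists_uniformization_sdiff D _ hD (hf q)
      convert hAD X _ (hS Set.univ MeasurableSet.univ) using 1
      ext x
      constructor
      · rintro ⟨y, hy, hlt⟩
        obtain ⟨y', hy'⟩ := hex x y ⟨hy, fun h => not_lt_of_ge h.2 hlt⟩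
        exact ⟨y', trivial, hy'⟩
      · rintro ⟨y, -, hy⟩
        exact ⟨y, (hU hy).1, lt_of_not_ge fun h => (hU hy).2 ⟨(hU hy).1, h⟩⟩
    refine universallyMeasurable_iff.2 fun μ hμ =>
      measurable_of_Iio (δ := NullMeasurableSpace X μ) fun a => ?_
    have heq : fs ⁻¹' Set.Iio a = ⋃ q : ℚ, ⋃ _ : ((q : ℝ) : EReal) < a,
        {x | ∃ y, (x, y) ∈ D ∧ f (x, y) < ((q : ℝ) : EReal)} := by
      ext x
      simp only [Set.mem_preimage, Set.mem_Iio, Set.mem_iUnion, Set.mem_ofPred_eq, exists_prop,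
        ← hfs_lt]
      rw [EReal.lt_iff_exists_rat_btwn]
      exact exists_congr fun q => and_comm
    change NullMeasurableSet (fs ⁻¹' Set.Iio a) μ
    rw [heq]
    exact NullMeasurableSet.iUnion fun q => NullMeasurableSet.iUnion fun _ => hproj q μ hμ
  -- uniformize the sublevel sets of `f`, with the level as a parameter
  obtain ⟨U, hU, hex, huniq, hS⟩ := exists_uniformization_sdiff
    {p : (X × EReal) × Y | (p.1.1, p.2) ∈ D}
    {p : (X × EReal) × Y | (p.1.1, p.2) ∈ D ∧ p.1.2 < f (p.1.1, p.2)}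
    (hD.preimage (by fun_prop)) (by
      have hπ : Continuous fun p : (X × EReal) × Y => (p.1.1, p.2) := by fun_prop
      have ht : Continuous fun p : (X × EReal) × Y => p.1.2 := by fun_prop
      convert AnalyticSet.iUnion fun q : ℚ =>
        (isOpen_lt ht (continuous_const (y := ((q : ℝ) : EReal)))).measurableSet.analyticSet.inter
          ((hf q).preimage hπ)
      ext p
      simp only [Set.mem_ofPred_eq, Set.mem_iUnion, Set.mem_inter_iff, Set.mem_preimage]
      constructor
      · rintro ⟨h, hlt⟩
        obtain ⟨q, h1, h2⟩ := EReal.lt_iff_exists_rat_btwn.1 hlt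
        exact ⟨q, h1, h, h2.le⟩
      · rintro ⟨q, h1, h, h2⟩
        exact ⟨h, h1.trans_le h2⟩)
  have hUle : ∀ x t y, ((x, t), y) ∈ U → (x, y) ∈ D ∧ f (x, y) ≤ t := fun x t y h =>
    ⟨(hU h).1, le_of_not_gt fun hlt => (hU h).2 ⟨(hU h).1, hlt⟩⟩
  have hUex : ∀ x t y, (x, y) ∈ D → f (x, y) ≤ t → ∃ y', ((x, t), y') ∈ U := fun x t y h hle =>
    hex (x, t) y ⟨h, fun h' => not_lt_of_ge hle h'.2⟩
  have hgraph : ∀ h : X → EReal, UniversallyMeasurable h →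
      UniversallyMeasurable fun x => (x, h x) := fun h hh =>
    universallyMeasurable_of_aemeasurable fun μ _ => aemeasurable_id.prodMk (hh.aemeasurable μ)
  have hpre : ∀ h : X → EReal, UniversallyMeasurable h → ∀ S : Set Y, MeasurableSet S →
      UniversallyMeasurableSet {x | ∃ y ∈ S, ((x, h x), y) ∈ U} := fun h hh S hSm =>
    (hAD _ _ (hS S hSm)).preimage (hgraph h hh)
  have hE : UniversallyMeasurableSet {x : X | ∃ y : Y, (x, y) ∈ D ∧ f (x, y) = fs x} := by
    convert hpre fs hfsm Set.univ MeasurableSet.univ using 1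
    ext x
    constructor
    · rintro ⟨y, hy, heq⟩
      obtain ⟨y', hy'⟩ := hUex x _ y hy heq.le
      exact ⟨y', trivial, hy'⟩
    · rintro ⟨y, -, hy⟩
      obtain ⟨h1, h2⟩ := hUle _ _ _ hy
      exact ⟨y, h1, h2.antisymm (hfs_le x y h1)⟩
  refine ⟨hfsm, hE, fun ε hε => ?_⟩
  -- the level at which to select
  let h : X → EReal := fun x => if ∃ y : Y, (x, y) ∈ D ∧ f (x, y) = fs x then fs x else
    if fs x = ⊥ then ((-ε⁻¹ : ℝ) : EReal) else fs x + (ε : EReal)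
  have hh : UniversallyMeasurable h := by
    refine UniversallyMeasurable.ite hE hfsm (UniversallyMeasurable.ite (hfsm {⊥} (measurableSet_singleton _))
      ?_ ?_)
    · exact universallyMeasurable_of_aemeasurable fun μ _ => aemeasurable_const
    · exact universallyMeasurable_of_aemeasurable fun μ _ =>
        (hfsm.aemeasurable μ).add aemeasurable_const
  have hsel : ∀ x : {x : X // ∃ y : Y, (x, y) ∈ D}, ∃ y, (((x : X), h x), y) ∈ U := by
    rintro ⟨x, y₀, hy₀⟩
    by_cases hx : ∃ y : Y, (x, y) ∈ D ∧ f (x, y) = fs x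
    · obtain ⟨y, hy, heq⟩ := hx
      refine hUex x _ y hy ?_
      rw [heq]
      exact (if_pos ⟨y, hy, heq⟩).ge
    · have hlt : fs x < h x := by
        simp only [h, if_neg hx]
        split_ifs with hbot
        · rw [hbot]
          exact EReal.bot_lt_coe _
        · have htop : fs x ≠ ⊤ := fun htop =>
            hx ⟨y₀, hy₀, (top_le_iff.1 (htop ▸ hfs_le x y₀ hy₀)).trans htop.symm⟩
          lift fs x to ℝ using ⟨htop, hbot⟩ with a
          rw [← EReal.coe_add, EReal.coe_lt_coe_iff]
          linarith
      obtain ⟨y, hy, hylt⟩ := (hfs_lt x _).1 hlt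
      exact hUex x _ y hy hylt.le
  choose ψ hψ using hsel
  refine ⟨ψ, fun S hSm => ?_, fun x => ?_⟩
  · have hval : UniversallyMeasurable
        (Subtype.val : {x : X // ∃ y : Y, (x, y) ∈ D} → X) :=
      universallyMeasurable_of_aemeasurable fun μ _ => measurable_subtype_coe.aemeasurable
    convert (hpre h hh S hSm).preimage hval using 1
    ext x
    constructor
    · exact fun hx => ⟨ψ x, hx, hψ x⟩
    · rintro ⟨y, hy, hyU⟩
      rw [Set.mem_preimage, huniq _ _ _ (hψ x) hyU]
      exact hy
  · obtain ⟨h1, h2⟩ := hUle _ _ _ (hψ x)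
    refine ⟨h1, fun hx => ?_, fun hx => ⟨fun hne => ?_, fun hbot => ?_⟩⟩
    · refine le_antisymm (h2.trans ?_) (hfs_le x _ h1)
      exact (if_pos hx).le
    · refine h2.trans ?_
      exact ((if_neg hx).trans (if_neg hne)).le
    · refine h2.trans ?_
      exact ((if_neg hx).trans (if_pos hbot)).le

end PaperStmt
end
end

section
/- Assume that every Σ¹₂ subset of a Borel space is universally measurable, and consider the minimax control model under Assumption AC and Assumption UA. Then with respect to the criterion J: (i) the optimal value function g(x) = inf over π_1 ∈ Π_1 of sup over π_2 ∈ Π_2 of J(π_1, π_2, x) is universally measurable on 𝕏; (ii) for each ε > 0, player 1 has a universally measurable ε-optimal policy π*_1 ∈ Π_1 that is moreover optimal for every state admitting an optimal policy. -/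
open MeasureTheory ProbabilityTheory Filter
open scoped ENNReal NNReal Topology

noncomputable section

namespace PaperStmt

/-- The Borel σ-algebra of the topology of weak convergence on the space of Borel
probability measures. -/
instance instMeasProb {Ω : Type*} [MeasurableSpace Ω] [TopologicalSpace Ω]
    [OpensMeasurableSpace Ω] : MeasurableSpace (ProbabilityMeasure Ω) := borel _


/-- Helper instance: the product topology on `P(Ω) × P(Ω)`. -/
instance instTopPMProd {α : Type*} [MeasurableSpace α] [TopologicalSpace α]
    [OpensMeasurableSpace α] :
    TopologicalSpace (ProbabilityMeasure α × ProbabilityMeasure α) :=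
  @instTopologicalSpaceProd _ _ inferInstance inferInstance

/-- Helper instance: the product σ-algebra on `P(Ω) × P(Ω)`. -/
instance instMeasPMProd {α : Type*} [MeasurableSpace α] [TopologicalSpace α]
    [OpensMeasurableSpace α] :
    MeasurableSpace (ProbabilityMeasure α × ProbabilityMeasure α) :=
  @Prod.instMeasurableSpace _ _ inferInstance inferInstance

/-- Upper semianalytic functions on a topological (Borel) space. -/
def UpperSemianalytic {γ : Type*} [TopologicalSpace γ] (f : γ → EReal) : Prop :=
  ∀ r : ℝ, MeasureTheory.AnalyticSet {x | (r : EReal) ≤ f x}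

/-- The sample space `Ω = (𝕏 × 𝔸₁ × 𝔸₂)^∞` of the minimax control model. -/
abbrev TrajM (X A1 A2 : Type*) := ℕ → X × A1 × A2

/-- Histories `h_n = (x_0, a_0, …, x_n)` of the minimax model. -/
abbrev HistM (X A1 A2 : Type*) (n : ℕ) := (Fin n → X × A1 × A2) × X

/-- Controller information vectors `i_n = (x_0, a¹_0, x_1, …, x_n)`. -/
abbrev InfoM (X A1 : Type*) (n : ℕ) := (Fin n → X × A1) × X

/-- The controller information vector determined by a history. -/
def infoM {X A1 A2 : Type*} : ∀ {n : ℕ}, HistM X A1 A2 n → InfoM X A1 n :=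
  fun {_} h => (fun k => ((h.1 k).1, (h.1 k).2.1), h.2)

/-- The controller information vector determined by a trajectory, up to time `n`. -/
def iProjM {X A1 A2 : Type*} (n : ℕ) (ω : TrajM X A1 A2) : InfoM X A1 n :=
  (fun k : Fin n => ((ω k.val).1, (ω k.val).2.1), (ω n).1)

/-- A universally measurable policy for player 1 (the controller), who observes only the
information vectors `i_n`. -/
structure Policy1 {X A1 : Type*} [MeasurableSpace X] [MeasurableSpace A1]
    (Acts1 : X → Set A1) where
  μ : ∀ n : ℕ, InfoM X A1 n → Measure A1
  isProb : ∀ n i, IsProbabilityMeasure (μ n i)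
  umeas : ∀ (n : ℕ) (B : Set A1), MeasurableSet B →
    UniversallyMeasurable fun i : InfoM X A1 n => μ n i B
  feasible : ∀ n i, μ n i (Acts1 i.2) = 1

/-- A universally measurable policy for player 2 (the opponent), who observes the full
histories `h_n`. -/
structure Policy2 (A1 : Type*) {X A2 : Type*} [MeasurableSpace X] [MeasurableSpace A1]
    [MeasurableSpace A2] (Acts2 : X → Set A2) where
  μ : ∀ n : ℕ, HistM X A1 A2 n → Measure A2
  isProb : ∀ n h, IsProbabilityMeasure (μ n h)
  umeas : ∀ (n : ℕ) (B : Set A2), MeasurableSet B →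
    UniversallyMeasurable fun h : HistM X A1 A2 n => μ n h B
  feasible : ∀ n h, μ n h (Acts2 h.2) = 1

variable {X A1 A2 : Type*} [MeasurableSpace X] [MeasurableSpace A1] [MeasurableSpace A2]

/-- The iterated integral giving the finite-dimensional distributions of the minimax
control model: the two players act simultaneously and independently. -/
def histIntM (p0 : Measure X) (q : Kernel (X × A1 × A2) X)
    (ν1 : ∀ n : ℕ, InfoM X A1 n → Measure A1)
    (ν2 : ∀ n : ℕ, HistM X A1 A2 n → Measure A2) :
    ∀ n : ℕ, (HistM X A1 A2 n → ℝ≥0∞) → ℝ≥0∞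
  | 0, g => ∫⁻ x, g (Fin.elim0, x) ∂p0
  | n + 1, g => histIntM p0 q ν1 ν2 n fun h =>
      ∫⁻ a1, ∫⁻ a2, ∫⁻ y, g (Fin.snoc h.1 (h.2, a1, a2), y)
        ∂(q (h.2, a1, a2)) ∂(ν2 n h) ∂(ν1 n (infoM h))

/-- `InducesM q π1 π2 p0 p` says that `p` is the strategic measure `ρ_{p0}[π₁, π₂]`. -/
def InducesM (q : Kernel (X × A1 × A2) X) {Acts1 : X → Set A1} {Acts2 : X → Set A2}
    (π1 : Policy1 Acts1) (π2 : Policy2 A1 Acts2)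
    (p0 : Measure X) (p : Measure (TrajM X A1 A2)) : Prop :=
  ∀ (n : ℕ) (B : Set (HistM X A1 A2 n)), MeasurableSet B →
    p {ω : TrajM X A1 A2 | ((fun i : Fin n => ω i.val), (ω n).1) ∈ B}
      = histIntM p0 q π1.μ π2.μ n (B.indicator fun _ => 1)

/-- The set `S_M` of all strategic measures of the minimax control model. -/
def SM (q : Kernel (X × A1 × A2) X) (Acts1 : X → Set A1) (Acts2 : X → Set A2) :
    Set (ProbabilityMeasure (TrajM X A1 A2)) :=
  {p | ∃ (π1 : Policy1 Acts1) (π2 : Policy2 A1 Acts2) (p0 : ProbabilityMeasure X),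
    InducesM q π1 π2 p0.toMeasure p.toMeasure}

/-- The section `tilde-S_M(x)`. -/
def tsecM (q : Kernel (X × A1 × A2) X) (Acts1 : X → Set A1) (Acts2 : X → Set A2) (x : X) :
    Set (ProbabilityMeasure (TrajM X A1 A2)) :=
  {p | p ∈ SM q Acts1 Acts2 ∧ p.toMeasure.map (fun ω => (ω 0).1) = Measure.dirac x}

/-- The set `tilde-S_M ⊂ 𝕏 × P(Ω)`. -/
def tsetM (q : Kernel (X × A1 × A2) X) (Acts1 : X → Set A1) (Acts2 : X → Set A2) :
    Set (X × ProbabilityMeasure (TrajM X A1 A2)) :=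
  {xp | xp.2 ∈ tsecM q Acts1 Acts2 xp.1}

/-- Assumption `AC` (Assumption 4.1 / `cond-minimax-abscont`): while player 1 uses the same
policy, the marginal distributions of the induced processes on the controller information
spaces `I_n` are mutually absolutely continuous. -/
def AssumpAC (q : Kernel (X × A1 × A2) X) (Acts1 : X → Set A1) (Acts2 : X → Set A2) : Prop :=
  ∀ (π1 : Policy1 Acts1) (π2 π2' : Policy2 A1 Acts2) (x : X)
    (p p' : ProbabilityMeasure (TrajM X A1 A2)),
    InducesM q π1 π2 (Measure.dirac x) p.toMeasure →
    InducesM q π1 π2' (Measure.dirac x) p'.toMeasure →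
    ∀ n : ℕ, p.toMeasure.map (iProjM n) ≪ p'.toMeasure.map (iProjM n)

end PaperStmt

namespace PaperStmt

variable {X A1 A2 : Type} [MeasurableSpace X] [MeasurableSpace A1] [MeasurableSpace A2]
  [TopologicalSpace X] [OpensMeasurableSpace X] [TopologicalSpace A1]
  [OpensMeasurableSpace A1] [TopologicalSpace A2] [OpensMeasurableSpace A2]

/-- `sup2 q Acts2 φ π1 x = sup_{π2 ∈ Π₂} J(π1, π2, x)`, expressed through strategic
measures. -/
def sup2 (q : Kernel (X × A1 × A2) X) {Acts1 : X → Set A1} (Acts2 : X → Set A2)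
    (φ : ProbabilityMeasure (TrajM X A1 A2) → EReal) (π1 : Policy1 Acts1) (x : X) :
    EReal :=
  ⨆ (π2 : Policy2 A1 Acts2) (p : ProbabilityMeasure (TrajM X A1 A2))
    (_ : InducesM q π1 π2 (Measure.dirac x) p.toMeasure), φ p

/-- The optimal value function of player 1:
`g(x) = inf_{π1 ∈ Π₁} sup_{π2 ∈ Π₂} J(π1, π2, x)`. -/
def gMinimax (q : Kernel (X × A1 × A2) X) (Acts1 : X → Set A1) (Acts2 : X → Set A2)
    (φ : ProbabilityMeasure (TrajM X A1 A2) → EReal) (x : X) : EReal :=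
  ⨅ π1 : Policy1 Acts1, sup2 q Acts2 φ π1 x

end PaperStmt

namespace Uniformization

open Set

theorem analyticSet_inter {α : Type*} [TopologicalSpace α] [T2Space α] {s t : Set α}
    (hs : AnalyticSet s) (ht : AnalyticSet t) : AnalyticSet (s ∩ t) := by
  rw [inter_eq_iInter]
  exact AnalyticSet.iInter fun b => by cases b <;> assumption

theorem analyticSet_union {α : Type*} [TopologicalSpace α] {s t : Set α}
    (hs : AnalyticSet s) (ht : AnalyticSet t) : AnalyticSet (s ∪ t) := by
  rw [union_eq_iUnion]
  exact AnalyticSet.iUnion fun b => by cases b <;> assumption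

/-! ### Comparing ranks through simulations -/

section Simulation

variable {α : Type}

/-- A simulation between two relations, linking `a` to `b`, exists. -/
def Simulates (r' r : α → α → Prop) (a b : α) : Prop :=
  ∃ Z : α × α → Bool, Z (a, b) = true ∧ ∀ v c, Z (v, c) = true → ∀ v', r' v' v →
    ∃ c', r c' c ∧ Z (v', c') = true

theorem simulates_iff {r' r : α → α → Prop} {a b : α} (hb : Acc r b) :
    Simulates r' r a b ↔ ∃ ha : Acc r' a, ha.rank ≤ hb.rank := by
  classical
  constructor
  · rintro ⟨Z, hab, hZ⟩
    induction hb generalizing a with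
    | intro b hb ih =>
      have hacc : Acc r' a := Acc.intro a fun v hv => by
        obtain ⟨c, hc, hvc⟩ := hZ a b hab v hv
        exact (ih c hc hvc).1
      refine ⟨hacc, ?_⟩
      rw [hacc.rank_eq]
      refine Ordinal.iSup_le fun ⟨v, hv⟩ => ?_
      obtain ⟨c, hc, hvc⟩ := hZ a b hab v hv
      obtain ⟨_, hle⟩ := ih c hc hvc
      exact Order.succ_le_of_lt (hle.trans_lt (Acc.rank_lt_of_rel (Acc.intro b hb) hc))
  · rintro ⟨ha, hab⟩
    refine ⟨fun p => decide (∃ (h' : Acc r' p.1) (h : Acc r p.2), h'.rank ≤ h.rank),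
      by simpa using ⟨ha, hb, hab⟩, ?_⟩
    simp only [decide_eq_true_eq]
    rintro v c ⟨hv, hc, hvc⟩ v' hv'
    have hlt := (Acc.rank_lt_of_rel hv hv').trans_le hvc
    rw [hc.rank_eq, Ordinal.lt_iSup_iff] at hlt
    obtain ⟨⟨c', hc'⟩, h⟩ := hlt
    exact ⟨c', hc', hv.inv hv', hc.inv hc', Order.lt_succ_iff.1 h⟩

theorem exists_simulates_iff {r' r : α → α → Prop} {a b : α} (hb : Acc r b) :
    (∃ c, r c b ∧ Simulates r' r a c) ↔ ∃ ha : Acc r' a, ha.rank < hb.rank := by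
  constructor
  · rintro ⟨c, hc, h⟩
    obtain ⟨ha, hle⟩ := (simulates_iff (hb.inv hc)).1 h
    exact ⟨ha, hle.trans_lt (Acc.rank_lt_of_rel hb hc)⟩
  · rintro ⟨ha, hlt⟩
    rw [hb.rank_eq, Ordinal.lt_iSup_iff] at hlt
    obtain ⟨⟨c, hc⟩, h⟩ := hlt
    exact ⟨c, hc, (simulates_iff (hb.inv hc)).2 ⟨ha, Order.lt_succ_iff.1 h⟩⟩

theorem analyticSet_simulates [Countable α] {D E : Type*} [TopologicalSpace D] [PolishSpace D]
    [MeasurableSpace D] [BorelSpace D] [TopologicalSpace E] [PolishSpace E]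
    [MeasurableSpace E] [BorelSpace E]
    {r' : D → α → α → Prop} {r : E → α → α → Prop}
    (hr' : ∀ v u, MeasurableSet {d | r' d v u}) (hr : ∀ v u, MeasurableSet {d | r d v u})
    (a b : α) : AnalyticSet {p : D × E | Simulates (r' p.1) (r p.2) a b} := by
  have : PolishSpace (α × α → Bool) := {}
  have hm : MeasurableSet {q : (D × E) × (α × α → Bool) | q.2 (a, b) = true ∧
      ∀ v c, q.2 (v, c) = true → ∀ v', r' q.1.1 v' v →
        ∃ c', r q.1.2 c' c ∧ q.2 (v', c') = true} := by
    have hZ : ∀ v c, Measurable fun q : (D × E) × (α × α → Bool) => q.2 (v, c) = true :=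
      fun v c => measurableSet_setOfPred.1 (measurableSet_eq_fun (by fun_prop) measurable_const)
    have h1 : ∀ v' v, Measurable fun q : (D × E) × (α × α → Bool) => r' q.1.1 v' v :=
      fun v' v => (measurableSet_setOfPred.1 (hr' v' v)).comp (by fun_prop)
    have h2 : ∀ v' v, Measurable fun q : (D × E) × (α × α → Bool) => r q.1.2 v' v :=
      fun v' v => (measurableSet_setOfPred.1 (hr v' v)).comp (by fun_prop)
    exact measurableSet_setOfPred.2 ((hZ a b).and (Measurable.forall fun v => Measurable.forall
      fun c => (hZ v c).imp (Measurable.forall fun v' => (h1 v' v).imp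
        (Measurable.exists fun c' => (h2 c' c).and (hZ v' c')))))
  convert hm.analyticSet.image_of_continuous continuous_fst
  ext p
  constructor
  · rintro ⟨Z, hZ⟩
    exact ⟨(p, Z), hZ, rfl⟩
  · rintro ⟨⟨p, Z⟩, hZ, rfl⟩
    exact ⟨Z, hZ⟩

end Simulation

/-! ### Tree representation of coanalytic sets -/

/-- A family of trees on `ℕ` (nodes are reversed lists), indexed by `S × ℕ^ℕ`, whose
dependence on the second coordinate is local. -/
structure LocalTree (S : Type*) [TopologicalSpace S] [MeasurableSpace S] where
  T : List ℕ → Set (S × (ℕ → ℕ))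
  measurable_T : ∀ u, MeasurableSet (T u)
  mem_of_agree : ∀ u s y y', (∀ i < u.length, y i = y' i) → (s, y) ∈ T u → (s, y') ∈ T u
  mem_of_cons : ∀ a u d, d ∈ T (a :: u) → d ∈ T u

namespace LocalTree

variable {S : Type*} [TopologicalSpace S] [MeasurableSpace S] (𝒯 : LocalTree S)

/-- `v` is an immediate successor of `u` in the tree at `d`. -/
def Child (d : S × (ℕ → ℕ)) (v u : List ℕ) : Prop := (∃ a, v = a :: u) ∧ d ∈ 𝒯.T v

theorem measurableSet_child (v u : List ℕ) : MeasurableSet {d | 𝒯.Child d v u} := by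
  by_cases h : ∃ a, v = a :: u
  · simpa [Child, h] using 𝒯.measurable_T v
  · simp [Child, h]

theorem wellFounded_child_iff (d : S × (ℕ → ℕ)) :
    WellFounded (𝒯.Child d) ↔ Acc (𝒯.Child d) [] := by
  refine ⟨fun h => h.apply _, fun h => ⟨fun u => ?_⟩⟩
  by_cases hu : d ∈ 𝒯.T u
  · induction u with
    | nil => exact h
    | cons a u ih => exact (ih (𝒯.mem_of_cons _ _ _ hu)).inv ⟨⟨a, rfl⟩, hu⟩
  · refine Acc.intro u fun v hv => ?_
    obtain ⟨⟨a, rfl⟩, hv⟩ := hv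
    exact absurd (𝒯.mem_of_cons _ _ _ hv) hu

/-- The rank of a node in a well-founded tree, with junk value `0` for other trees. -/
def rk (d : S × (ℕ → ℕ)) (u : List ℕ) : Ordinal.{0} :=
  open Classical in if h : WellFounded (𝒯.Child d) then (h.apply u).rank else 0

theorem rk_eq {d : S × (ℕ → ℕ)} (h : WellFounded (𝒯.Child d)) (u : List ℕ)
    (hu : Acc (𝒯.Child d) u) : 𝒯.rk d u = hu.rank := by
  rw [rk, dif_pos h]

end LocalTree

theorem exists_localTree {S : Type*} [TopologicalSpace S] [PolishSpace S] [MeasurableSpace S]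
    [BorelSpace S] {A : Set (S × (ℕ → ℕ))} (hA : AnalyticSet A) :
    ∃ 𝒯 : LocalTree S, ∀ d, d ∉ A ↔ WellFounded (𝒯.Child d) := by
  rw [AnalyticSet] at hA
  obtain rfl | ⟨f, hf, rfl⟩ := hA
  · refine ⟨⟨fun _ => ∅, fun _ => MeasurableSet.empty, by simp, by simp⟩, fun d => ?_⟩
    simp only [mem_empty_iff_false, not_false_eq_true, true_iff]
    exact ⟨fun u => Acc.intro u fun v hv => hv.2.elim⟩
  let P : List ℕ → (ℕ → ℕ) → Set S := fun v y =>
    closure ((fun w => (f w).1) '' {w | PiNat.res w v.length = v ∧ ∀ i < v.length, (f w).2 i = y i})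
  have hP : ∀ v y y', (∀ i < v.length, y i = y' i) → P v y = P v y' := by
    intro v y y' h
    have : ∀ w, (∀ i < v.length, (f w).2 i = y i) ↔ (∀ i < v.length, (f w).2 i = y' i) :=
      fun w => forall₂_congr fun i hi => by rw [h i hi]
    simp only [P, this]
  let 𝒯 : LocalTree S :=
    { T := fun v => {d | d.1 ∈ P v d.2}
      measurable_T := fun v => by
        have : {d : S × (ℕ → ℕ) | d.1 ∈ P v d.2} = ⋃ σ : Fin v.length → ℕ,
            (P v fun i => if h : i < v.length then σ ⟨i, h⟩ else 0) ×ˢ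
              {y | ∀ i : Fin v.length, y i = σ i} := by
          ext ⟨s, y⟩
          simp only [mem_ofPred_eq, mem_iUnion, mem_prod]
          constructor
          · intro h
            refine ⟨fun i => y i, ?_, fun i => rfl⟩
            rwa [← hP v y]
            intro i hi
            simp [hi]
          · rintro ⟨σ, h, hσ⟩
            rwa [hP v y]
            intro i hi
            simpa [hi] using hσ ⟨i, hi⟩
        rw [this]
        refine MeasurableSet.iUnion fun σ => MeasurableSet.prod isClosed_closure.measurableSet ?_
        simp only [ofPred_forall]
        exact MeasurableSet.iInter fun i =>
          measurableSet_eq_fun (by fun_prop) measurable_const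
      mem_of_agree := fun v s y y' h hs => by
        simpa only [mem_ofPred_eq, hP v y y' h] using hs
      mem_of_cons := fun a u d hd => by
        refine closure_mono (image_mono ?_) hd
        rintro w ⟨h1, h2⟩
        simp only [List.length_cons, PiNat.res_succ, List.cons.injEq] at h1
        exact ⟨h1.2, fun i hi => h2 i (by simp; omega)⟩ }
  refine ⟨𝒯, fun d => ?_⟩
  rw [𝒯.wellFounded_child_iff, ← not_iff_not, not_not, not_acc_iff_exists_descending_chain]
  constructor
  · rintro ⟨w, rfl⟩
    refine ⟨fun n => PiNat.res w n, rfl, fun n => ⟨⟨w n, rfl⟩, ?_⟩⟩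
    exact subset_closure ⟨w, ⟨by simp, fun _ _ => rfl⟩, rfl⟩
  · rintro ⟨u, hu0, hu⟩
    let := TopologicalSpace.upgradeIsCompletelyMetrizable S
    have hlen : ∀ n, (u n).length = n := by
      intro n
      induction n with
      | zero => simp [hu0]
      | succ n ih => obtain ⟨⟨a, ha⟩, -⟩ := hu n; simp [ha, ih]
    have key : ∀ n : ℕ, ∃ w, PiNat.res w (n + 1) = u (n + 1) ∧ (∀ i < n + 1, (f w).2 i = d.2 i) ∧
        dist d.1 (f w).1 < 1 / ((n : ℝ) + 1) := by
      intro n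
      have h1 : d.1 ∈ P (u (n + 1)) d.2 := (hu n).2
      obtain ⟨_, ⟨w, ⟨h2, h3⟩, rfl⟩, h4⟩ :=
        Metric.mem_closure_iff.1 h1 (1 / ((n : ℝ) + 1)) (by positivity)
      rw [hlen] at h2 h3
      exact ⟨w, h2, h3, h4⟩
    choose w hw1 hw2 hw3 using key
    have hres : ∀ m n, n ≤ m → PiNat.res (w m) (n + 1) = u (n + 1) := by
      intro m n hnm
      have hsuf : ∀ k, PiNat.res (w m) (m + 1 - k) = u (m + 1 - k) := by
        intro k
        induction k with
        | zero => simpa using hw1 m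
        | succ k ih =>
          rcases Nat.lt_or_ge k (m + 1) with hk | hk
          · obtain ⟨j, hj⟩ : ∃ j, m + 1 - k = j + 1 := ⟨m - k, by omega⟩
            have hj' : m + 1 - (k + 1) = j := by omega
            rw [hj] at ih
            obtain ⟨⟨a, ha⟩, -⟩ := hu j
            rw [PiNat.res_succ, ha, List.cons.injEq] at ih
            rw [hj', ih.2]
          · have : m + 1 - (k + 1) = m + 1 - k := by omega
            rw [this, ih]
      have := hsuf (m - n)
      rwa [show m + 1 - (m - n) = n + 1 by omega] at this
    let w' : ℕ → ℕ := fun i => w i i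
    have hw' : Tendsto w atTop (𝓝 w') := by
      rw [tendsto_pi_nhds]
      intro i
      refine tendsto_const_nhds.congr' ?_
      filter_upwards [eventually_ge_atTop i] with m hm
      have := (hw1 i).trans (hres m i hm).symm
      exact PiNat.res_eq_res.1 this (Nat.lt_succ_self i)
    have hfw : Tendsto (fun n => f (w n)) atTop (𝓝 (f w')) := (hf.tendsto w').comp hw'
    have hd : Tendsto (fun n => f (w n)) atTop (𝓝 d) := by
      refine Prod.tendsto_iff _ _ |>.2 ⟨?_, ?_⟩
      · rw [tendsto_iff_dist_tendsto_zero]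
        refine squeeze_zero (fun _ => dist_nonneg) (fun n => ?_)
          tendsto_one_div_add_atTop_nhds_zero_nat
        rw [dist_comm]
        exact (hw3 n).le
      · rw [tendsto_pi_nhds]
        intro i
        refine tendsto_const_nhds.congr' ?_
        filter_upwards [eventually_ge_atTop i] with m hm
        exact (hw2 m i (by omega)).symm
    exact ⟨w', tendsto_nhds_unique hfw hd⟩

theorem existsUnique_of_minimal {Y K : Type*} [LinearOrder K] [WellFoundedLT K] {C : Set Y}
    {key : ℕ → Y → K} (hinj : ∀ y y', (∀ k, key k y = key k y') → y = y')
    (hlim : ∀ F : ℕ → Set Y, F 0 = C →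
      (∀ k, F (k + 1) = {y ∈ F k | ∀ y' ∈ F k, key k y ≤ key k y'}) →
      (∀ k, (F k).Nonempty) → ∃ y, ∀ k, y ∈ F k) (hC : C.Nonempty) :
    ∃! y, y ∈ C ∧ ∀ y' ∈ C, ∀ k, (∀ j < k, key j y' = key j y) → key k y ≤ key k y' := by
  let F : ℕ → Set Y := fun k => Nat.rec C (fun k F => {y ∈ F | ∀ y' ∈ F, key k y ≤ key k y'}) k
  have hF : ∀ k, F (k + 1) = {y ∈ F k | ∀ y' ∈ F k, key k y ≤ key k y'} := fun k => rfl
  have hne : ∀ k, (F k).Nonempty := by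
    intro k
    induction k with
    | zero => exact hC
    | succ k ih =>
      obtain ⟨y, hy, hmin⟩ := (InvImage.wf (key k) (wellFounded_lt (α := K))).has_min (F k) ih
      exact ⟨y, hy, fun y' hy' => not_lt.1 (hmin y' hy')⟩
  obtain ⟨y, hy⟩ := hlim F rfl hF hne
  refine ⟨y, ⟨hy 0, fun y' hy' k hk => ?_⟩, fun y' ⟨hy', hmin⟩ => ?_⟩
  · have : ∀ j ≤ k, y' ∈ F j := by
      intro j hj
      induction j with
      | zero => exact hy'
      | succ j ih =>
        refine ⟨ih (by omega), fun y'' hy'' => ?_⟩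
        rw [hk j (by omega)]
        exact (hy (j + 1)).2 y'' hy''
    exact (hy (k + 1)).2 y' (this k le_rfl)
  · refine hinj _ _ fun k => ?_
    have : ∀ k, y' ∈ F k ∧ ∀ j < k, key j y = key j y' := by
      intro k
      induction k with
      | zero => exact ⟨hy', by simp⟩
      | succ k ih =>
        have h1 : key k y' ≤ key k y := hmin y (hy 0) k ih.2
        have h2 : key k y ≤ key k y' := (hy (k + 1)).2 y' ih.1
        refine ⟨⟨ih.1, fun z hz => h1.trans ((hy (k + 1)).2 z hz)⟩, fun j hj => ?_⟩
        obtain hj | rfl := Nat.lt_succ_iff_lt_or_eq.1 hj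
        · exact ih.2 j hj
        · exact le_antisymm h2 h1
    exact ((this (k + 1)).2 k (Nat.lt_succ_self k)).symm

namespace LocalTree

variable {S : Type*} [TopologicalSpace S] [MeasurableSpace S] (𝒯 : LocalTree S)

/-- `d'` has smaller or equal rank than `d` at the node `u`, expressed by a simulation. -/
def RankLE (d' d : S × (ℕ → ℕ)) (u : List ℕ) : Prop := Simulates (𝒯.Child d') (𝒯.Child d) u u

/-- `d'` has smaller rank than `d` at the node `u`, expressed by a simulation. -/
def RankLT (d' d : S × (ℕ → ℕ)) (u : List ℕ) : Prop :=
  ∃ c, 𝒯.Child d c u ∧ Simulates (𝒯.Child d') (𝒯.Child d) u c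

/-- `d'` precedes `d` in the comparison of ranks and values at the nodes `u 0, u 1, …`. -/
def Precedes (u : ℕ → List ℕ) (d' d : S × (ℕ → ℕ)) : Prop :=
  d'.1 = d.1 ∧ ∃ k, (∀ j < k, 𝒯.RankLE d' d (u j) ∧ 𝒯.RankLE d d' (u j) ∧ d'.2 j = d.2 j) ∧
    (𝒯.RankLT d' d (u k) ∨ 𝒯.RankLE d' d (u k) ∧ d'.2 k < d.2 k)

theorem analyticSet_precedes [PolishSpace S] [BorelSpace S] (u : ℕ → List ℕ) :
    AnalyticSet {p : (S × (ℕ → ℕ)) × (S × (ℕ → ℕ)) | 𝒯.Precedes u p.2 p.1} := by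
  have hle : ∀ v c, AnalyticSet {p : (S × (ℕ → ℕ)) × (S × (ℕ → ℕ)) |
      Simulates (𝒯.Child p.1) (𝒯.Child p.2) v c} := fun v c =>
    analyticSet_simulates 𝒯.measurableSet_child 𝒯.measurableSet_child v c
  have hle' : ∀ v c, AnalyticSet {p : (S × (ℕ → ℕ)) × (S × (ℕ → ℕ)) |
      Simulates (𝒯.Child p.2) (𝒯.Child p.1) v c} := fun v c => by
    convert (hle v c).image_of_continuous continuous_swap
    ext p
    simp [Set.image_swap_eq_preimage_swap]
  have hmeas : ∀ {p : (S × (ℕ → ℕ)) × (S × (ℕ → ℕ)) → Prop}, Measurable p →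
      AnalyticSet {q | p q} := fun h => (measurableSet_setOfPred.2 h).analyticSet
  have hlt : ∀ v, AnalyticSet {p : (S × (ℕ → ℕ)) × (S × (ℕ → ℕ)) | 𝒯.RankLT p.2 p.1 v} := by
    intro v
    simp only [RankLT, ofPred_exists]
    refine AnalyticSet.iUnion fun c => analyticSet_inter ?_ (hle' v c)
    exact hmeas ((measurableSet_setOfPred.1 (𝒯.measurableSet_child c v)).comp measurable_fst)
  refine analyticSet_inter (s := {p : (S × (ℕ → ℕ)) × (S × (ℕ → ℕ)) | p.2.1 = p.1.1})
    (t := {p | ∃ k,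
    (∀ j < k, 𝒯.RankLE p.2 p.1 (u j) ∧ 𝒯.RankLE p.1 p.2 (u j) ∧ p.2.2 j = p.1.2 j) ∧
    (𝒯.RankLT p.2 p.1 (u k) ∨ 𝒯.RankLE p.2 p.1 (u k) ∧ p.2.2 k < p.1.2 k)})
    (measurableSet_eq_fun (by fun_prop) (by fun_prop)).analyticSet ?_
  simp only [ofPred_exists]
  have hval : ∀ k, AnalyticSet {p : (S × (ℕ → ℕ)) × (S × (ℕ → ℕ)) | p.2.2 k < p.1.2 k} :=
    fun k => (measurableSet_lt (by fun_prop) (by fun_prop)).analyticSet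
  have hall : ∀ k, AnalyticSet {p : (S × (ℕ → ℕ)) × (S × (ℕ → ℕ)) | ∀ j < k,
      𝒯.RankLE p.2 p.1 (u j) ∧ 𝒯.RankLE p.1 p.2 (u j) ∧ p.2.2 j = p.1.2 j} := by
    intro k
    rw [show {p : (S × (ℕ → ℕ)) × (S × (ℕ → ℕ)) | ∀ j < k, 𝒯.RankLE p.2 p.1 (u j) ∧
      𝒯.RankLE p.1 p.2 (u j) ∧ p.2.2 j = p.1.2 j} = ⋂ j : ℕ, {p | j < k → 𝒯.RankLE p.2 p.1 (u j) ∧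
      𝒯.RankLE p.1 p.2 (u j) ∧ p.2.2 j = p.1.2 j} by ext; simp]
    refine AnalyticSet.iInter fun j => ?_
    by_cases hj : j < k
    · simp only [hj, true_imp_iff]
      exact analyticSet_inter (hle' _ _) (analyticSet_inter (hle _ _)
        (measurableSet_eq_fun (f := fun p : (S × (ℕ → ℕ)) × (S × (ℕ → ℕ)) => p.2.2 j)
          (g := fun p => p.1.2 j) (by fun_prop) (by fun_prop)).analyticSet)
    · simp only [hj, false_imp_iff]
      exact MeasurableSet.univ.analyticSet
  exact AnalyticSet.iUnion fun k => analyticSet_inter (hall k) (analyticSet_union (hlt _)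
    (analyticSet_inter (hle' _ _) (hval k)))

/-- Rank and value at the `k`-th node. -/
def key (u : ℕ → List ℕ) (s : S) (k : ℕ) (y : ℕ → ℕ) : Ordinal.{0} ×ₗ ℕ :=
  toLex (𝒯.rk (s, y) (u k), y k)

theorem rankLE_iff {d' d : S × (ℕ → ℕ)} (hd' : WellFounded (𝒯.Child d'))
    (hd : WellFounded (𝒯.Child d)) (v : List ℕ) : 𝒯.RankLE d' d v ↔ 𝒯.rk d' v ≤ 𝒯.rk d v := by
  rw [RankLE, simulates_iff (hd.apply v), 𝒯.rk_eq hd v (hd.apply v), 𝒯.rk_eq hd' v (hd'.apply v)]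
  exact ⟨fun h => h.2, fun h => ⟨_, h⟩⟩

theorem rankLT_iff {d' d : S × (ℕ → ℕ)} (hd' : WellFounded (𝒯.Child d'))
    (hd : WellFounded (𝒯.Child d)) (v : List ℕ) : 𝒯.RankLT d' d v ↔ 𝒯.rk d' v < 𝒯.rk d v := by
  rw [RankLT, exists_simulates_iff (hd.apply v), 𝒯.rk_eq hd v (hd.apply v),
    𝒯.rk_eq hd' v (hd'.apply v)]
  exact ⟨fun h => h.2, fun h => ⟨_, h⟩⟩

theorem precedes_iff {u : ℕ → List ℕ} (hu : u 0 = []) {s s' : S} {y' y : ℕ → ℕ}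
    (hd : WellFounded (𝒯.Child (s, y))) :
    𝒯.Precedes u (s', y') (s, y) ↔ s' = s ∧ WellFounded (𝒯.Child (s, y')) ∧
      ∃ k, (∀ j < k, 𝒯.key u s j y' = 𝒯.key u s j y) ∧ 𝒯.key u s k y' < 𝒯.key u s k y := by
  have hwf : 𝒯.Precedes u (s', y') (s, y) → WellFounded (𝒯.Child (s', y')) := by
    rintro ⟨-, k, h1, h2⟩
    rw [𝒯.wellFounded_child_iff, ← hu]
    cases k with
    | zero =>
      obtain h2 | h2 := h2
      · exact ((exists_simulates_iff (hd.apply _)).1 h2).1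
      · exact ((simulates_iff (hd.apply _)).1 h2.1).1
    | succ k => exact ((simulates_iff (hd.apply _)).1 (h1 0 (by omega)).1).1
  have hcongr : WellFounded (𝒯.Child (s, y')) →
      (𝒯.Precedes u (s, y') (s, y) ↔
        ∃ k, (∀ j < k, 𝒯.key u s j y' = 𝒯.key u s j y) ∧ 𝒯.key u s k y' < 𝒯.key u s k y) := by
    intro hd'
    simp only [Precedes, true_and]
    refine exists_congr fun k => and_congr (forall₂_congr fun j _ => ?_) ?_
    · rw [𝒯.rankLE_iff hd' hd, 𝒯.rankLE_iff hd hd', key, key, toLex_inj, Prod.mk.injEq,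
        le_antisymm_iff (a := 𝒯.rk (s, y') _), and_assoc]
    · rw [𝒯.rankLE_iff hd' hd, 𝒯.rankLT_iff hd' hd, key, key, Prod.Lex.toLex_lt_toLex]
      constructor
      · rintro (h | ⟨h1, h2⟩)
        · exact .inl h
        · exact h1.lt_or_eq.imp_right fun h => ⟨h, h2⟩
      · rintro (h | ⟨h1, h2⟩)
        · exact .inl h
        · exact .inr ⟨h1.le, h2⟩
  constructor
  · intro h
    obtain rfl : s' = s := h.1
    exact ⟨rfl, hwf h, (hcongr (hwf h)).1 h⟩
  · rintro ⟨rfl, h1, h2⟩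
    exact (hcongr h1).2 h2

theorem exists_limit {u : ℕ → List ℕ} (hu : Function.Surjective u) {s : S}
    {F : ℕ → Set (ℕ → ℕ)} (hF0 : F 0 = {y | WellFounded (𝒯.Child (s, y))})
    (hF : ∀ k, F (k + 1) = {y ∈ F k | ∀ y' ∈ F k, 𝒯.key u s k y ≤ 𝒯.key u s k y'})
    (hne : ∀ k, (F k).Nonempty) : ∃ y, ∀ k, y ∈ F k := by
  choose y hy using hne
  have hmono : ∀ k m, k ≤ m → F m ⊆ F k := fun k m hkm =>
    antitone_nat_of_succ_le (f := F) (fun k => by rw [hF]; exact sep_subset _ _) hkm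
  have hwf : ∀ k z, z ∈ F k → WellFounded (𝒯.Child (s, z)) := fun k z hz => by
    have := hmono 0 k (Nat.zero_le k) hz
    rwa [hF0] at this
  have hkey : ∀ k m, k < m → 𝒯.key u s k (y m) = 𝒯.key u s k (y (k + 1)) := by
    intro k m hkm
    have h1 := hmono (k + 1) m hkm (hy m)
    have h2 := hy (k + 1)
    rw [hF] at h1 h2
    exact le_antisymm (h1.2 _ h2.1) (h2.2 _ h1.1)
  let z : ℕ → ℕ := fun k => y (k + 1) k
  let r : ℕ → Ordinal.{0} := fun k => 𝒯.rk (s, y (k + 1)) (u k)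
  have hrank : ∀ k m, k < m → 𝒯.rk (s, y m) (u k) = r k := fun k m hkm =>
    congrArg Prod.fst (toLex_inj.1 (hkey k m hkm))
  have hval : ∀ k m, k < m → y m k = z k := fun k m hkm =>
    congrArg Prod.snd (toLex_inj.1 (hkey k m hkm))
  have hchild : ∀ j k, 𝒯.Child (s, z) (u j) (u k) → r j < r k := by
    intro j k hjk
    set m := j + k + (u j).length + 1
    have hwfm := hwf m (y m) (hy m)
    have : 𝒯.Child (s, y m) (u j) (u k) := ⟨hjk.1, 𝒯.mem_of_agree _ _ z _ (fun i hi =>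
      (hval i m (by omega)).symm) hjk.2⟩
    rw [← hrank j m (by omega), ← hrank k m (by omega), 𝒯.rk_eq hwfm _ (hwfm.apply _),
      𝒯.rk_eq hwfm _ (hwfm.apply _)]
    exact Acc.rank_lt_of_rel _ this
  have hacc : ∀ k, ∃ h : Acc (𝒯.Child (s, z)) (u k), h.rank ≤ r k := by
    intro k
    induction hk : r k using WellFoundedLT.induction generalizing k with
    | ind o ih =>
      subst hk
      have hsub : ∀ v, 𝒯.Child (s, z) v (u k) →
          ∃ h : Acc (𝒯.Child (s, z)) v, h.rank < r k := by
        intro v hv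
        obtain ⟨j, rfl⟩ := hu v
        obtain ⟨h, hle⟩ := ih (r j) (hchild j k hv) j rfl
        exact ⟨h, hle.trans_lt (hchild j k hv)⟩
      have h : Acc (𝒯.Child (s, z)) (u k) := Acc.intro _ fun v hv => (hsub v hv).1
      refine ⟨h, ?_⟩
      rw [h.rank_eq]
      exact Ordinal.iSup_le fun ⟨v, hv⟩ => Order.succ_le_of_lt (hsub v hv).2
  have hz : WellFounded (𝒯.Child (s, z)) := ⟨fun v => by
    obtain ⟨k, rfl⟩ := hu v
    exact (hacc k).1⟩
  refine ⟨z, fun k => ?_⟩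
  induction k with
  | zero => rw [hF0]; exact hz
  | succ k ih =>
    rw [hF]
    refine ⟨ih, fun y' hy' => le_trans ?_ (((hF k) ▸ hy (k + 1)).2 y' hy')⟩
    rw [key, key, Prod.Lex.toLex_le_toLex']
    obtain ⟨h, hle⟩ := hacc k
    refine ⟨?_, fun _ => le_rfl⟩
    rw [𝒯.rk_eq hz _ h]
    exact hle

end LocalTree

/-- **Kondo's uniformization theorem**, for coanalytic subsets of `S × ℕ^ℕ`. -/
theorem exists_coanalytic_uniformization {S : Type*} [TopologicalSpace S] [PolishSpace S]
    [MeasurableSpace S] [BorelSpace S] {C : Set (S × (ℕ → ℕ))} (hC : AnalyticSet Cᶜ) :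
    ∃ G ⊆ C, AnalyticSet Gᶜ ∧ ∀ s y, (s, y) ∈ C → ∃! y', (s, y') ∈ G := by
  obtain ⟨𝒯, h𝒯⟩ := exists_localTree hC
  simp only [mem_compl_iff, not_not] at h𝒯
  obtain ⟨u, hu, hu0⟩ : ∃ u : ℕ → List ℕ, Function.Surjective u ∧ u 0 = [] := by
    obtain ⟨u, hu⟩ := exists_surjective_nat (List ℕ)
    refine ⟨fun n => Nat.casesOn n [] u, fun v => ?_, rfl⟩
    obtain ⟨n, rfl⟩ := hu v
    exact ⟨n + 1, rfl⟩
  refine ⟨{d ∈ C | ¬ ∃ d', 𝒯.Precedes u d' d}, sep_subset _ _, ?_, fun s y hy => ?_⟩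
  · have : {d ∈ C | ¬ ∃ d', 𝒯.Precedes u d' d}ᶜ =
        Cᶜ ∪ Prod.fst '' {p : (S × (ℕ → ℕ)) × (S × (ℕ → ℕ)) | 𝒯.Precedes u p.2 p.1} := by
      ext d
      simp only [mem_compl_iff, mem_ofPred_eq, not_and, not_not, mem_union, mem_image, Prod.exists,
        exists_and_right, exists_eq_right, imp_iff_not_or]
    rw [this]
    exact analyticSet_union hC ((𝒯.analyticSet_precedes u).image_of_continuous continuous_fst)
  · have key := existsUnique_of_minimal (C := {y | WellFounded (𝒯.Child (s, y))})
      (key := 𝒯.key u s)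
      (fun y y' h => funext fun k => congrArg Prod.snd (toLex_inj.1 (h k)))
      (fun F hF0 hF hne => 𝒯.exists_limit hu hF0 hF hne) ⟨y, (h𝒯 _).1 hy⟩
    convert key using 3 with y'
    simp only [mem_ofPred_eq, h𝒯]
    refine and_congr_right fun hy' => ?_
    simp only [Prod.exists, 𝒯.precedes_iff hu0 hy']
    push Not
    constructor
    · intro h y'' hy'' k hk
      exact h s y'' rfl hy'' k hk
    · rintro h _ y'' rfl hy'' k hk
      exact h y'' hy'' k hk

end Uniformization

namespace MinimaxControl

open Set PaperStmt
open scoped unitInterval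

/-! ### Universally measurable sets and maps -/

/-- Every `Σ¹₂` subset of a Borel space is universally measurable. -/
def Sigma12UniversallyMeasurable : Prop :=
  ∀ (γ : Type) [TopologicalSpace γ] [PolishSpace γ] [MeasurableSpace γ] [BorelSpace γ]
    (s : Set γ), IsSigma12 s → UniversallyMeasurableSet s

/-- The σ-algebra of universally measurable sets. -/
abbrev umSpace (α : Type*) [MeasurableSpace α] : MeasurableSpace α where
  MeasurableSet' := UniversallyMeasurableSet
  measurableSet_empty := fun _ _ => MeasurableSet.empty.nullMeasurableSet
  measurableSet_compl := fun _ hs μ hμ => (hs μ hμ).compl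
  measurableSet_iUnion := fun _ hs μ hμ => NullMeasurableSet.iUnion fun n => hs n μ hμ

theorem um_of_measurable {α β : Type*} [MeasurableSpace α] [MeasurableSpace β] {f : α → β}
    (hf : Measurable f) : UniversallyMeasurable f :=
  fun _ hs _ _ => (hf hs).nullMeasurableSet

theorem um_aemeasurable {α β : Type*} [MeasurableSpace α] [MeasurableSpace β]
    [MeasurableSpace.CountablyGenerated β] [Nonempty β] {f : α → β} (hf : UniversallyMeasurable f)
    (μ : Measure α) [IsProbabilityMeasure μ] : AEMeasurable f μ :=
  NullMeasurable.aemeasurable fun s hs => hf s hs μ inferInstance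

theorem umSet_preimage {α β : Type*} [MeasurableSpace α] [MeasurableSpace β]
    [MeasurableSpace.CountablyGenerated β] [Nonempty β] {f : α → β} {s : Set β}
    (hs : UniversallyMeasurableSet s) (hf : UniversallyMeasurable f) :
    UniversallyMeasurableSet (f ⁻¹' s) := by
  intro μ _
  have h := um_aemeasurable hf μ
  have hp : IsProbabilityMeasure (μ.map f) := Measure.isProbabilityMeasure_map h
  have h1 : NullMeasurableSet (h.mk f ⁻¹' s) μ := by
    refine NullMeasurableSet.preimage (hs (μ.map f) hp)
      ⟨h.measurable_mk, ?_⟩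
    rw [Measure.map_congr h.ae_eq_mk]
  refine h1.congr ?_
  filter_upwards [h.ae_eq_mk] with x hx
  exact congrArg (· ∈ s) hx.symm

theorem um_comp {α β γ : Type*} [MeasurableSpace α] [MeasurableSpace β] [MeasurableSpace γ]
    [MeasurableSpace.CountablyGenerated β] [Nonempty β] {g : β → γ} {f : α → β}
    (hg : UniversallyMeasurable g) (hf : UniversallyMeasurable f) :
    UniversallyMeasurable (g ∘ f) :=
  fun s hs => umSet_preimage (s := g ⁻¹' s) (hg s hs) hf

theorem isSigma12_image {β γ : Type} [TopologicalSpace β] [PolishSpace β] [MeasurableSpace β]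
    [BorelSpace β] [TopologicalSpace γ] [MeasurableSpace γ] {C : Set β} (hC : AnalyticSet Cᶜ)
    {f : β → γ} (hf : Measurable f) : IsSigma12 (f '' C) :=
  ⟨β, inferInstance, inferInstance, C, f, hC, by rwa [← BorelSpace.measurable_eq], rfl⟩

theorem isSigma12_of_analyticSet {γ : Type} [TopologicalSpace γ] [PolishSpace γ]
    [MeasurableSpace γ] [BorelSpace γ] {s : Set γ} (hs : AnalyticSet s) : IsSigma12 s := by
  rw [AnalyticSet] at hs
  obtain rfl | ⟨f, hf, rfl⟩ := hs
  · simpa using isSigma12_image (C := (∅ : Set γ)) (by simpa using MeasurableSet.univ.analyticSet)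
      measurable_id
  · rw [← image_univ]
    exact isSigma12_image (by simpa using analyticSet_empty) hf.measurable

theorem exists_um_selector (hAD : Sigma12UniversallyMeasurable) {S P : Type}
    [TopologicalSpace S] [PolishSpace S] [MeasurableSpace S] [BorelSpace S]
    [TopologicalSpace P] [PolishSpace P] [MeasurableSpace P] [BorelSpace P] [Nonempty P]
    {C : Set (S × P)} (hC : AnalyticSet Cᶜ) :
    ∃ ζ : S → P, UniversallyMeasurable ζ ∧ ∀ s y, (s, y) ∈ C → (s, ζ s) ∈ C := by
  classical
  obtain ⟨f, hf, hsurj⟩ := PolishSpace.exists_nat_nat_continuous_surjective P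
  obtain ⟨G, hGC, hG, huniq⟩ := Uniformization.exists_coanalytic_uniformization
    (C := Prod.map id f ⁻¹' C) (hC.preimage (continuous_id.prodMap hf))
  let ζ : S → ℕ → ℕ := fun s => if h : ∃ y, (s, y) ∈ G then h.choose else 0
  have hζ : ∀ s, (∃ y, (s, y) ∈ G) → (s, ζ s) ∈ G := fun s h => by
    simp only [ζ, dif_pos h]
    exact h.choose_spec
  have hmeas : ∀ B : Set (ℕ → ℕ), MeasurableSet B →
      UniversallyMeasurableSet {s | ∃ y ∈ B, (s, y) ∈ G} := by
    intro B hB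
    refine hAD S _ ?_
    have : {s | ∃ y ∈ B, (s, y) ∈ G} = Prod.fst '' (G ∩ Prod.snd ⁻¹' B) := by
      ext s
      simp [and_comm]
    rw [this]
    refine isSigma12_image ?_ measurable_fst
    rw [compl_inter]
    exact Uniformization.analyticSet_union hG (measurable_snd hB).compl.analyticSet
  have hζm : UniversallyMeasurable ζ := by
    intro B hB
    have hdom := hmeas univ MeasurableSet.univ
    have : ζ ⁻¹' B = {s | ∃ y ∈ B, (s, y) ∈ G} ∪
        ({s | ∃ y ∈ univ, (s, y) ∈ G}ᶜ ∩ {s | (0 : ℕ → ℕ) ∈ B}) := by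
      ext s
      by_cases h : ∃ y, (s, y) ∈ G
      · have h1 := hζ s h
        obtain ⟨y', -, hy'⟩ := huniq s (ζ s) (hGC h1)
        have : ∀ y, (s, y) ∈ G ↔ y = ζ s :=
          fun y => ⟨fun hy => (hy' y hy).trans (hy' _ h1).symm, fun hy => hy ▸ h1⟩
        simp [this]
      · have h2 : ∀ y, (s, y) ∉ G := fun y hy => h ⟨y, hy⟩
        simp [h2, ζ]
    rw [this]
    exact MeasurableSet.union (m := umSpace S) (hmeas B hB)
      (MeasurableSet.inter (m := umSpace S) (MeasurableSet.compl (m := umSpace S) hdom)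
        (MeasurableSet.const (m := umSpace S) _))
  refine ⟨f ∘ ζ, um_comp (um_of_measurable hf.measurable) hζm, fun s y hy => ?_⟩
  obtain ⟨w, rfl⟩ := hsurj y
  exact hGC (hζ s (huniq s w hy).exists)

theorem umSet_exists (hAD : Sigma12UniversallyMeasurable) {S P : Type}
    [TopologicalSpace S] [PolishSpace S] [MeasurableSpace S] [BorelSpace S]
    [TopologicalSpace P] [PolishSpace P] [MeasurableSpace P] [BorelSpace P]
    {C : Set (S × P)} (hC : AnalyticSet Cᶜ) : UniversallyMeasurableSet {s | ∃ y, (s, y) ∈ C} := by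
  refine hAD S _ ?_
  convert isSigma12_image hC measurable_fst
  ext s
  simp

/-! ### Universally measurable kernels -/

/-- A universally measurable family of probability measures. -/
structure IsUMKernel {S A : Type*} [MeasurableSpace S] [MeasurableSpace A]
    (ν : S → Measure A) : Prop where
  isProb : ∀ s, IsProbabilityMeasure (ν s)
  um : ∀ B, MeasurableSet B → UniversallyMeasurable fun s => ν s B

theorem exists_countable_piSystem (A : Type*) [m : MeasurableSpace A]
    [MeasurableSpace.CountablyGenerated A] : ∃ 𝒞 : Set (Set A), 𝒞.Countable ∧ IsPiSystem 𝒞 ∧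
      m = MeasurableSpace.generateFrom 𝒞 := by
  refine ⟨generateSetAlgebra (MeasurableSpace.countableGeneratingSet A),
    countable_generateSetAlgebra (MeasurableSpace.countable_countableGeneratingSet), ?_, ?_⟩
  · intro s hs t ht _
    exact isSetAlgebra_generateSetAlgebra.inter_mem hs ht
  · rw [generateFrom_generateSetAlgebra_eq,
      MeasurableSpace.generateFrom_countableGeneratingSet]

theorem IsUMKernel.exists_kernel {S A : Type*} [MeasurableSpace S] [MeasurableSpace A]
    [MeasurableSpace.CountablyGenerated A] {ν : S → Measure A} (hν : IsUMKernel ν)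
    (m : Measure S) [IsProbabilityMeasure m] :
    ∃ κ : Kernel S A, IsMarkovKernel κ ∧ ∀ᵐ s ∂m, ν s = κ s := by
  classical
  obtain ⟨s₀⟩ : Nonempty S := m.nonempty_of_neZero
  have := hν.isProb
  obtain ⟨𝒞, h𝒞c, h𝒞p, h𝒞⟩ := exists_countable_piSystem A
  have h𝒞m : ∀ B ∈ 𝒞, MeasurableSet B := fun B hB => by
    rw [h𝒞]
    exact MeasurableSpace.measurableSet_generateFrom hB
  have hae : ∀ B ∈ 𝒞, AEMeasurable (fun s => ν s B) m :=
    fun B hB => um_aemeasurable (hν.um B (h𝒞m B hB)) m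
  have hall : ∀ᵐ s ∂m, ∀ B (hB : B ∈ 𝒞), ν s B = (hae B hB).mk _ s :=
    (ae_ball_iff h𝒞c).2 fun B hB => (hae B hB).ae_eq_mk
  obtain ⟨G, hG, hGm, hGae⟩ : ∃ G ⊆ {s | ∀ B (hB : B ∈ 𝒞), ν s B = (hae B hB).mk _ s},
      MeasurableSet G ∧ ∀ᵐ s ∂m, s ∈ G := eventually_iff.1 hall |> fun h => by
    obtain ⟨G, h1, h2, h3⟩ := exists_measurable_superset_of_null h
    exact ⟨Gᶜ, compl_subset_comm.1 h1, h2.compl, by simpa [ae_iff] using h3⟩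
  let κ : S → Measure A := fun s => if s ∈ G then ν s else ν s₀
  have hκp : ∀ s, IsProbabilityMeasure (κ s) := fun s => by
    dsimp only [κ]
    split_ifs <;> infer_instance
  have hκm : Measurable κ := by
    refine Measurable.measure_of_isPiSystem_of_isProbabilityMeasure h𝒞 h𝒞p fun B hB => ?_
    have : (fun s => κ s B) = fun s => if s ∈ G then (hae B hB).mk _ s else ν s₀ B := by
      ext s
      by_cases h : s ∈ G
      · simp only [κ, h, if_true]
        exact hG h B hB
      · simp [κ, h]
    rw [this]
    exact Measurable.ite hGm (hae B hB).measurable_mk measurable_const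
  refine ⟨⟨κ, hκm⟩, ⟨hκp⟩, ?_⟩
  filter_upwards [hGae] with s hs
  simp [κ, hs]

/-! ### Coding of measurable functions and kernels -/

/-- Codes for measurable functions. -/
abbrev Code := ℕ → ℕ → ℕ → ℕ

theorem exists_open_enumeration (S : Type*) [TopologicalSpace S] [SecondCountableTopology S] :
    ∃ b : ℕ → Set S, (∀ j, IsOpen (b j)) ∧
      ∀ O, IsOpen O → ∃ c : ℕ → ℕ, O = ⋃ j, b (c j) := by
  classical
  obtain ⟨B, hBc, -, hB⟩ := TopologicalSpace.exists_countable_basis S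
  obtain ⟨b, hb⟩ := (hBc.insert ∅).exists_eq_range ⟨∅, mem_insert _ _⟩
  have hopen : ∀ j, IsOpen (b j) := fun j => by
    have : b j ∈ insert ∅ B := hb ▸ mem_range_self j
    obtain h | h := this
    · rw [h]
      exact isOpen_empty
    · exact hB.isOpen h
  obtain ⟨j₀, hj₀⟩ : ∅ ∈ range b := hb ▸ mem_insert _ _
  refine ⟨b, hopen, fun O hO => ⟨fun j => if b j ⊆ O then j else j₀, ?_⟩⟩
  refine Subset.antisymm (fun s hs => ?_) (iUnion_subset fun j => ?_)
  · obtain ⟨v, hv, hsv, hvO⟩ := hB.exists_subset_of_mem_open hs hO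
    obtain ⟨j, rfl⟩ : v ∈ range b := hb ▸ mem_insert_of_mem _ hv
    exact mem_iUnion.2 ⟨j, by simpa [hvO] using hsv⟩
  · by_cases h : b j ⊆ O <;> simp [h, hj₀]

theorem exists_universal_function (S : Type*) [TopologicalSpace S] [PolishSpace S]
    [MeasurableSpace S] [BorelSpace S] :
    ∃ U : Code × S → ℕ → ℕ, Measurable U ∧ ∀ (m : Measure S) [IsProbabilityMeasure m]
      (f : S → ℕ → ℕ), AEMeasurable f m → ∃ c, ∀ᵐ s ∂m, U (c, s) = f s := by
  classical
  obtain ⟨b, hbo, hb⟩ := exists_open_enumeration S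
  have e : (ℕ → ℕ) ≃ᵐ (ℕ → Bool) := PolishSpace.measurableEquivNatBoolOfNotCountable fun _ => by
    obtain ⟨g, hg⟩ := exists_surjective_nat (ℕ → ℕ)
    obtain ⟨n, hn⟩ := hg fun k => g k k + 1
    exact absurd (congrFun hn n) (Nat.ne_of_lt (Nat.lt_succ_self _))
  refine ⟨fun p => e.symm fun k => decide (∀ n, ∃ j, p.2 ∈ b (p.1 k n j)), ?_, ?_⟩
  · refine e.symm.measurable.comp (measurable_pi_lambda _ fun k => ?_)
    refine measurable_to_bool ?_
    have : (fun p : Code × S => decide (∀ n, ∃ j, p.2 ∈ b (p.1 k n j))) ⁻¹' {true} =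
        ⋂ n, ⋃ j, ⋃ i, {p | p.1 k n j = i} ∩ {p | p.2 ∈ b i} := by
      ext p
      simp
    rw [this]
    exact MeasurableSet.iInter fun n => MeasurableSet.iUnion fun j => MeasurableSet.iUnion fun i =>
      (measurableSet_eq_fun (by fun_prop) measurable_const).inter
        (measurable_snd (hbo i).measurableSet)
  · intro m _ f hf
    have hGδ : ∀ D : Set S, MeasurableSet D → ∃ c : ℕ → ℕ → ℕ,
        ∀ᵐ s ∂m, s ∈ D ↔ ∀ n, ∃ j, s ∈ b (c n j) := by
      intro D hD
      have h1 : ∀ n : ℕ, ∃ c : ℕ → ℕ, D ⊆ ⋃ j, b (c j) ∧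
          m ((⋃ j, b (c j)) \ D) < ((n : ℝ≥0∞) + 1)⁻¹ := by
        intro n
        obtain ⟨O, hDO, hO, -, hlt⟩ := hD.exists_isOpen_sdiff_lt (measure_ne_top m D)
          (ε := ((n : ℝ≥0∞) + 1)⁻¹) (by simp)
        obtain ⟨c, rfl⟩ := hb O hO
        exact ⟨c, hDO, hlt⟩
      choose c hc1 hc2 using h1
      refine ⟨c, ?_⟩
      have hnull : m ((⋂ n, ⋃ j, b (c n j)) \ D) = 0 := by
        refine le_antisymm (ENNReal.le_of_forall_pos_le_add fun ε hε _ => ?_) bot_le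
        obtain ⟨n, hn⟩ := ENNReal.exists_inv_nat_lt (a := (ε : ℝ≥0∞)) (by simpa using hε.ne')
        rw [zero_add]
        calc m ((⋂ n, ⋃ j, b (c n j)) \ D) ≤ m ((⋃ j, b (c n j)) \ D) :=
              measure_mono (sdiff_subset_sdiff_left (iInter_subset _ n))
          _ ≤ ((n : ℝ≥0∞) + 1)⁻¹ := (hc2 n).le
          _ ≤ (n : ℝ≥0∞)⁻¹ := ENNReal.inv_le_inv.2 le_self_add
          _ ≤ ε := hn.le
      filter_upwards [measure_eq_zero_iff_ae_notMem.1 hnull] with s hs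
      refine ⟨fun h n => by simpa using hc1 n h, fun h => ?_⟩
      by_contra hD
      exact hs ⟨mem_iInter.2 fun n => mem_iUnion.2 (h n), hD⟩
    have h2 := fun k => hGδ {s | e (hf.mk f s) k = true}
      (measurableSet_eq_fun ((measurable_pi_apply k).comp
        (e.measurable.comp hf.measurable_mk)) measurable_const)
    choose c hc using h2
    refine ⟨c, ?_⟩
    filter_upwards [hf.ae_eq_mk, ae_all_iff.2 hc] with s hs hs'
    rw [hs, MeasurableEquiv.symm_apply_eq]
    ext k
    rw [Bool.eq_iff_iff, decide_eq_true_iff]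
    exact (hs' k).symm

/-- A coding of the universally measurable feasible randomized decision rules of a player, where
`ξ` is the current state as a function of the information of the player. -/
structure Coding {S X A : Type} [MeasurableSpace S] [MeasurableSpace A] (ξ : S → X)
    (Acts : X → Set A) where
  act : Code × S × I → A
  measurable_act : Measurable act
  ok : Set (Code × S)
  measurableSet_ok : MeasurableSet ok
  feasible : ∀ c s, (c, s) ∈ ok → volume.map (fun u => act (c, s, u)) (Acts (ξ s)) = 1
  exists_code : ∀ ν : S → Measure A, IsUMKernel ν → (∀ s, ν s (Acts (ξ s)) = 1) →
    ∀ (m : Measure S) [IsProbabilityMeasure m],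
      ∃ c, ∀ᵐ s ∂m, (c, s) ∈ ok ∧ volume.map (fun u => act (c, s, u)) = ν s

theorem umSet_of_analyticSet (hAD : Sigma12UniversallyMeasurable) {S : Type}
    [TopologicalSpace S] [PolishSpace S] [MeasurableSpace S] [BorelSpace S] {s : Set S}
    (hs : AnalyticSet s) : UniversallyMeasurableSet s :=
  hAD S s (isSigma12_of_analyticSet hs)

theorem analyticSet_acts {X A : Type*} [TopologicalSpace X] [PolishSpace X]
    [TopologicalSpace A] [PolishSpace A] {Acts : X → Set A}
    (hΓ : AnalyticSet {p : X × A | p.2 ∈ Acts p.1}) (x : X) :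
    AnalyticSet (Acts x) :=
  hΓ.preimage (f := fun a => (x, a)) (by fun_prop)

theorem measurableSet_ae_right {S T : Type*} [MeasurableSpace S] [MeasurableSpace T]
    {m : Measure T} [SFinite m] {P : Set (S × T)} (hP : MeasurableSet P) :
    MeasurableSet {s | ∀ᵐ t ∂m, (s, t) ∈ P} := by
  simp only [ae_iff]
  exact measurable_measure_prodMk_left hP.compl (measurableSet_singleton 0)

section

variable {X A : Type} [TopologicalSpace X] [PolishSpace X] [MeasurableSpace X] [BorelSpace X]
  [TopologicalSpace A] [PolishSpace A] [MeasurableSpace A] [BorelSpace A] {Acts : X → Set A}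

theorem exists_coding (hAD : Sigma12UniversallyMeasurable) {S : Type} [TopologicalSpace S]
    [PolishSpace S] [MeasurableSpace S] [BorelSpace S] {ξ : S → X} (hξ : Measurable ξ)
    (hΓ : AnalyticSet {p : X × A | p.2 ∈ Acts p.1}) {ψ : (ℕ → ℕ) → X × A} (hψ : Continuous ψ)
    (hψr : range ψ = {p : X × A | p.2 ∈ Acts p.1}) : Nonempty (Coding ξ Acts) := by
  have : Nonempty (X × A) := ⟨ψ 0⟩
  have : Nonempty A := ⟨(ψ 0).2⟩
  obtain ⟨U, hU, hUuniv⟩ := exists_universal_function (S × I)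
  obtain ⟨τ, hτ, hτψ⟩ := exists_um_selector hAD (C := {p : (X × A) × (ℕ → ℕ) | ψ p.2 = p.1})
    (measurableSet_eq_fun (hψ.measurable.comp measurable_snd) measurable_fst).compl.analyticSet
  have hact : Measurable fun p : Code × S × I => (ψ (U p)).2 :=
    measurable_snd.comp (hψ.measurable.comp hU)
  have hok : MeasurableSet {p : (Code × S) × I | (ψ (U (p.1.1, p.1.2, p.2))).1 = ξ p.1.2} :=
    measurableSet_eq_fun (measurable_fst.comp (hψ.measurable.comp (hU.comp (by fun_prop))))
      (hξ.comp (by fun_prop))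
  refine ⟨⟨fun p => (ψ (U p)).2, hact, {p | ∀ᵐ u, (ψ (U (p.1, p.2, u))).1 = ξ p.2},
    measurableSet_ae_right hok, ?_, ?_⟩⟩
  · intro c s h
    have hact' : Measurable fun u => (ψ (U (c, s, u))).2 := hact.comp (by fun_prop)
    have := Measure.isProbabilityMeasure_map (μ := (volume : Measure I)) hact'.aemeasurable
    refine le_antisymm prob_le_one (le_trans ?_ (Measure.le_map_apply hact'.aemeasurable _))
    have h1 : ∀ᵐ u : I, u ∈ (fun u => (ψ (U (c, s, u))).2) ⁻¹' Acts (ξ s) := by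
      filter_upwards [h] with u hu
      have : ψ (U (c, s, u)) ∈ {p : X × A | p.2 ∈ Acts p.1} := hψr ▸ mem_range_self _
      rw [mem_ofPred_eq, hu] at this
      exact this
    exact ((measure_congr (eventuallyEq_univ.2 h1)).trans measure_univ).ge
  · intro ν hν hfeas m _
    obtain ⟨κ, _, hκ⟩ := hν.exists_kernel m
    obtain ⟨f, hf, hfκ⟩ := Kernel.exists_measurable_map_eq_unitInterval κ
    have hF : UniversallyMeasurable fun p : S × I => τ (ξ p.1, f p.1 p.2) :=
      um_comp (f := fun p : S × I => (ξ p.1, f p.1 p.2)) hτ (um_of_measurable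
        ((hξ.comp measurable_fst).prodMk hf))
    obtain ⟨c, hc⟩ := hUuniv (m.prod volume) _ (um_aemeasurable hF _)
    refine ⟨c, ?_⟩
    filter_upwards [hκ, Measure.ae_ae_of_ae_prod hc] with s hs hcs
    have hfs : Measurable (f s) := hf.of_uncurry_left
    have hmem : ∀ᵐ u, f s u ∈ Acts (ξ s) := by
      refine ae_of_ae_map hfs.aemeasurable ?_
      rw [hfκ, ← hs]
      have := hν.isProb s
      refine (prob_compl_eq_zero_iff₀ ?_).2 (hfeas s)
      exact umSet_of_analyticSet hAD (analyticSet_acts hΓ _) (ν s) this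
    have hψU : ∀ᵐ u, ψ (U (c, s, u)) = (ξ s, f s u) := by
      filter_upwards [hmem, hcs] with u hu hcu
      obtain ⟨w, hw⟩ : (ξ s, f s u) ∈ range ψ := by rw [hψr]; exact hu
      rw [hcu]
      exact hτψ (ξ s, f s u) w hw
    refine ⟨?_, ?_⟩
    · filter_upwards [hψU] with u hu
      rw [hu]
    · rw [hs, ← hfκ]
      refine Measure.map_congr ?_
      filter_upwards [hψU] with u hu
      rw [hu]

theorem exists_um_selection (hAD : Sigma12UniversallyMeasurable)
    {ψ : (ℕ → ℕ) → X × A} (hψ : Continuous ψ)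
    (hψr : range ψ = {p : X × A | p.2 ∈ Acts p.1}) (hne : ∀ x, (Acts x).Nonempty) :
    ∃ sel : X → A, UniversallyMeasurable sel ∧ ∀ x, sel x ∈ Acts x := by
  obtain ⟨τ, hτ, hτψ⟩ := exists_um_selector hAD (C := {p : X × (ℕ → ℕ) | (ψ p.2).1 = p.1})
    (measurableSet_eq_fun (measurable_fst.comp (hψ.measurable.comp measurable_snd))
      measurable_fst).compl.analyticSet
  refine ⟨fun x => (ψ (τ x)).2, um_comp (g := fun w => (ψ w).2)
    (um_of_measurable (measurable_snd.comp hψ.measurable)) hτ, fun x => ?_⟩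
  obtain ⟨a, ha⟩ := hne x
  obtain ⟨w, hw⟩ : (x, a) ∈ range ψ := by rw [hψr]; exact ha
  have h1 : (ψ (τ x)).1 = x := hτψ x w (by simp [hw])
  have : ψ (τ x) ∈ {p : X × A | p.2 ∈ Acts p.1} := hψr ▸ mem_range_self _
  rw [mem_ofPred_eq, h1] at this
  exact this

end

namespace Coding

variable {S X A : Type} [MeasurableSpace S] [MeasurableSpace A] {ξ : S → X} {Acts : X → Set A}
  (𝒦 : Coding ξ Acts)

/-- The randomized decision rule with code `c`. -/
def rule (c : Code) (s : S) : Measure A := volume.map fun u : I => 𝒦.act (c, s, u)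

theorem measurable_act_right (c : Code) (s : S) : Measurable fun u : I => 𝒦.act (c, s, u) :=
  𝒦.measurable_act.comp (by fun_prop)

instance (c : Code) (s : S) : IsProbabilityMeasure (𝒦.rule c s) :=
  Measure.isProbabilityMeasure_map (𝒦.measurable_act_right c s).aemeasurable

theorem measurable_rule {B : Set A} (hB : MeasurableSet B) :
    Measurable fun p : Code × S => 𝒦.rule p.1 p.2 B := by
  have h : ∀ p : Code × S, 𝒦.rule p.1 p.2 B =
      volume (Prod.mk p ⁻¹' {r : (Code × S) × I | 𝒦.act (r.1.1, r.1.2, r.2) ∈ B}) :=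
    fun p => Measure.map_apply (𝒦.measurable_act_right p.1 p.2) hB
  simp only [h]
  exact measurable_measure_prodMk_left ((𝒦.measurable_act.comp (by fun_prop)) hB)

open Classical in
/-- The decision rule with code `c s` where feasible, and the selection `sel` elsewhere. -/
def total (sel : X → A) (c : S → Code) (s : S) : Measure A :=
  if (c s, s) ∈ 𝒦.ok then 𝒦.rule (c s) s else Measure.dirac (sel (ξ s))

theorem isUMKernel_total [MeasurableSpace X] [MeasurableSpace.CountablyGenerated X]
    [MeasurableSpace.CountablyGenerated A]
    [MeasurableSpace.CountablyGenerated S] (hξ : Measurable ξ) {sel : X → A}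
    (hsel : UniversallyMeasurable sel) {c : S → Code} (hc : UniversallyMeasurable c) :
    IsUMKernel (𝒦.total sel c) := by
  classical
  refine ⟨fun s => ?_, fun B hB => ?_⟩
  · unfold total
    split_ifs <;> infer_instance
  · cases isEmpty_or_nonempty S with
    | inl h =>
      intro t _
      rw [Subsingleton.elim (_ ⁻¹' t) ∅]
      exact fun _ _ => MeasurableSet.empty.nullMeasurableSet
    | inr h =>
      have : Nonempty X := h.map ξ
      have : Nonempty A := this.map sel
      have hpair : UniversallyMeasurable fun s => (c s, s) :=
        Measurable.prodMk (m := umSpace S) (f := c) hc (um_of_measurable measurable_id)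
      have h1 : UniversallyMeasurable fun s => 𝒦.rule (c s) s B :=
        um_comp (um_of_measurable (𝒦.measurable_rule hB)) hpair
      have h2 : UniversallyMeasurable fun s => Measure.dirac (sel (ξ s)) B := by
        simp only [Measure.dirac_apply' _ hB]
        exact um_comp (g := fun a => B.indicator 1 a) (um_of_measurable
          (measurable_one.indicator hB)) (um_comp hsel (um_of_measurable hξ))
      have h3 : (fun s => 𝒦.total sel c s B) = fun s => if (c s, s) ∈ 𝒦.ok then
          𝒦.rule (c s) s B else Measure.dirac (sel (ξ s)) B := by
        ext s
        unfold total
        split_ifs <;> rfl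
      rw [h3]
      exact Measurable.ite (m := umSpace S) (hpair _ 𝒦.measurableSet_ok) h1 h2

theorem total_feasible {sel : X → A} (hsel : ∀ x, sel x ∈ Acts x) (c : S → Code) (s : S) :
    𝒦.total sel c s (Acts (ξ s)) = 1 := by
  unfold total
  split_ifs with h
  · exact 𝒦.feasible _ _ h
  · exact Measure.dirac_apply_of_mem (hsel _)

theorem total_of_mem (sel : X → A) {c : S → Code} {s : S} (h : (c s, s) ∈ 𝒦.ok) :
    𝒦.total sel c s = 𝒦.rule (c s) s := if_pos h

end Coding

/-! ### Finite-dimensional distributions -/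

theorem infinitePi_map_prodMk {T E : Type*} [MeasurableSpace T] [MeasurableSpace E]
    {m : Measure T} [IsProbabilityMeasure m] {f : (ℕ → T) → E} (hf : Measurable f) {n : ℕ}
    (h : ∀ ω ω', (∀ k < n, ω k = ω' k) → f ω = f ω') :
    (Measure.infinitePi fun _ : ℕ => m).map (fun ω => (f ω, ω n)) =
      ((Measure.infinitePi fun _ : ℕ => m).map f).prod m := by
  classical
  have : Nonempty T := nonempty_of_isProbabilityMeasure m
  let t : T := Classical.arbitrary T
  let e : ((i : Finset.range n) → T) → ℕ → T :=
    fun r k => if h : k ∈ Finset.range n then r ⟨k, h⟩ else t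
  have he : Measurable e := by
    refine measurable_pi_lambda _ fun k => ?_
    by_cases hk : k ∈ Finset.range n
    · simpa only [e, dif_pos hk] using measurable_pi_apply _
    · simpa only [e, dif_neg hk] using measurable_const
  have hind := (iIndepFun_infinitePi (ι := ℕ) (P := fun _ => m) (X := fun _ => id)
    fun _ => measurable_id).indepFun_finset (Finset.range n) {n} (by simp)
    fun i => measurable_id.comp (measurable_pi_apply i)
  have hind' := hind.comp (hf.comp he)
    (measurable_pi_apply (⟨n, Finset.mem_singleton_self n⟩ : ({n} : Finset ℕ)))
  have hfe : ∀ ω : ℕ → T, f (e fun i => ω i) = f ω := fun ω => h _ _ fun k hk => by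
    simp [e, hk]
  have h1 : IndepFun f (fun ω => ω n) (Measure.infinitePi fun _ : ℕ => m) := by
    have h2 : f = (f ∘ e) ∘ fun ω (i : Finset.range n) => ω i := funext fun ω => (hfe ω).symm
    rw [h2]
    exact hind'
  rw [h1.map_prod_eq_prod_map_map hf.aemeasurable (measurable_pi_apply n).aemeasurable]
  congr 1
  exact Measure.infinitePi_map_eval (fun _ : ℕ => m) n

variable {X A1 A2 : Type} [MeasurableSpace X] [MeasurableSpace A1] [MeasurableSpace A2]

/-- The history up to time `n` of a trajectory. -/
def histProj (n : ℕ) (ω : TrajM X A1 A2) : HistM X A1 A2 n := (fun i : Fin n => ω i, (ω n).1)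

theorem measurable_histProj (n : ℕ) : Measurable (histProj (X := X) (A1 := A1) (A2 := A2) n) := by
  unfold histProj
  fun_prop

theorem measurable_infoM (n : ℕ) :
    Measurable (infoM : HistM X A1 A2 n → InfoM X A1 n) := by
  unfold infoM
  fun_prop

theorem measure_ext_of_histProj {p p' : Measure (TrajM X A1 A2)} [IsProbabilityMeasure p]
    [IsProbabilityMeasure p'] (h : ∀ n, p.map (histProj n) = p'.map (histProj n)) : p = p' := by
  refine IsProjectiveLimit.unique (P := fun J => p'.map J.restrict) (fun J => ?_) fun J => rfl
  let r : HistM X A1 A2 (J.sup id + 1) → (j : J) → X × A1 × A2 := fun h j =>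
    h.1 ⟨j, Nat.lt_succ_of_le (Finset.le_sup (f := id) j.2)⟩
  have hr : Measurable r := by
    refine measurable_pi_lambda _ fun j => ?_
    exact (measurable_pi_apply _).comp measurable_fst
  have hJ : (J.restrict : TrajM X A1 A2 → _) = r ∘ histProj (J.sup id + 1) := rfl
  rw [hJ, ← Measure.map_map hr (measurable_histProj _), h,
    Measure.map_map hr (measurable_histProj _), ← hJ]

/-- The one-step extension of a history. -/
def histExtend {n : ℕ} (h : HistM X A1 A2 n) (a1 : A1) (a2 : A2) (y : X) :
    HistM X A1 A2 (n + 1) := (Fin.snoc h.1 (h.2, a1, a2), y)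

theorem measurable_histExtend (n : ℕ) : Measurable fun p : HistM X A1 A2 n × A1 × A2 × X =>
    histExtend p.1 p.2.1 p.2.2.1 p.2.2.2 := by
  unfold histExtend
  refine Measurable.prodMk (measurable_pi_lambda _ fun k => ?_) (by fun_prop)
  induction k using Fin.lastCases with
  | last =>
    simp only [Fin.snoc_last]
    fun_prop
  | cast k =>
    simp only [Fin.snoc_castSucc]
    fun_prop

variable {q : Kernel (X × A1 × A2) X} {Acts1 : X → Set A1} {Acts2 : X → Set A2}

/-- A canonical parametrization of the policies and of the dynamics of the minimax control model
by codes and independent uniform random variables. -/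
structure Model (q : Kernel (X × A1 × A2) X) (Acts1 : X → Set A1) (Acts2 : X → Set A2) where
  code1 : ∀ n, Coding (fun i : InfoM X A1 n => i.2) Acts1
  code2 : ∀ n, Coding (fun h : HistM X A1 A2 n => h.2) Acts2
  next : X × A1 × A2 → I → X
  measurable_next : Measurable (Function.uncurry next)
  map_next : ∀ a, volume.map (next a) = q a

/-- The initial state and the codes of the decision rules of both players. -/
abbrev Param (X : Type) := X × (ℕ → Code) × (ℕ → Code)

/-- The driving noise: for each time, one uniform variable for each player and one for the
transition. -/
abbrev Noise := ℕ → I × I × I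

/-- The law of the driving noise. -/
abbrev noiseMeasure : Measure Noise := Measure.infinitePi fun _ => volume

namespace Model

variable (M : Model q Acts1 Acts2)

/-- One step of the dynamics. -/
def step (n : ℕ) (c1 c2 : Code) (h : HistM X A1 A2 n) (u : I × I × I) : HistM X A1 A2 (n + 1) :=
  histExtend h ((M.code1 n).act (c1, infoM h, u.1)) ((M.code2 n).act (c2, h, u.2.1))
    (M.next (h.2, (M.code1 n).act (c1, infoM h, u.1), (M.code2 n).act (c2, h, u.2.1)) u.2.2)

theorem measurable_step (n : ℕ) : Measurable fun p : (Code × Code) × HistM X A1 A2 n × I × I × I =>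
    M.step n p.1.1 p.1.2 p.2.1 p.2.2 := by
  have h1 : Measurable fun p : (Code × Code) × HistM X A1 A2 n × I × I × I =>
      (M.code1 n).act (p.1.1, infoM p.2.1, p.2.2.1) :=
    (M.code1 n).measurable_act.comp (Measurable.prodMk (by fun_prop)
      (((measurable_infoM n).comp (by fun_prop)).prodMk (by fun_prop)))
  have h2 : Measurable fun p : (Code × Code) × HistM X A1 A2 n × I × I × I =>
      (M.code2 n).act (p.1.2, p.2.1, p.2.2.2.1) :=
    (M.code2 n).measurable_act.comp (by fun_prop)
  have h3 : Measurable fun p : (Code × Code) × HistM X A1 A2 n × I × I × I =>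
      M.next (p.2.1.2, (M.code1 n).act (p.1.1, infoM p.2.1, p.2.2.1),
        (M.code2 n).act (p.1.2, p.2.1, p.2.2.2.1)) p.2.2.2.2 :=
    M.measurable_next.comp ((Measurable.prodMk (by fun_prop) (h1.prodMk h2)).prodMk (by fun_prop))
  exact (measurable_histExtend n).comp
    (Measurable.prodMk (by fun_prop) (h1.prodMk (h2.prodMk h3)))

/-- The history up to time `n` as a function of the parameters and of the noise. -/
def hist : ∀ n : ℕ, Param X → Noise → HistM X A1 A2 n
  | 0, θ, _ => (Fin.elim0, θ.1)
  | n + 1, θ, ω => M.step n (θ.2.1 n) (θ.2.2 n) (hist n θ ω) (ω n)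

theorem measurable_hist (n : ℕ) : Measurable fun p : Param X × Noise => M.hist n p.1 p.2 := by
  induction n with
  | zero => exact measurable_const.prodMk (by fun_prop)
  | succ n ih =>
    have h1 : Measurable fun p : Param X × Noise => (p.1.2.1 n, p.1.2.2 n) := by fun_prop
    have h2 : Measurable fun p : Param X × Noise => p.2 n := by fun_prop
    exact (M.measurable_step n).comp (h1.prodMk (ih.prodMk h2))

theorem measurable_hist_right (n : ℕ) (θ : Param X) : Measurable (M.hist n θ) :=
  (M.measurable_hist n).comp measurable_prodMk_left

theorem hist_congr {n : ℕ} {θ θ' : Param X} {ω ω' : Noise} (hx : θ.1 = θ'.1)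
    (h1 : ∀ k < n, θ.2.1 k = θ'.2.1 k) (h2 : ∀ k < n, θ.2.2 k = θ'.2.2 k)
    (h : ∀ k < n, ω k = ω' k) : M.hist n θ ω = M.hist n θ' ω' := by
  induction n with
  | zero => simp only [hist, hx]
  | succ n ih =>
    simp only [hist]
    rw [ih (fun k hk => h1 k (by omega)) (fun k hk => h2 k (by omega)) fun k hk => h k (by omega),
      h1 n n.lt_succ_self, h2 n n.lt_succ_self, h n n.lt_succ_self]

/-- The law of the history up to time `n`. -/
def law (n : ℕ) (θ : Param X) : Measure (HistM X A1 A2 n) := noiseMeasure.map (M.hist n θ)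

instance (n : ℕ) (θ : Param X) : IsProbabilityMeasure (M.law n θ) :=
  Measure.isProbabilityMeasure_map (M.measurable_hist_right n θ).aemeasurable

theorem law_congr {n : ℕ} {θ θ' : Param X} (hx : θ.1 = θ'.1)
    (h1 : ∀ k < n, θ.2.1 k = θ'.2.1 k) (h2 : ∀ k < n, θ.2.2 k = θ'.2.2 k) :
    M.law n θ = M.law n θ' := by
  unfold law
  congr 1
  ext1 ω
  exact M.hist_congr hx h1 h2 fun _ _ => rfl

theorem measurable_step_right (n : ℕ) (c1 c2 : Code) :
    Measurable fun p : HistM X A1 A2 n × I × I × I => M.step n c1 c2 p.1 p.2 :=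
  (M.measurable_step n).comp (measurable_prodMk_left (x := (c1, c2)))

theorem law_zero (θ : Param X) : M.law 0 θ = Measure.dirac (Fin.elim0, θ.1) := by
  have h : M.hist 0 θ = fun _ => (Fin.elim0, θ.1) := rfl
  rw [law, h, Measure.map_const, measure_univ, one_smul]

theorem law_succ (n : ℕ) (θ : Param X) : M.law (n + 1) θ = ((M.law n θ).prod volume).map
    fun p => M.step n (θ.2.1 n) (θ.2.2 n) p.1 p.2 := by
  rw [law, law, ← infinitePi_map_prodMk (M.measurable_hist_right n θ) (n := n)
    fun ω ω' h => M.hist_congr rfl (fun _ _ => rfl) (fun _ _ => rfl) h,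
    Measure.map_map (M.measurable_step_right n _ _)
      ((M.measurable_hist_right n θ).prodMk (measurable_pi_apply n))]
  rfl

/-- The trajectory as a function of the parameters and of the noise. -/
def traj (θ : Param X) (ω : Noise) : TrajM X A1 A2 :=
  fun n => (M.hist (n + 1) θ ω).1 (Fin.last n)

theorem measurable_traj : Measurable fun p : Param X × Noise => M.traj p.1 p.2 :=
  measurable_pi_lambda _ fun n =>
    (measurable_pi_apply _).comp (measurable_fst.comp (M.measurable_hist (n + 1)))

theorem histProj_traj (n : ℕ) (θ : Param X) (ω : Noise) :
    histProj n (M.traj θ ω) = M.hist n θ ω := by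
  have h2 : ∀ n, (M.traj θ ω n).1 = (M.hist n θ ω).2 := fun n => by
    simp [traj, hist, step, histExtend]
  have h1 : ∀ n, ∀ k : Fin n, M.traj θ ω k = (M.hist n θ ω).1 k := by
    intro n
    induction n with
    | zero => exact fun k => k.elim0
    | succ n ih =>
      intro k
      induction k using Fin.lastCases with
      | last => rfl
      | cast k =>
        rw [Fin.val_castSucc, ih k]
        simp [hist, step, histExtend]
  exact Prod.ext (funext (h1 n)) (h2 n)

/-- The strategic measure determined by the parameters. -/
def strat (θ : Param X) : Measure (TrajM X A1 A2) := noiseMeasure.map (M.traj θ)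

theorem measurable_traj_right (θ : Param X) : Measurable (M.traj θ) :=
  M.measurable_traj.comp measurable_prodMk_left

instance (θ : Param X) : IsProbabilityMeasure (M.strat θ) :=
  Measure.isProbabilityMeasure_map (M.measurable_traj_right θ).aemeasurable

theorem strat_map_histProj (n : ℕ) (θ : Param X) : (M.strat θ).map (histProj n) = M.law n θ := by
  rw [strat, Measure.map_map (measurable_histProj n) (M.measurable_traj_right θ), law]
  congr 1
  ext1 ω
  exact M.histProj_traj n θ ω

theorem measurable_strat {B : Set (TrajM X A1 A2)} (hB : MeasurableSet B) :
    Measurable fun θ => M.strat θ B := by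
  have h : ∀ θ, M.strat θ B =
      noiseMeasure (Prod.mk θ ⁻¹' {p : Param X × Noise | M.traj p.1 p.2 ∈ B}) :=
    fun θ => Measure.map_apply (M.measurable_traj_right θ) hB
  simp only [h]
  exact measurable_measure_prodMk_left (M.measurable_traj hB)

end Model

/-! ### Strategic measures and codes -/

theorem exists_forall_eq_of_lt {C : Type*} [Inhabited C] (F : ℕ → (ℕ → C) → C) :
    ∃ c : ℕ → C, ∀ n, c n = F n fun k => if k < n then c k else default := by
  let G : ∀ n : ℕ, (∀ k, k < n → C) → C :=
    fun n ih => F n fun k => if h : k < n then ih k h else default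
  refine ⟨wellFounded_lt.fix G, fun n => ?_⟩
  rw [wellFounded_lt.fix_eq G n]
  simp only [G, dite_eq_ite]

/-- The initial state of an information vector. -/
def initialState {X A1 : Type} : ∀ {n : ℕ}, InfoM X A1 n → X
  | 0, i => i.2
  | _ + 1, i => (i.1 0).1

theorem measurable_initialState {X A1 : Type} [MeasurableSpace X] [MeasurableSpace A1] (n : ℕ) :
    Measurable (initialState : InfoM X A1 n → X) := by
  cases n with
  | zero => exact measurable_snd
  | succ n => exact measurable_fst.comp ((measurable_pi_apply 0).comp measurable_fst)

namespace Model

section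

variable {X A1 A2 : Type} [MeasurableSpace X] [MeasurableSpace A1] [MeasurableSpace A2]
  {q : Kernel (X × A1 × A2) X} {Acts1 : X → Set A1} {Acts2 : X → Set A2} (M : Model q Acts1 Acts2)

/-- The decision rule of player 1 at time `n`. -/
abbrev rule1 (θ : Param X) (n : ℕ) (i : InfoM X A1 n) : Measure A1 := (M.code1 n).rule (θ.2.1 n) i

/-- The decision rule of player 2 at time `n`. -/
abbrev rule2 (θ : Param X) (n : ℕ) (h : HistM X A1 A2 n) : Measure A2 :=
  (M.code2 n).rule (θ.2.2 n) h

theorem lintegral_step {n : ℕ} (θ : Param X) (h : HistM X A1 A2 n)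
    {g : HistM X A1 A2 (n + 1) → ℝ≥0∞} (hg : Measurable g) :
    ∫⁻ u, g (M.step n (θ.2.1 n) (θ.2.2 n) h u) =
      ∫⁻ a1, ∫⁻ a2, ∫⁻ y, g (histExtend h a1 a2 y) ∂q (h.2, a1, a2) ∂M.rule2 θ n h
        ∂M.rule1 θ n (infoM h) := by
  have hk : Measurable fun p : (A1 × A2) × I =>
      g (histExtend h p.1.1 p.1.2 (M.next (h.2, p.1.1, p.1.2) p.2)) := by
    have h1 : Measurable fun p : (A1 × A2) × I => p.1.1 := by fun_prop
    have h2 : Measurable fun p : (A1 × A2) × I => p.1.2 := by fun_prop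
    have h3 : Measurable fun p : (A1 × A2) × I => ((h.2, p.1.1, p.1.2), p.2) := by fun_prop
    exact hg.comp ((measurable_histExtend n).comp (measurable_const.prodMk
      (h1.prodMk (h2.prodMk (M.measurable_next.comp h3)))))
  have h3 : ∀ a1 a2, ∫⁻ y, g (histExtend h a1 a2 y) ∂q (h.2, a1, a2) =
      ∫⁻ u : I, g (histExtend h a1 a2 (M.next (h.2, a1, a2) u)) := by
    intro a1 a2
    have h1 : Measurable fun y : X => (h, a1, a2, y) := by fun_prop
    rw [← M.map_next]
    exact lintegral_map (hg.comp ((measurable_histExtend n).comp h1))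
      M.measurable_next.of_uncurry_left
  have hk2 : Measurable fun p : A1 × A2 =>
      ∫⁻ u : I, g (histExtend h p.1 p.2 (M.next (h.2, p.1, p.2) u)) := hk.lintegral_prod_right'
  have hm2 := (M.code2 n).measurable_act_right (θ.2.2 n) h
  have hm1 := (M.code1 n).measurable_act_right (θ.2.1 n) (infoM h)
  have h2 : ∀ a1, ∫⁻ a2, ∫⁻ y, g (histExtend h a1 a2 y) ∂q (h.2, a1, a2) ∂M.rule2 θ n h =
      ∫⁻ v : I, ∫⁻ u : I, g (histExtend h a1 ((M.code2 n).act (θ.2.2 n, h, v))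
        (M.next (h.2, a1, (M.code2 n).act (θ.2.2 n, h, v)) u)) := by
    intro a1
    simp only [h3]
    exact lintegral_map (hk2.comp (measurable_prodMk_left (x := a1))) hm2
  have hk1 : Measurable fun a1 : A1 =>
      ∫⁻ v : I, ∫⁻ u : I, g (histExtend h a1 ((M.code2 n).act (θ.2.2 n, h, v))
        (M.next (h.2, a1, (M.code2 n).act (θ.2.2 n, h, v)) u)) :=
    (hk2.comp (measurable_fst.prodMk (hm2.comp measurable_snd)) :
      Measurable fun p : A1 × I => _).lintegral_prod_right'
  simp only [h2]
  rw [rule1, Coding.rule, lintegral_map hk1 hm1]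
  have hstep : Measurable fun u => g (M.step n (θ.2.1 n) (θ.2.2 n) h u) :=
    hg.comp ((M.measurable_step_right n _ _).comp measurable_prodMk_left)
  rw [Measure.volume_eq_prod, lintegral_prod _ hstep.aemeasurable]
  refine lintegral_congr fun u => ?_
  rw [Measure.volume_eq_prod]
  exact lintegral_prod _ (hstep.comp (measurable_prodMk_left (x := u))).aemeasurable

theorem histIntM_eq_lintegral_law [MeasurableSingletonClass X] [MeasurableSingletonClass A1]
    [MeasurableSingletonClass A2] {ν1 : ∀ n : ℕ, InfoM X A1 n → Measure A1}
    {ν2 : ∀ n : ℕ, HistM X A1 A2 n → Measure A2} {θ : Param X} {n : ℕ}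
    (hν : ∀ k < n, ∀ᵐ h ∂M.law k θ, M.rule1 θ k (infoM h) = ν1 k (infoM h) ∧
      M.rule2 θ k h = ν2 k h)
    {g g' : HistM X A1 A2 n → ℝ≥0∞} (hg' : Measurable g') (hg : g =ᵐ[M.law n θ] g') :
    histIntM (Measure.dirac θ.1) q ν1 ν2 n g = ∫⁻ h, g' h ∂M.law n θ := by
  induction n with
  | zero =>
    rw [law_zero, EventuallyEq, ae_dirac_eq, eventually_pure] at hg
    rw [law_zero, lintegral_dirac, histIntM, lintegral_dirac, hg]
  | succ n ih =>
    have hstep := M.measurable_step_right n (θ.2.1 n) (θ.2.2 n)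
    have hG : Measurable fun h => ∫⁻ u, g' (M.step n (θ.2.1 n) (θ.2.2 n) h u) :=
      (hg'.comp hstep).lintegral_prod_right'
    have hlaw : ∫⁻ h, g' h ∂M.law (n + 1) θ =
        ∫⁻ h, (∫⁻ u, g' (M.step n (θ.2.1 n) (θ.2.2 n) h u)) ∂M.law n θ := by
      rw [law_succ, lintegral_map hg' hstep]
      exact lintegral_prod _ (hg'.comp hstep).aemeasurable
    rw [hlaw, histIntM]
    refine ih (fun k hk => hν k (by omega)) hG ?_
    obtain ⟨N, hN, hNm, hN0⟩ := exists_measurable_superset_of_null hg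
    have hN1 : ∀ᵐ h ∂M.law n θ, ∀ᵐ u, M.step n (θ.2.1 n) (θ.2.2 n) h u ∉ N := by
      have h1 : ∀ᵐ h ∂M.law (n + 1) θ, h ∉ N := measure_eq_zero_iff_ae_notMem.1 hN0
      rw [law_succ] at h1
      exact Measure.ae_ae_of_ae_prod (ae_of_ae_map hstep.aemeasurable h1)
    have hgN : ∀ h, h ∉ N → g h = g' h := fun h hh => by
      by_contra hne
      exact hh (hN hne)
    let k : HistM X A1 A2 (n + 1) → ℝ≥0∞ := fun h => g' h + N.indicator (fun _ => ⊤) h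
    have hk : Measurable k := hg'.add (measurable_const.indicator hNm)
    have hgk : ∀ h, g h ≤ k h := fun h => by
      by_cases hh : h ∈ N <;> simp [k, hh, hgN]
    have hkN : ∀ h, Nᶜ.indicator g' h ≤ g h := fun h => by
      by_cases hh : h ∈ N <;> simp [hh, hgN]
    filter_upwards [hN1, hν n n.lt_succ_self] with h hh hr
    rw [← hr.1, ← hr.2]
    refine le_antisymm ?_ ?_
    · calc
        _ ≤ ∫⁻ a1, ∫⁻ a2, ∫⁻ y, k (histExtend h a1 a2 y)
            ∂q (h.2, a1, a2) ∂M.rule2 θ n h ∂M.rule1 θ n (infoM h) := by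
          exact lintegral_mono fun a1 => lintegral_mono fun a2 => lintegral_mono fun y => hgk _
        _ = ∫⁻ u, k (M.step n (θ.2.1 n) (θ.2.2 n) h u) :=
          (M.lintegral_step θ h hk).symm
        _ = _ := by
          refine lintegral_congr_ae ?_
          filter_upwards [hh] with u hu
          simp [k, hu]
    · calc
        _ = ∫⁻ u, Nᶜ.indicator g' (M.step n (θ.2.1 n) (θ.2.2 n) h u) := by
          refine lintegral_congr_ae ?_
          filter_upwards [hh] with u hu
          simp [hu]
        _ = ∫⁻ a1, ∫⁻ a2, ∫⁻ y, Nᶜ.indicator g' (histExtend h a1 a2 y)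
            ∂q (h.2, a1, a2) ∂M.rule2 θ n h ∂M.rule1 θ n (infoM h) :=
          M.lintegral_step θ h (hg'.indicator hNm.compl)
        _ ≤ _ := by
          exact lintegral_mono fun a1 => lintegral_mono fun a2 => lintegral_mono fun y => hkN _

theorem strat_eq {θ θ' : Param X} (h : ∀ n, M.law n θ = M.law n θ') :
    M.strat θ = M.strat θ' :=
  measure_ext_of_histProj fun n => by rw [strat_map_histProj, strat_map_histProj, h]

/-- The law of the information vector of player 1 at time `n`. -/
def infoLaw (n : ℕ) (θ : Param X) : Measure (InfoM X A1 n) := (M.law n θ).map infoM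

instance (n : ℕ) (θ : Param X) : IsProbabilityMeasure (M.infoLaw n θ) :=
  Measure.isProbabilityMeasure_map (measurable_infoM n).aemeasurable

theorem measurable_infoM_hist (n : ℕ) (θ : Param X) :
    Measurable fun ω => infoM (M.hist n θ ω) :=
  (measurable_infoM n).comp (M.measurable_hist_right n θ)

theorem infoLaw_eq (n : ℕ) (θ : Param X) :
    M.infoLaw n θ = noiseMeasure.map fun ω => infoM (M.hist n θ ω) :=
  Measure.map_map (measurable_infoM n) (M.measurable_hist_right n θ)

theorem infoLaw_congr {n : ℕ} {θ θ' : Param X} (hx : θ.1 = θ'.1)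
    (h1 : ∀ k < n, θ.2.1 k = θ'.2.1 k) (h2 : ∀ k < n, θ.2.2 k = θ'.2.2 k) :
    M.infoLaw n θ = M.infoLaw n θ' := by
  rw [infoLaw, infoLaw, M.law_congr hx h1 h2]

theorem strat_map_iProjM (n : ℕ) (θ : Param X) :
    (M.strat θ).map (iProjM n) = M.infoLaw n θ := by
  rw [infoLaw, ← strat_map_histProj, Measure.map_map (measurable_infoM n) (measurable_histProj n)]
  rfl

/-- The feasible parameters. -/
def good : Set (Param X) := {θ | ∀ n, (∀ᵐ i ∂M.infoLaw n θ, (θ.2.1 n, i) ∈ (M.code1 n).ok) ∧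
  ∀ᵐ h ∂M.law n θ, (θ.2.2 n, h) ∈ (M.code2 n).ok}

theorem measurableSet_good : MeasurableSet M.good := by
  have h1 : ∀ n θ, (∀ᵐ i ∂M.infoLaw n θ, (θ.2.1 n, i) ∈ (M.code1 n).ok) ↔
      ∀ᵐ ω ∂noiseMeasure, (θ, ω) ∈ (fun p : Param X × Noise =>
        (p.1.2.1 n, infoM (M.hist n p.1 p.2))) ⁻¹' (M.code1 n).ok := by
    intro n θ
    rw [infoLaw_eq, ae_map_iff
      (M.measurable_infoM_hist n θ).aemeasurable
      (measurable_prodMk_left (M.code1 n).measurableSet_ok)]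
    rfl
  have h2 : ∀ n θ, (∀ᵐ h ∂M.law n θ, (θ.2.2 n, h) ∈ (M.code2 n).ok) ↔
      ∀ᵐ ω ∂noiseMeasure, (θ, ω) ∈ (fun p : Param X × Noise =>
        (p.1.2.2 n, M.hist n p.1 p.2)) ⁻¹' (M.code2 n).ok := by
    intro n θ
    rw [law, ae_map_iff (M.measurable_hist_right n θ).aemeasurable
      (measurable_prodMk_left (M.code2 n).measurableSet_ok)]
    rfl
  simp only [good, h1, h2, ofPred_forall, ofPred_and]
  refine MeasurableSet.iInter fun n => (measurableSet_ae_right ?_).inter (measurableSet_ae_right ?_)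
  · have hz : Measurable fun p : Param X × Noise => p.1.2.1 n := by fun_prop
    exact hz.prodMk ((measurable_infoM n).comp (M.measurable_hist n))
      (M.code1 n).measurableSet_ok
  · have hz : Measurable fun p : Param X × Noise => p.1.2.2 n := by fun_prop
    exact hz.prodMk (M.measurable_hist n) (M.code2 n).measurableSet_ok

theorem ae_initialState (n : ℕ) (θ : Param X) [MeasurableSingletonClass X] :
    ∀ᵐ i ∂M.infoLaw n θ, initialState i = θ.1 := by
  rw [infoLaw_eq, ae_map_iff (p := fun i => initialState i = θ.1)
    (M.measurable_infoM_hist n θ).aemeasurable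
    (measurable_initialState n (measurableSet_singleton θ.1))]
  refine ae_of_all _ fun ω => ?_
  rw [← histProj_traj]
  have h1 : initialState (infoM (histProj n (M.traj θ ω))) = (M.traj θ ω 0).1 := by
    cases n <;> rfl
  rw [h1]
  exact congrArg Prod.snd (M.histProj_traj 0 θ ω)

end

section

variable {X A1 A2 : Type} [MeasurableSpace X] [MeasurableSpace A1] [MeasurableSpace A2]
  [MeasurableSingletonClass X] [MeasurableSingletonClass A1] [MeasurableSingletonClass A2]
  {q : Kernel (X × A1 × A2) X} {Acts1 : X → Set A1} {Acts2 : X → Set A2} (M : Model q Acts1 Acts2)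

theorem histIntM_indicator {ν1 : ∀ n : ℕ, InfoM X A1 n → Measure A1}
    {ν2 : ∀ n : ℕ, HistM X A1 A2 n → Measure A2} {θ : Param X} {n : ℕ}
    (hν : ∀ k < n, ∀ᵐ h ∂M.law k θ, M.rule1 θ k (infoM h) = ν1 k (infoM h) ∧
      M.rule2 θ k h = ν2 k h) {B : Set (HistM X A1 A2 n)} (hB : MeasurableSet B) :
    histIntM (Measure.dirac θ.1) q ν1 ν2 n (B.indicator fun _ => 1) = M.law n θ B := by
  rw [M.histIntM_eq_lintegral_law hν (measurable_const.indicator hB) .rfl]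
  exact lintegral_indicator_one hB

theorem law_eq {θ θ' : Param X} (hx : θ.1 = θ'.1)
    (h : ∀ n, M.law n θ = M.law n θ' → ∀ᵐ h ∂M.law n θ',
      M.rule1 θ' n (infoM h) = M.rule1 θ n (infoM h) ∧ M.rule2 θ' n h = M.rule2 θ n h) (n : ℕ) :
    M.law n θ = M.law n θ' := by
  induction n using Nat.strong_induction_on with
  | _ n ih =>
    ext B hB
    rw [← M.histIntM_indicator (ν1 := M.rule1 θ) (ν2 := M.rule2 θ)
      (fun k _ => ae_of_all _ fun _ => ⟨rfl, rfl⟩) hB, hx]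
    exact M.histIntM_indicator (fun k hk => h k (ih k hk)) hB

theorem inducesM_strat {π1 : Policy1 Acts1} {π2 : Policy2 A1 Acts2} {θ : Param X}
    (h : ∀ n, ∀ᵐ h ∂M.law n θ, M.rule1 θ n (infoM h) = π1.μ n (infoM h) ∧
      M.rule2 θ n h = π2.μ n h) :
    InducesM q π1 π2 (Measure.dirac θ.1) (M.strat θ) := by
  intro n B hB
  rw [M.histIntM_indicator (fun k _ => h k) hB, ← strat_map_histProj,
    Measure.map_apply (measurable_histProj n) hB]
  rfl

end

end Model

theorem inducesM_unique {X A1 A2 : Type} [MeasurableSpace X] [MeasurableSpace A1]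
    [MeasurableSpace A2] {q : Kernel (X × A1 × A2) X} {Acts1 : X → Set A1} {Acts2 : X → Set A2}
    {π1 : Policy1 Acts1} {π2 : Policy2 A1 Acts2} {p0 : Measure X} {p p' : Measure (TrajM X A1 A2)}
    [IsProbabilityMeasure p] [IsProbabilityMeasure p'] (h : InducesM q π1 π2 p0 p)
    (h' : InducesM q π1 π2 p0 p') : p = p' := by
  refine measure_ext_of_histProj fun n => Measure.ext fun B hB => ?_
  rw [Measure.map_apply (measurable_histProj n) hB, Measure.map_apply (measurable_histProj n) hB]
  exact (h n B hB).trans (h' n B hB).symm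

namespace Model

section

variable {X A1 A2 : Type} [MeasurableSpace X] [MeasurableSpace A1] [MeasurableSpace A2]
  {q : Kernel (X × A1 × A2) X} {Acts1 : X → Set A1} {Acts2 : X → Set A2} (M : Model q Acts1 Acts2)

/-- The parameter `θ` codes the decision rules of the policy `π1`. -/
def Codes1 (π1 : Policy1 Acts1) (θ : Param X) : Prop :=
  ∀ n, ∀ᵐ i ∂M.infoLaw n θ, (θ.2.1 n, i) ∈ (M.code1 n).ok ∧ M.rule1 θ n i = π1.μ n i

/-- The parameter `θ` codes the decision rules of the policy `π2`. -/
def Codes2 (π2 : Policy2 A1 Acts2) (θ : Param X) : Prop :=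
  ∀ n, ∀ᵐ h ∂M.law n θ, (θ.2.2 n, h) ∈ (M.code2 n).ok ∧ M.rule2 θ n h = π2.μ n h

variable {M}

theorem Codes1.ae_law {π1 : Policy1 Acts1} {θ : Param X} (h : M.Codes1 π1 θ) (n : ℕ) :
    ∀ᵐ h ∂M.law n θ, M.rule1 θ n (infoM h) = π1.μ n (infoM h) :=
  (ae_of_ae_map (measurable_infoM n).aemeasurable (h n)).mono fun _ h => h.2

theorem mem_good_of_codes {π1 : Policy1 Acts1} {π2 : Policy2 A1 Acts2} {θ : Param X}
    (h1 : M.Codes1 π1 θ) (h2 : M.Codes2 π2 θ) : θ ∈ M.good :=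
  fun n => ⟨(h1 n).mono fun _ h => h.1, (h2 n).mono fun _ h => h.1⟩

variable (M)

theorem exists_codes (π1 : Policy1 Acts1) (π2 : Policy2 A1 Acts2) (x : X) :
    ∃ z y, M.Codes1 π1 (x, z, y) ∧ M.Codes2 π2 (x, z, y) := by
  have key : ∀ n (θ : Param X), ∃ c : Code × Code,
      (∀ᵐ i ∂M.infoLaw n θ, (c.1, i) ∈ (M.code1 n).ok ∧ (M.code1 n).rule c.1 i = π1.μ n i) ∧
      ∀ᵐ h ∂M.law n θ, (c.2, h) ∈ (M.code2 n).ok ∧ (M.code2 n).rule c.2 h = π2.μ n h := by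
    intro n θ
    obtain ⟨c1, h1⟩ := (M.code1 n).exists_code (π1.μ n) ⟨π1.isProb n, π1.umeas n⟩
      (π1.feasible n) (M.infoLaw n θ)
    obtain ⟨c2, h2⟩ := (M.code2 n).exists_code (π2.μ n) ⟨π2.isProb n, π2.umeas n⟩
      (π2.feasible n) (M.law n θ)
    exact ⟨(c1, c2), h1, h2⟩
  choose F hF1 hF2 using key
  obtain ⟨c, hc⟩ := exists_forall_eq_of_lt fun n (c : ℕ → Code × Code) =>
    F n (x, fun k => (c k).1, fun k => (c k).2)
  let θ : ℕ → Param X := fun n => (x, fun k => (if k < n then c k else default).1,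
    fun k => (if k < n then c k else default).2)
  refine ⟨fun k => (c k).1, fun k => (c k).2, fun n => ?_, fun n => ?_⟩
  · have h := hF1 n (θ n)
    rw [← hc n] at h
    have e : M.infoLaw n (x, (fun k => (c k).1), fun k => (c k).2) = M.infoLaw n (θ n) :=
      M.infoLaw_congr rfl (fun k hk => by simp [θ, hk]) fun k hk => by simp [θ, hk]
    rw [e]
    exact h
  · have h := hF2 n (θ n)
    rw [← hc n] at h
    have e : M.law n (x, (fun k => (c k).1), fun k => (c k).2) = M.law n (θ n) :=
      M.law_congr rfl (fun k hk => by simp [θ, hk]) fun k hk => by simp [θ, hk]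
    rw [e]
    exact h

/-- The strategic measure determined by the parameters, as an element of the space of probability
measures. -/
def stratP (θ : Param X) : ProbabilityMeasure (TrajM X A1 A2) := ⟨M.strat θ, inferInstance⟩

variable {M} in
theorem inducesM_of_codes [MeasurableSingletonClass X] [MeasurableSingletonClass A1]
    [MeasurableSingletonClass A2] {π1 : Policy1 Acts1} {π2 : Policy2 A1 Acts2} {θ : Param X}
    (h1 : M.Codes1 π1 θ) (h2 : M.Codes2 π2 θ) :
    InducesM q π1 π2 (Measure.dirac θ.1) (M.stratP θ).toMeasure :=
  M.inducesM_strat fun n => (h1.ae_law n).and ((h2 n).mono fun _ h => h.2)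

end

section

variable {X A1 A2 : Type}
  [TopologicalSpace X] [PolishSpace X] [MeasurableSpace X] [BorelSpace X]
  [TopologicalSpace A1] [PolishSpace A1] [MeasurableSpace A1] [BorelSpace A1]
  [MeasurableSpace A2]
  {q : Kernel (X × A1 × A2) X} {Acts1 : X → Set A1} {Acts2 : X → Set A2} (M : Model q Acts1 Acts2)

theorem exists_policy1 {sel : X → A1} (hsel : UniversallyMeasurable sel)
    (hsel' : ∀ x, sel x ∈ Acts1 x) {ζ : X → ℕ → Code} (hζ : UniversallyMeasurable ζ) :
    ∃ π1 : Policy1 Acts1, ∀ x y, (x, ζ x, y) ∈ M.good → M.Codes1 π1 (x, ζ x, y) := by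
  cases isEmpty_or_nonempty X with
  | inl h =>
    exact ⟨⟨fun _ i => isEmptyElim i.2, fun _ i => isEmptyElim i.2, fun n B _ s _ => by
      have : IsEmpty (InfoM X A1 n) := ⟨fun i => isEmptyElim i.2⟩
      rw [Subsingleton.elim (_ ⁻¹' s) ∅]
      exact fun _ _ => MeasurableSet.empty.nullMeasurableSet,
      fun _ i => isEmptyElim i.2⟩, fun x => isEmptyElim x⟩
  | inr h =>
    have hum := fun n => (M.code1 n).isUMKernel_total measurable_snd hsel
      (c := fun i => ζ (initialState i) n)
      (um_comp (g := fun x => ζ x n)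
        (um_comp (g := fun z : ℕ → Code => z n) (um_of_measurable (measurable_pi_apply n)) hζ)
        (um_of_measurable (measurable_initialState n)))
    refine ⟨⟨fun n => (M.code1 n).total sel fun i => ζ (initialState i) n,
      fun n => (hum n).isProb, fun n => (hum n).um, fun n => (M.code1 n).total_feasible hsel' _⟩,
      fun x y hg n => ?_⟩
    filter_upwards [(hg n).1, M.ae_initialState n (x, ζ x, y)] with i hi hi'
    refine ⟨hi, ?_⟩
    have h := (M.code1 n).total_of_mem sel (c := fun i => ζ (initialState i) n) (s := i)
      (by rw [hi']; exact hi)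
    rw [h, hi']

end

section

variable {X A1 A2 : Type}
  [TopologicalSpace X] [PolishSpace X] [MeasurableSpace X] [BorelSpace X]
  [TopologicalSpace A1] [PolishSpace A1] [MeasurableSpace A1] [BorelSpace A1]
  [TopologicalSpace A2] [PolishSpace A2] [MeasurableSpace A2] [BorelSpace A2]
  {q : Kernel (X × A1 × A2) X} {Acts1 : X → Set A1} {Acts2 : X → Set A2} (M : Model q Acts1 Acts2)

theorem exists_policy2 {sel : X → A2} (hsel : UniversallyMeasurable sel)
    (hsel' : ∀ x, sel x ∈ Acts2 x) (y : ℕ → Code) :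
    ∃ π2 : Policy2 A1 Acts2, ∀ n h, (y n, h) ∈ (M.code2 n).ok →
      π2.μ n h = (M.code2 n).rule (y n) h := by
  have hum := fun n => (M.code2 n).isUMKernel_total measurable_snd hsel
    (um_of_measurable (measurable_const (a := y n)))
  exact ⟨⟨fun n => (M.code2 n).total sel fun _ => y n, fun n => (hum n).isProb,
    fun n => (hum n).um, fun n => (M.code2 n).total_feasible hsel' _⟩,
    fun n h hh => (M.code2 n).total_of_mem sel (c := fun _ => y n) (s := h) hh⟩

/-- The payoff guaranteed by the codes `z` at the initial state `x`. -/
def value (φ : ProbabilityMeasure (TrajM X A1 A2) → EReal) (x : X) (z : ℕ → Code) : EReal :=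
  ⨆ (y : ℕ → Code) (_ : (x, z, y) ∈ M.good), φ (M.stratP (x, z, y))

theorem ae_codes_of_induces {sel : X → A2} (hsel : UniversallyMeasurable sel)
    (hsel' : ∀ x, sel x ∈ Acts2 x) (hAC : AssumpAC q Acts1 Acts2) {π1 : Policy1 Acts1}
    {θ₀ θ : Param X} (hg : θ₀ ∈ M.good) (hc : M.Codes1 π1 θ₀) {π2 : Policy2 A1 Acts2}
    (hθ : InducesM q π1 π2 (Measure.dirac θ₀.1) (M.stratP θ).toMeasure) (n : ℕ) :
    ∀ᵐ i ∂M.infoLaw n θ, (θ₀.2.1 n, i) ∈ (M.code1 n).ok ∧ M.rule1 θ₀ n i = π1.μ n i := by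
  obtain ⟨π2₀, hπ2₀⟩ := M.exists_policy2 hsel hsel' θ₀.2.2
  have hind₀ : InducesM q π1 π2₀ (Measure.dirac θ₀.1) (M.stratP θ₀).toMeasure :=
    inducesM_of_codes hc fun n => (hg n).2.mono fun h hh => ⟨hh, (hπ2₀ n h hh).symm⟩
  have h : (M.strat θ).map (iProjM n) ≪ (M.strat θ₀).map (iProjM n) :=
    hAC π1 π2 π2₀ θ₀.1 _ _ hθ hind₀ n
  rw [strat_map_iProjM, strat_map_iProjM] at h
  exact h.ae_le (hc n)

theorem sup2_le_value {sel : X → A2} (hsel : UniversallyMeasurable sel)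
    (hsel' : ∀ x, sel x ∈ Acts2 x) (hAC : AssumpAC q Acts1 Acts2)
    (φ : ProbabilityMeasure (TrajM X A1 A2) → EReal) {π1 : Policy1 Acts1} {x : X}
    {z y₀ : ℕ → Code} (hg : (x, z, y₀) ∈ M.good) (hc : M.Codes1 π1 (x, z, y₀)) :
    sup2 q Acts2 φ π1 x ≤ M.value φ x z := by
  refine iSup_le fun π2 => iSup_le fun p => iSup_le fun hp => ?_
  obtain ⟨z', y', h1, h2⟩ := M.exists_codes π1 π2 x
  have hind := inducesM_of_codes h1 h2
  have := p.2
  have := (M.stratP (x, z', y')).2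
  have hpe : p = M.stratP (x, z', y') := Subtype.ext (inducesM_unique hp hind)
  have hac := M.ae_codes_of_induces hsel hsel' hAC hg hc hind
  have hlaw : ∀ n, M.law n (x, z, y') = M.law n (x, z', y') :=
    M.law_eq rfl fun n _ => by
      filter_upwards [h1.ae_law n, ae_of_ae_map (measurable_infoM n).aemeasurable (hac n)]
        with h hh hh'
      exact ⟨hh.trans hh'.2.symm, rfl⟩
  have hgood : (x, z, y') ∈ M.good := by
    intro n
    rw [infoLaw, hlaw]
    exact ⟨(hac n).mono fun _ h => h.1, (h2 n).mono fun _ h => h.1⟩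
  have hs : M.stratP (x, z', y') = M.stratP (x, z, y') :=
    Subtype.ext (M.strat_eq fun n => (hlaw n).symm)
  rw [hpe, hs]
  exact le_iSup₂ (f := fun y (_ : (x, z, y) ∈ M.good) => φ (M.stratP (x, z, y))) y' hgood

theorem value_le_sup2 {sel : X → A2} (hsel : UniversallyMeasurable sel)
    (hsel' : ∀ x, sel x ∈ Acts2 x) (hAC : AssumpAC q Acts1 Acts2)
    (φ : ProbabilityMeasure (TrajM X A1 A2) → EReal) {π1 : Policy1 Acts1} {x : X}
    {z y₀ : ℕ → Code} (hg : (x, z, y₀) ∈ M.good) (hc : M.Codes1 π1 (x, z, y₀)) :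
    M.value φ x z ≤ sup2 q Acts2 φ π1 x := by
  refine iSup₂_le fun y hy => ?_
  obtain ⟨π2, hπ2⟩ := M.exists_policy2 hsel hsel' y
  obtain ⟨z', y', h1, h2⟩ := M.exists_codes π1 π2 x
  have hind := inducesM_of_codes h1 h2
  have hac := M.ae_codes_of_induces hsel hsel' hAC hg hc hind
  have hlaw : ∀ n, M.law n (x, z, y) = M.law n (x, z', y') :=
    M.law_eq rfl fun n hn => by
      have hy2 := (hy n).2
      rw [hn] at hy2
      filter_upwards [h1.ae_law n, ae_of_ae_map (measurable_infoM n).aemeasurable (hac n),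
        h2 n, hy2] with h hh hh' hh2 hh2'
      exact ⟨hh.trans hh'.2.symm, hh2.2.trans (hπ2 n h hh2')⟩
  have hs : M.stratP (x, z, y) = M.stratP (x, z', y') := Subtype.ext (M.strat_eq hlaw)
  rw [hs]
  exact le_iSup_of_le π2 (le_iSup_of_le _ (le_iSup_of_le hind le_rfl))

end

end Model

section

set_option synthInstance.maxSize 10000

instance polishSpace_codes : PolishSpace (ℕ → Code) := inferInstance

instance borelSpace_codes : BorelSpace (ℕ → Code) := inferInstance

end

instance polishSpace_prod (S T : Type*) [TopologicalSpace S] [PolishSpace S] [TopologicalSpace T]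
    [PolishSpace T] : PolishSpace (S × T) :=
  inferInstance

instance borelSpace_prod (S T : Type*) [TopologicalSpace S] [PolishSpace S] [MeasurableSpace S]
    [BorelSpace S] [TopologicalSpace T] [PolishSpace T] [MeasurableSpace T] [BorelSpace T] :
    BorelSpace (S × T) :=
  inferInstance

instance polishSpace_codePairs : PolishSpace ((ℕ → Code) × (ℕ → Code)) :=
  polishSpace_prod _ _

instance borelSpace_codePairs : BorelSpace ((ℕ → Code) × (ℕ → Code)) :=
  borelSpace_prod _ _

theorem measurable_coe_of_continuous {T Ω : Type*} [TopologicalSpace T] [MeasurableSpace T]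
    [OpensMeasurableSpace T] [TopologicalSpace Ω] [MeasurableSpace Ω] [BorelSpace Ω]
    [HasOuterApproxClosed Ω] {f : T → ProbabilityMeasure Ω} (hf : Continuous f) {B : Set Ω}
    (hB : MeasurableSet B) : Measurable fun t => (f t).toMeasure B := by
  have h : Measurable fun t => (f t).toMeasure := by
    have : ∀ t, IsProbabilityMeasure (f t).toMeasure := fun t => (f t).2
    refine .measure_of_isPiSystem_of_isProbabilityMeasure
      (S := {s : Set Ω | IsOpen s}) (BorelSpace.measurable_eq) isPiSystem_isOpen fun s hs => ?_
    refine LowerSemicontinuous.measurable (lowerSemicontinuous_iff_le_liminf.2 fun t => ?_)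
    exact ProbabilityMeasure.le_liminf_measure_open_of_tendsto (hf.tendsto t) hs
  exact (Measure.measurable_coe hB).comp h

theorem analyticSet_preimage_probabilityMeasure {T Ω : Type} [TopologicalSpace T] [PolishSpace T]
    [MeasurableSpace T] [BorelSpace T] [TopologicalSpace Ω] [MeasurableSpace Ω] [BorelSpace Ω]
    [HasOuterApproxClosed Ω] [MeasurableSpace.CountablyGenerated Ω]
    {κ : T → ProbabilityMeasure Ω}
    (hκ : ∀ B, MeasurableSet B → Measurable fun t => (κ t).toMeasure B)
    {S : Set (ProbabilityMeasure Ω)} (hS : AnalyticSet S) : AnalyticSet {t | κ t ∈ S} := by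
  rw [AnalyticSet] at hS
  obtain rfl | ⟨ψ, hψ, rfl⟩ := hS
  · simpa using analyticSet_empty
  obtain ⟨𝒞, h𝒞c, h𝒞p, h𝒞⟩ := exists_countable_piSystem Ω
  have h𝒞m : ∀ B ∈ 𝒞, MeasurableSet B := fun B hB => by
    rw [h𝒞]
    exact MeasurableSpace.measurableSet_generateFrom hB
  have hC : MeasurableSet {p : T × (ℕ → ℕ) |
      ∀ B ∈ 𝒞, (κ p.1).toMeasure B = (ψ p.2).toMeasure B} := by
    have e : {p : T × (ℕ → ℕ) | ∀ B ∈ 𝒞, (κ p.1).toMeasure B = (ψ p.2).toMeasure B} =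
        ⋂ B ∈ 𝒞, {p : T × (ℕ → ℕ) | (κ p.1).toMeasure B = (ψ p.2).toMeasure B} := by
      ext p
      simp
    rw [e]
    exact .biInter h𝒞c fun B hB => measurableSet_eq_fun ((hκ B (h𝒞m B hB)).comp measurable_fst)
      ((measurable_coe_of_continuous hψ (h𝒞m B hB)).comp measurable_snd)
  convert hC.analyticSet.image_of_continuous continuous_fst
  ext t
  simp only [mem_ofPred_eq, mem_range, mem_image, Prod.exists, exists_and_right, exists_eq_right]
  refine exists_congr fun w => ⟨fun h B _ => by rw [h], fun h => Subtype.ext ?_⟩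
  have := (κ t).2
  have := (ψ w).2
  exact (ext_of_generate_finite 𝒞 h𝒞 h𝒞p h (by simp)).symm

namespace Model

variable {X A1 A2 : Type}
  [TopologicalSpace X] [PolishSpace X] [MeasurableSpace X] [BorelSpace X]
  [TopologicalSpace A1] [PolishSpace A1] [MeasurableSpace A1] [BorelSpace A1]
  [TopologicalSpace A2] [PolishSpace A2] [MeasurableSpace A2] [BorelSpace A2]
  {q : Kernel (X × A1 × A2) X} {Acts1 : X → Set A1} {Acts2 : X → Set A2} (M : Model q Acts1 Acts2)
  {φ : ProbabilityMeasure (TrajM X A1 A2) → EReal}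

/-- The triples of an initial state `x`, a bound `b` and codes for the two players which are
admissible and for which the codes of player 1 guarantee a payoff of at most `b` at `x`. -/
def guarantee (φ : ProbabilityMeasure (TrajM X A1 A2) → EReal) :
    Set ((X × EReal) × ((ℕ → Code) × (ℕ → Code))) :=
  {p | (p.1.1, p.2) ∈ M.good ∧ M.value φ p.1.1 p.2.1 ≤ p.1.2}

theorem analyticSet_rat_le (hφ : UpperSemianalytic φ) (r : ℚ) :
    AnalyticSet {p : X × (ℕ → Code) |
      ∃ y, (p.1, p.2, y) ∈ M.good ∧ ((r : ℝ) : EReal) ≤ φ (M.stratP (p.1, p.2, y))} := by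
  have h1 : AnalyticSet {θ : Param X | M.stratP θ ∈ {p | ((r : ℝ) : EReal) ≤ φ p}} :=
    analyticSet_preimage_probabilityMeasure (fun B hB => M.measurable_strat hB) (hφ r)
  have h2 := Uniformization.analyticSet_inter M.measurableSet_good.analyticSet h1
  have hc : Continuous fun θ : Param X => (θ.1, θ.2.1) := by fun_prop
  convert h2.image_of_continuous hc
  ext ⟨x, z⟩
  constructor
  · rintro ⟨y, h, h'⟩
    exact ⟨(x, z, y), ⟨h, h'⟩, rfl⟩
  · rintro ⟨⟨x', z', y'⟩, ⟨h, h'⟩, he⟩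
    obtain ⟨rfl, rfl⟩ := Prod.mk.inj he
    exact ⟨y', h, h'⟩

theorem analyticSet_compl_guarantee (hφ : UpperSemianalytic φ) :
    AnalyticSet (M.guarantee φ)ᶜ := by
  have hg : Measurable fun p : (X × EReal) × ((ℕ → Code) × (ℕ → Code)) => (p.1.1, p.2) := by
    fun_prop
  have hc : Continuous fun p : (X × EReal) × ((ℕ → Code) × (ℕ → Code)) => (p.1.1, p.2.1) := by
    fun_prop
  have hb : Measurable fun p : (X × EReal) × ((ℕ → Code) × (ℕ → Code)) => p.1.2 := by
    fun_prop
  have e : (M.guarantee φ)ᶜ = ((fun p => (p.1.1, p.2)) ⁻¹' M.good)ᶜ ∪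
      ⋃ r : ℚ, ({p | p.1.2 < ((r : ℝ) : EReal)} ∩ (fun p => (p.1.1, p.2.1)) ⁻¹'
        {p : X × (ℕ → Code) |
          ∃ y, (p.1, p.2, y) ∈ M.good ∧ ((r : ℝ) : EReal) ≤ φ (M.stratP (p.1, p.2, y))}) := by
    ext ⟨⟨x, b⟩, z, y⟩
    have h : b < M.value φ x z ↔ ∃ r : ℚ, b < ((r : ℝ) : EReal) ∧
        ∃ y, (x, z, y) ∈ M.good ∧ ((r : ℝ) : EReal) ≤ φ (M.stratP (x, z, y)) := by
      simp only [value, lt_iSup_iff]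
      constructor
      · rintro ⟨y, hy, h⟩
        obtain ⟨r, h1, h2⟩ := EReal.lt_iff_exists_rat_btwn.1 h
        exact ⟨r, h1, y, hy, h2.le⟩
      · rintro ⟨r, h, y, hy, h'⟩
        exact ⟨y, hy, h.trans_le h'⟩
    simp only [guarantee, mem_compl_iff, mem_ofPred_eq, not_and_or, not_le, h, mem_union,
      mem_preimage, mem_iUnion, mem_inter_iff]
  rw [e]
  refine Uniformization.analyticSet_union (hg M.measurableSet_good).compl.analyticSet
    (.iUnion fun r => Uniformization.analyticSet_inter
      (measurableSet_lt hb measurable_const).analyticSet ((M.analyticSet_rat_le hφ r).preimage hc))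

end Model

namespace Model

variable {X A1 A2 : Type}
  [TopologicalSpace X] [PolishSpace X] [MeasurableSpace X] [BorelSpace X]
  [TopologicalSpace A1] [PolishSpace A1] [MeasurableSpace A1] [BorelSpace A1]
  [TopologicalSpace A2] [PolishSpace A2] [MeasurableSpace A2] [BorelSpace A2]
  {q : Kernel (X × A1 × A2) X} {Acts1 : X → Set A1} {Acts2 : X → Set A2}
  {φ : ProbabilityMeasure (TrajM X A1 A2) → EReal}

theorem exists_guarantee_iff (M : Model q Acts1 Acts2) {sel1 : X → A1}
    (hsel1 : UniversallyMeasurable sel1) (hsel1' : ∀ x, sel1 x ∈ Acts1 x)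
    {sel2 : X → A2} (hsel2 : UniversallyMeasurable sel2)
    (hsel2' : ∀ x, sel2 x ∈ Acts2 x) (hAC : AssumpAC q Acts1 Acts2) (x : X) (b : EReal) :
    (∃ p, ((x, b), p) ∈ M.guarantee φ) ↔ ∃ π1 : Policy1 Acts1, sup2 q Acts2 φ π1 x ≤ b := by
  constructor
  · rintro ⟨⟨z, y⟩, hg, hb⟩
    obtain ⟨π1, hπ1⟩ := M.exists_policy1 hsel1 hsel1' (um_of_measurable (measurable_const (a := z)))
    exact ⟨π1, (M.sup2_le_value hsel2 hsel2' hAC φ hg (hπ1 x y hg)).trans hb⟩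
  · rintro ⟨π1, hb⟩
    obtain ⟨π2, -⟩ := M.exists_policy2 hsel2 hsel2' 0
    obtain ⟨z, y, h1, h2⟩ := M.exists_codes π1 π2 x
    have hg := mem_good_of_codes h1 h2
    exact ⟨(z, y), hg, (M.value_le_sup2 hsel2 hsel2' hAC φ hg h1).trans hb⟩

theorem exists_guarantee_of_lt (M : Model q Acts1 Acts2) {sel1 : X → A1}
    (hsel1 : UniversallyMeasurable sel1) (hsel1' : ∀ x, sel1 x ∈ Acts1 x)
    {sel2 : X → A2} (hsel2 : UniversallyMeasurable sel2)
    (hsel2' : ∀ x, sel2 x ∈ Acts2 x) (hAC : AssumpAC q Acts1 Acts2) {x : X} {b : EReal}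
    (hb : gMinimax q Acts1 Acts2 φ x < b) : ∃ p, ((x, b), p) ∈ M.guarantee φ := by
  obtain ⟨π1, h⟩ := iInf_lt_iff.1 hb
  exact (M.exists_guarantee_iff hsel1 hsel1' hsel2 hsel2' hAC x b).2 ⟨π1, h.le⟩

theorem um_gMinimax (M : Model q Acts1 Acts2) (hAD : Sigma12UniversallyMeasurable) {sel1 : X → A1}
    (hsel1 : UniversallyMeasurable sel1) (hsel1' : ∀ x, sel1 x ∈ Acts1 x) {sel2 : X → A2}
    (hsel2 : UniversallyMeasurable sel2) (hsel2' : ∀ x, sel2 x ∈ Acts2 x)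
    (hAC : AssumpAC q Acts1 Acts2) (hφ : UpperSemianalytic φ) :
    UniversallyMeasurable (gMinimax q Acts1 Acts2 φ) := by
  cases isEmpty_or_nonempty X with
  | inl h =>
    intro s _
    rw [Subsingleton.elim (_ ⁻¹' s) ∅]
    exact fun _ _ => MeasurableSet.empty.nullMeasurableSet
  | inr h =>
    refine measurable_of_Iio (mδ := umSpace X) fun b => ?_
    have e : gMinimax q Acts1 Acts2 φ ⁻¹' Iio b = ⋃ r : {r : ℚ // ((r : ℝ) : EReal) < b},
        (fun x => (x, ((r : ℝ) : EReal))) ⁻¹' {s | ∃ p, (s, p) ∈ M.guarantee φ} := by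
      ext x
      simp only [mem_preimage, mem_Iio, mem_iUnion, mem_ofPred_eq, Subtype.exists]
      constructor
      · intro h
        obtain ⟨r, h1, h2⟩ := EReal.lt_iff_exists_rat_btwn.1 h
        exact ⟨r, h2, M.exists_guarantee_of_lt hsel1 hsel1' hsel2 hsel2' hAC h1⟩
      · rintro ⟨r, hr, h⟩
        obtain ⟨π1, h⟩ := (M.exists_guarantee_iff hsel1 hsel1' hsel2 hsel2' hAC x _).1 h
        exact ((iInf_le _ π1).trans h).trans_lt hr
    rw [e]
    refine @MeasurableSet.iUnion X _ (umSpace X) _ _ fun r => ?_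
    exact umSet_preimage (s := {s | ∃ p, (s, p) ∈ M.guarantee φ})
      (umSet_exists hAD (M.analyticSet_compl_guarantee hφ))
      (um_of_measurable (measurable_id.prodMk measurable_const))

theorem exists_policy1_of_guarantee (M : Model q Acts1 Acts2)
    (hAD : Sigma12UniversallyMeasurable) {sel1 : X → A1}
    (hsel1 : UniversallyMeasurable sel1) (hsel1' : ∀ x, sel1 x ∈ Acts1 x) {sel2 : X → A2}
    (hsel2 : UniversallyMeasurable sel2) (hsel2' : ∀ x, sel2 x ∈ Acts2 x)
    (hAC : AssumpAC q Acts1 Acts2) (hφ : UpperSemianalytic φ) [Nonempty X] {b : X → EReal}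
    (hb : UniversallyMeasurable b) (h : ∀ x, ∃ p, ((x, b x), p) ∈ M.guarantee φ) :
    ∃ π1 : Policy1 Acts1, ∀ x, sup2 q Acts2 φ π1 x ≤ b x := by
  obtain ⟨ζ, hζ, hζg⟩ := exists_um_selector hAD (M.analyticSet_compl_guarantee hφ)
  have hxb : UniversallyMeasurable fun x => (x, b x) :=
    Measurable.prodMk (m := umSpace X) (f := fun x => x) (um_of_measurable measurable_id) hb
  obtain ⟨π1, hπ1⟩ := M.exists_policy1 hsel1 hsel1' (ζ := fun x => (ζ (x, b x)).1)
    (um_comp (g := Prod.fst) (um_of_measurable measurable_fst)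
      (um_comp (g := ζ) (f := fun x => (x, b x)) hζ hxb))
  refine ⟨π1, fun x => ?_⟩
  obtain ⟨p, hp⟩ := h x
  obtain ⟨hg, hv⟩ := hζg _ p hp
  exact (M.sup2_le_value hsel2 hsel2' hAC φ hg (hπ1 x _ hg)).trans hv

theorem exists_optimal_policy1 (M : Model q Acts1 Acts2)
    (hAD : Sigma12UniversallyMeasurable) {sel1 : X → A1}
    (hsel1 : UniversallyMeasurable sel1) (hsel1' : ∀ x, sel1 x ∈ Acts1 x) {sel2 : X → A2}
    (hsel2 : UniversallyMeasurable sel2) (hsel2' : ∀ x, sel2 x ∈ Acts2 x)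
    (hAC : AssumpAC q Acts1 Acts2) (hφ : UpperSemianalytic φ) [Nonempty X] {ε : ℝ} (hε : 0 < ε) :
    ∃ π1 : Policy1 Acts1,
      (∀ x : X,
        (gMinimax q Acts1 Acts2 φ x ≠ ⊥ →
          sup2 q Acts2 φ π1 x ≤ gMinimax q Acts1 Acts2 φ x + (ε : EReal)) ∧
        (gMinimax q Acts1 Acts2 φ x = ⊥ →
          sup2 q Acts2 φ π1 x ≤ ((-ε⁻¹ : ℝ) : EReal))) ∧
      (∀ x : X,
        (∃ π1' : Policy1 Acts1, sup2 q Acts2 φ π1' x = gMinimax q Acts1 Acts2 φ x) →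
        sup2 q Acts2 φ π1 x = gMinimax q Acts1 Acts2 φ x) := by
  classical
  have hiff := M.exists_guarantee_iff (φ := φ) hsel1 hsel1' hsel2 hsel2' hAC
  have hgm := M.um_gMinimax hAD hsel1 hsel1' hsel2 hsel2' hAC hφ
  set g := gMinimax q Acts1 Acts2 φ with hg
  have hle : ∀ (π1 : Policy1 Acts1) x, g x ≤ sup2 q Acts2 φ π1 x := fun π1 x => iInf_le _ π1
  let D : Set X := (fun x => (x, g x)) ⁻¹' {s | ∃ p, (s, p) ∈ M.guarantee φ}
  have hD : UniversallyMeasurableSet D :=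
    umSet_preimage (s := {s | ∃ p, (s, p) ∈ M.guarantee φ})
      (umSet_exists hAD (M.analyticSet_compl_guarantee hφ))
      (Measurable.prodMk (m := umSpace X) (f := fun x => x) (um_of_measurable measurable_id) hgm)
  let slack : EReal → EReal := fun t => if t = ⊥ then ((-ε⁻¹ : ℝ) : EReal) else t + ε
  have hslack : Measurable slack := by
    refine Measurable.ite (measurableSet_singleton _) measurable_const ?_
    exact Monotone.measurable fun s t h => add_le_add_left h _
  let b : X → EReal := fun x => if x ∈ D then g x else slack (g x)
  have hb : UniversallyMeasurable b :=
    Measurable.ite (m := umSpace X) hD hgm (hslack.comp hgm)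
  have hgD : ∀ x, ∃ p, ((x, b x), p) ∈ M.guarantee φ := by
    intro x
    by_cases hx : x ∈ D
    · simp only [b, if_pos hx]
      exact hx
    simp only [b, if_neg hx]
    refine M.exists_guarantee_of_lt hsel1 hsel1' hsel2 hsel2' hAC ?_
    rw [← hg]
    by_cases hbot : g x = ⊥
    · simp only [slack, hbot, if_true]
      exact EReal.bot_lt_coe _
    simp only [slack, if_neg hbot]
    have htop : g x ≠ ⊤ := by
      intro htop
      obtain ⟨π1, -⟩ := M.exists_policy1 hsel1 hsel1'
        (um_of_measurable (measurable_const (a := (0 : ℕ → Code))))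
      exact hx ((hiff x (g x)).2 ⟨π1, htop ▸ le_top⟩)
    lift g x to ℝ using ⟨htop, hbot⟩ with t
    exact_mod_cast lt_add_of_pos_right t hε
  obtain ⟨π1, hπ1⟩ := M.exists_policy1_of_guarantee hAD hsel1 hsel1' hsel2 hsel2' hAC hφ hb hgD
  refine ⟨π1, fun x => ⟨fun hx => (hπ1 x).trans ?_, fun hx => (hπ1 x).trans ?_⟩, fun x hx => ?_⟩
  · by_cases h : x ∈ D
    · simp only [b, if_pos h]
      exact le_add_of_nonneg_right (by exact_mod_cast hε.le)
    · simp only [b, if_neg h, slack, if_neg hx, le_refl]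
  · by_cases h : x ∈ D
    · simp only [b, if_pos h, hx, bot_le]
    · simp only [b, if_neg h, slack, if_pos hx, le_refl]
  · obtain ⟨π1', h⟩ := hx
    have hxD : x ∈ D := (hiff x (g x)).2 ⟨π1', h.le⟩
    refine le_antisymm ((hπ1 x).trans ?_) (hle π1 x)
    simp only [b, if_pos hxD, le_refl]

end Model

theorem exists_model (hAD : Sigma12UniversallyMeasurable) {X A1 A2 : Type}
    [TopologicalSpace X] [PolishSpace X] [MeasurableSpace X] [BorelSpace X]
    [TopologicalSpace A1] [PolishSpace A1] [MeasurableSpace A1] [BorelSpace A1]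
    [TopologicalSpace A2] [PolishSpace A2] [MeasurableSpace A2] [BorelSpace A2] [Nonempty X]
    (q : Kernel (X × A1 × A2) X) [IsMarkovKernel q] {Acts1 : X → Set A1} {Acts2 : X → Set A2}
    {ψ1 : (ℕ → ℕ) → X × A1} (hψ1 : Continuous ψ1)
    (hψ1r : range ψ1 = {p : X × A1 | p.2 ∈ Acts1 p.1})
    {ψ2 : (ℕ → ℕ) → X × A2} (hψ2 : Continuous ψ2)
    (hψ2r : range ψ2 = {p : X × A2 | p.2 ∈ Acts2 p.1}) : Nonempty (Model q Acts1 Acts2) := by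
  obtain ⟨next, hnext, hq⟩ := q.exists_measurable_map_eq_unitInterval
  have hΓ1 : AnalyticSet {p : X × A1 | p.2 ∈ Acts1 p.1} :=
    hψ1r ▸ analyticSet_range_of_polishSpace hψ1
  have hΓ2 : AnalyticSet {p : X × A2 | p.2 ∈ Acts2 p.1} :=
    hψ2r ▸ analyticSet_range_of_polishSpace hψ2
  have h1 : ∀ n, Nonempty (Coding (fun i : InfoM X A1 n => i.2) Acts1) :=
    fun n => exists_coding hAD measurable_snd hΓ1 hψ1 hψ1r
  have h2 : ∀ n, Nonempty (Coding (fun h : HistM X A1 A2 n => h.2) Acts2) :=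
    fun n => exists_coding hAD measurable_snd hΓ2 hψ2 hψ2r
  exact ⟨⟨fun n => (h1 n).some, fun n => (h2 n).some, next, hnext, hq⟩⟩

theorem exists_continuous_range_graph {X A : Type} [TopologicalSpace X] [TopologicalSpace A]
    [Nonempty X] {Acts : X → Set A} (hne : ∀ x, (Acts x).Nonempty)
    (hΓ : AnalyticSet {p : X × A | p.2 ∈ Acts p.1}) :
    ∃ ψ : (ℕ → ℕ) → X × A, Continuous ψ ∧ range ψ = {p : X × A | p.2 ∈ Acts p.1} := by
  rw [AnalyticSet] at hΓ
  refine hΓ.resolve_left (Nonempty.ne_empty ?_)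
  obtain ⟨x⟩ := ‹Nonempty X›
  exact ⟨(x, (hne x).some), (hne x).some_mem⟩

end MinimaxControl

namespace PaperStmt

/-- Theorem `thm-minmax-opt`: assuming that every `Σ¹₂` subset of a
Borel space is universally measurable (a consequence of analytic determinacy), under
Assumptions AC and UA the optimal value function of the minimax control problem is
universally measurable, and for each `ε > 0` player 1 has a universally measurable
`ε`-optimal policy that is optimal at every state admitting an optimal policy. -/
theorem statement18
    (hAD : ∀ (γ : Type) [TopologicalSpace γ] [PolishSpace γ]
      [MeasurableSpace γ] [BorelSpace γ] (s : Set γ),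
      IsSigma12 s → UniversallyMeasurableSet s)
    {X A1 A2 : Type}
    [TopologicalSpace X] [PolishSpace X] [MeasurableSpace X] [BorelSpace X]
    [TopologicalSpace A1] [PolishSpace A1] [MeasurableSpace A1] [BorelSpace A1]
    [TopologicalSpace A2] [PolishSpace A2] [MeasurableSpace A2] [BorelSpace A2]
    (q : Kernel (X × A1 × A2) X) [IsMarkovKernel q]
    (Acts1 : X → Set A1) (Acts2 : X → Set A2)
    (hne1 : ∀ x, (Acts1 x).Nonempty) (hne2 : ∀ x, (Acts2 x).Nonempty)
    (hΓ1 : MeasureTheory.AnalyticSet {xa : X × A1 | xa.2 ∈ Acts1 xa.1})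
    (hΓ2 : MeasureTheory.AnalyticSet {xa : X × A2 | xa.2 ∈ Acts2 xa.1})
    -- Assumption AC
    (hAC : AssumpAC q Acts1 Acts2)
    -- Assumption UA: the criterion is given by an upper semianalytic function of the
    -- strategic measure
    (φ : ProbabilityMeasure (TrajM X A1 A2) → EReal)
    (hφ : UpperSemianalytic φ) :
    -- (i) the optimal value function of player 1 is universally measurable
    UniversallyMeasurable (gMinimax q Acts1 Acts2 φ) ∧
    -- (ii) `ε`-optimal policies for player 1
    ∀ ε : ℝ, 0 < ε →
      ∃ π1 : Policy1 Acts1,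
        (∀ x : X,
          (gMinimax q Acts1 Acts2 φ x ≠ ⊥ →
            sup2 q Acts2 φ π1 x ≤ gMinimax q Acts1 Acts2 φ x + (ε : EReal)) ∧
          (gMinimax q Acts1 Acts2 φ x = ⊥ →
            sup2 q Acts2 φ π1 x ≤ ((-ε⁻¹ : ℝ) : EReal))) ∧
        (∀ x : X,
          (∃ π1' : Policy1 Acts1, sup2 q Acts2 φ π1' x = gMinimax q Acts1 Acts2 φ x) →
          sup2 q Acts2 φ π1 x = gMinimax q Acts1 Acts2 φ x) := by
  have hempty : ∀ {β : Type} [IsEmpty β] [MeasurableSpace β] (s : Set β),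
      UniversallyMeasurableSet s := fun s μ _ => by
    rw [Subsingleton.elim s ∅]
    exact MeasurableSet.empty.nullMeasurableSet
  cases isEmpty_or_nonempty X with
  | inl h =>
    have h' : ∀ n, IsEmpty (InfoM X A1 n) := fun n => ⟨fun i => isEmptyElim i.2⟩
    exact ⟨fun _ _ => hempty _, fun ε _ => ⟨⟨fun _ i => isEmptyElim i.2,
      fun _ i => isEmptyElim i.2, fun n _ _ _ _ => hempty _, fun _ i => isEmptyElim i.2⟩,
      fun x => isEmptyElim x, fun x => isEmptyElim x⟩⟩
  | inr h =>
    obtain ⟨ψ1, hψ1, hψ1r⟩ := MinimaxControl.exists_continuous_range_graph hne1 hΓ1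
    obtain ⟨ψ2, hψ2, hψ2r⟩ := MinimaxControl.exists_continuous_range_graph hne2 hΓ2
    obtain ⟨sel1, hsel1, hsel1'⟩ := MinimaxControl.exists_um_selection hAD hψ1 hψ1r hne1
    obtain ⟨sel2, hsel2, hsel2'⟩ := MinimaxControl.exists_um_selection hAD hψ2 hψ2r hne2
    obtain ⟨M⟩ := MinimaxControl.exists_model hAD q hψ1 hψ1r hψ2 hψ2r
    exact ⟨M.um_gMinimax hAD hsel1 hsel1' hsel2 hsel2' hAC hφ,
      fun ε hε => M.exists_optimal_policy1 hAD hsel1 hsel1' hsel2 hsel2' hAC hφ hε⟩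

end PaperStmt
end
end

section
/- Let Ω be the countable product of Borel spaces with coordinates ω = (ω¹, ω², …), let I and I' be disjoint sets of positive integers with I'_1, I'_2 a partition of I', and set Z = Ω^(I), Z' = Ω^(I'), Z'_1 = Ω^(I'_1), Z'_2 = Ω^(I'_2). Let Ψ_1(dz' | z; p) and Ψ_2(dz' | z; p) be Borel measurable stochastic kernels on Z' given Z × P(Ω). Then the following sets are Borel: (i) B_1 := {p ∈ P(Ω) : p{ω : Ψ_1(· | ω^(I); p) = Ψ_2(· | ω^(I); p)} = 1}; (ii) B_2 := {p ∈ P(Ω) : p{ω : Ψ_1(· | ω^(I); p) is a Dirac measure on Z'} = 1}; (iii) B_3 := {p ∈ P(Ω) : p{ω : Ψ_1(· | ω^(I); p) is a product measure in P(Z'_1) ⊗ P(Z'_2)} = 1}; and (iv) if Θ is a Borel space and Ψ_1, Ψ_2 are Borel measurable stochastic kernels on Z' given Z × P(Ω) × Θ, the set B_4 := {(p, θ) ∈ P(Ω) × Θ : p{ω : Ψ_1(· | ω^(I); p, θ) = Ψ_2(· | ω^(I); p, θ)} = 1} is Borel. -/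
open MeasureTheory

noncomputable section

namespace PaperStmt

open ProbabilityTheory

/-- For a countably generated target, the coincidence set of two measurable families of probability
measures is measurable. -/
theorem measurableSet_setOf_measure_eq {X E : Type*} [MeasurableSpace X] [MeasurableSpace E]
    [MeasurableSpace.CountablyGenerated E] {κ η : X → Measure E}
    (hκ : Measurable κ) (hη : Measurable η)
    [∀ x, IsProbabilityMeasure (κ x)] [∀ x, IsProbabilityMeasure (η x)] :
    MeasurableSet {x | κ x = η x} := by
  set C : Set (Set E) := generateSetAlgebra (MeasurableSpace.countableGeneratingSet E)
  have hgen : ‹MeasurableSpace E› = MeasurableSpace.generateFrom C := by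
    rw [generateFrom_generateSetAlgebra_eq,
      MeasurableSpace.generateFrom_countableGeneratingSet]
  have hC : C.Countable :=
    countable_generateSetAlgebra MeasurableSpace.countable_countableGeneratingSet
  have hpi : IsPiSystem C := fun s hs t ht _ => isSetAlgebra_generateSetAlgebra.inter_mem hs ht
  have hmeas : ∀ s ∈ C, MeasurableSet s := fun s hs => by
    rw [hgen]
    exact MeasurableSpace.measurableSet_generateFrom hs
  have heq : {x | κ x = η x} = ⋂ s ∈ C, {x | κ x s = η x s} := by
    ext x
    simp only [Set.mem_ofPred_eq, Set.mem_iInter]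
    exact ⟨fun h s _ => by rw [h], fun h => ext_of_generate_finite C hgen hpi h (by simp)⟩
  rw [heq]
  exact MeasurableSet.biInter hC fun s hs => measurableSet_eq_fun
    ((Measure.measurable_coe (hmeas s hs)).comp hκ) ((Measure.measurable_coe (hmeas s hs)).comp hη)

theorem measurable_measure_map {X E F : Type*} [MeasurableSpace X] [MeasurableSpace E]
    [MeasurableSpace F] {κ : X → Measure E} (hκ : Measurable κ) {f : E → F} (hf : Measurable f) :
    Measurable fun x => (κ x).map f :=
  (Measure.measurable_map f hf).comp hκ

theorem measurable_measure_prod {X E F : Type*} [MeasurableSpace X] [MeasurableSpace E]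
    [MeasurableSpace F] {κ : X → Measure E} {η : X → Measure F}
    (hκ : Measurable κ) (hη : Measurable η)
    [∀ x, IsProbabilityMeasure (κ x)] [∀ x, IsProbabilityMeasure (η x)] :
    Measurable fun x => (κ x).prod (η x) := by
  let K : Kernel X E := ⟨κ, hκ⟩
  let H : Kernel X F := ⟨η, hη⟩
  have : IsMarkovKernel K := ⟨fun x => inferInstanceAs (IsProbabilityMeasure (κ x))⟩
  have : IsMarkovKernel H := ⟨fun x => inferInstanceAs (IsProbabilityMeasure (η x))⟩
  have h : (fun x => (κ x).prod (η x)) = fun x => (K ×ₖ H) x := by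
    ext1 x
    rw [Kernel.prod_apply]
    rfl
  rw [h]
  exact (K ×ₖ H).measurable

/-- A probability measure on a standard Borel space is a Dirac measure iff its independent
self-coupling is its diagonal self-coupling. -/
theorem exists_eq_dirac_iff_prod_self_eq_map {E : Type*} [MeasurableSpace E]
    [StandardBorelSpace E] (μ : Measure E) [IsProbabilityMeasure μ] :
    (∃ x, μ = Measure.dirac x) ↔ μ.prod μ = μ.map fun x => (x, x) := by
  have hdiag : Measurable fun x : E => (x, x) := measurable_id.prodMk measurable_id
  constructor
  · rintro ⟨x, rfl⟩
    rw [Measure.dirac_prod_dirac, Measure.map_dirac' hdiag]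
  · intro h
    have : IsZeroOneMeasure μ := ⟨fun s hs => by
      have h1 := congrArg (fun ν => ν (s ×ˢ s)) h
      simp only [Measure.prod_prod, Measure.map_apply hdiag (hs.prod hs)] at h1
      have h2 : (fun x : E => (x, x)) ⁻¹' (s ×ˢ s) = s := by ext; simp
      rw [h2] at h1
      by_cases h0 : μ s = 0
      · exact Or.inl h0
      · exact Or.inr ((ENNReal.mul_eq_left h0 (measure_ne_top μ s)).1 h1)⟩
    exact IsZeroOneMeasure.exists_eq_dirac

/-- The joint law of two random variables factorizes on measurable rectangles iff it is the
product of its marginals. -/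
theorem exists_factorization_iff_map_eq_prod {E F G : Type*} [MeasurableSpace E]
    [MeasurableSpace F] [MeasurableSpace G] (μ : Measure E) [IsProbabilityMeasure μ]
    {f : E → F} {g : E → G} (hf : Measurable f) (hg : Measurable g) :
    (∃ (ν1 : Measure F) (ν2 : Measure G), IsProbabilityMeasure ν1 ∧ IsProbabilityMeasure ν2 ∧
      ∀ (A : Set F) (B : Set G), MeasurableSet A → MeasurableSet B →
        μ (f ⁻¹' A ∩ g ⁻¹' B) = ν1 A * ν2 B) ↔
      μ.map (fun x => (f x, g x)) = (μ.map f).prod (μ.map g) := by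
  have hfg : Measurable fun x => (f x, g x) := hf.prodMk hg
  have := Measure.isProbabilityMeasure_map (μ := μ) hf.aemeasurable
  have := Measure.isProbabilityMeasure_map (μ := μ) hg.aemeasurable
  constructor
  · rintro ⟨ν1, ν2, h1, h2, h⟩
    have e1 : μ.map f = ν1 := by
      ext A hA
      simpa [Measure.map_apply hf hA] using h A Set.univ hA .univ
    have e2 : μ.map g = ν2 := by
      ext B hB
      simpa [Measure.map_apply hg hB] using h Set.univ B .univ hB
    rw [e1, e2]
    refine (Measure.prod_eq fun A B hA hB => ?_).symm
    rw [Measure.map_apply hfg (hA.prod hB), ← h A B hA hB]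
    rfl
  · intro h
    refine ⟨μ.map f, μ.map g, inferInstance, inferInstance, fun A B hA hB => ?_⟩
    rw [← Measure.prod_prod, ← h, Measure.map_apply hfg (hA.prod hB)]
    rfl

theorem measurableSet_setOf_measure_slice_eq_one {T X : Type*} [MeasurableSpace T]
    [MeasurableSpace X] {μ : T → Measure X} (hμ : Measurable μ)
    [∀ t, IsProbabilityMeasure (μ t)] {S : Set (T × X)} (hS : MeasurableSet S) :
    MeasurableSet {t | μ t (Prod.mk t ⁻¹' S) = 1} := by
  let K : Kernel T X := ⟨μ, hμ⟩
  have : IsMarkovKernel K := ⟨fun t => inferInstanceAs (IsProbabilityMeasure (μ t))⟩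
  exact Kernel.measurable_kernel_prodMk_left (κ := K) hS (measurableSet_singleton 1)

/-- The inclusion of probability measures into measures is Borel measurable for the topology of
weak convergence. -/
theorem measurable_toMeasure {X : Type*} [TopologicalSpace X] [HasOuterApproxClosed X]
    [MeasurableSpace X] [BorelSpace X] :
    Measurable fun p : ProbabilityMeasure X => p.toMeasure := by
  have : BorelSpace (ProbabilityMeasure X) := ⟨rfl⟩
  refine Measurable.measure_of_isPiSystem_of_isProbabilityMeasure
    (BorelSpace.measurable_eq.trans borel_eq_generateFrom_isClosed) isPiSystem_isClosed
    fun F hF => ?_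
  refine measurable_of_tendsto_metrizable
    (f := fun n (p : ProbabilityMeasure X) => ∫⁻ x, hF.apprSeq n x ∂p.toMeasure)
    (fun n => ?_) (tendsto_pi_nhds.2 fun p =>
      HasOuterApproxClosed.tendsto_lintegral_apprSeq hF p.toMeasure)
  exact (ProbabilityMeasure.continuous_lintegral_boundedContinuousFunction _).measurable

/-- Lemma `lem-gen1`: for Borel measurable stochastic kernels
`Ψ₁, Ψ₂` on `Z' = Ω^(I')` given `Z × P(Ω)` (resp. given `Z × P(Ω) × Θ`), where
`Z = Ω^(I)`, `I ∩ I' = ∅` and `I' = I'_1 ∪ I'_2` is a partition, the sets `B₁`–`B₄`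
are Borel subsets of `P(Ω)` (resp. of `P(Ω) × Θ`). -/
theorem statement19
    (Y : ℕ → Type*) [∀ i, TopologicalSpace (Y i)] [∀ i, PolishSpace (Y i)]
    [∀ i, MeasurableSpace (Y i)] [∀ i, BorelSpace (Y i)]
    (I I1 I2 : Set ℕ)
    (hdisj : Disjoint I (I1 ∪ I2)) (h12 : Disjoint I1 I2)
    (Ψ1 Ψ2 : ((∀ i : I, Y i) × ProbabilityMeasure (∀ i, Y i)) →
      Measure (∀ i : ↥(I1 ∪ I2), Y i))
    (hΨ1 : Measurable Ψ1) (hΨ2 : Measurable Ψ2)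
    (hΨ1p : ∀ zp, IsProbabilityMeasure (Ψ1 zp))
    (hΨ2p : ∀ zp, IsProbabilityMeasure (Ψ2 zp))
    (Θ : Type*) [TopologicalSpace Θ] [PolishSpace Θ] [MeasurableSpace Θ] [BorelSpace Θ]
    (Ψ1' Ψ2' : ((∀ i : I, Y i) × ProbabilityMeasure (∀ i, Y i) × Θ) →
      Measure (∀ i : ↥(I1 ∪ I2), Y i))
    (hΨ1' : Measurable Ψ1') (hΨ2' : Measurable Ψ2')
    (hΨ1'p : ∀ zpθ, IsProbabilityMeasure (Ψ1' zpθ))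
    (hΨ2'p : ∀ zpθ, IsProbabilityMeasure (Ψ2' zpθ)) :
    -- (i) `B₁`
    MeasurableSet {p : ProbabilityMeasure (∀ i, Y i) |
      p.toMeasure {ω | Ψ1 (fun i : I => ω i.1, p) = Ψ2 (fun i : I => ω i.1, p)} = 1} ∧
    -- (ii) `B₂`
    MeasurableSet {p : ProbabilityMeasure (∀ i, Y i) |
      p.toMeasure {ω | ∃ z' : ∀ i : ↥(I1 ∪ I2), Y i,
        Ψ1 (fun i : I => ω i.1, p) = Measure.dirac z'} = 1} ∧
    -- (iii) `B₃`
    MeasurableSet {p : ProbabilityMeasure (∀ i, Y i) |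
      p.toMeasure {ω | ∃ (ν1 : Measure (∀ i : I1, Y i)) (ν2 : Measure (∀ i : I2, Y i)),
        IsProbabilityMeasure ν1 ∧ IsProbabilityMeasure ν2 ∧
        ∀ (B1 : Set (∀ i : I1, Y i)) (B2 : Set (∀ i : I2, Y i)),
          MeasurableSet B1 → MeasurableSet B2 →
          Ψ1 (fun i : I => ω i.1, p)
            ((fun (z' : ∀ i : ↥(I1 ∪ I2), Y i) (i : I1) =>
                z' ⟨i.1, Set.mem_union_left I2 i.2⟩) ⁻¹' B1 ∩
             (fun (z' : ∀ i : ↥(I1 ∪ I2), Y i) (i : I2) =>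
                z' ⟨i.1, Set.mem_union_right I1 i.2⟩) ⁻¹' B2)
            = ν1 B1 * ν2 B2} = 1} ∧
    -- (iv) `B₄`
    MeasurableSet {pθ : ProbabilityMeasure (∀ i, Y i) × Θ |
      pθ.1.toMeasure {ω | Ψ1' (fun i : I => ω i.1, pθ.1, pθ.2)
        = Ψ2' (fun i : I => ω i.1, pθ.1, pθ.2)} = 1} := by
  have hμ : Measurable fun p : ProbabilityMeasure (∀ i, Y i) => p.toMeasure :=
    measurable_toMeasure
  have hres : Measurable fun (ω : ∀ i, Y i) (i : I) => ω i.1 :=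
    measurable_pi_lambda _ fun i => measurable_pi_apply i.1
  have hpair : Measurable fun q : ProbabilityMeasure (∀ i, Y i) × (∀ i, Y i) =>
      ((fun i : I => q.2 i.1, q.1) : (∀ i : I, Y i) × ProbabilityMeasure (∀ i, Y i)) :=
    (hres.comp measurable_snd).prodMk measurable_fst
  have hdiag : Measurable fun z : (∀ i : ↥(I1 ∪ I2), Y i) => (z, z) :=
    measurable_id.prodMk measurable_id
  have hf1 : Measurable fun (z' : ∀ i : ↥(I1 ∪ I2), Y i) (i : I1) =>
      z' ⟨i.1, Set.mem_union_left I2 i.2⟩ :=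
    measurable_pi_lambda _ fun i => measurable_pi_apply _
  have hf2 : Measurable fun (z' : ∀ i : ↥(I1 ∪ I2), Y i) (i : I2) =>
      z' ⟨i.1, Set.mem_union_right I1 i.2⟩ :=
    measurable_pi_lambda _ fun i => measurable_pi_apply _
  refine ⟨?_, ?_, ?_, ?_⟩
  · exact measurableSet_setOf_measure_slice_eq_one hμ
      (hpair (measurableSet_setOf_measure_eq hΨ1 hΨ2))
  · simp_rw [exists_eq_dirac_iff_prod_self_eq_map]
    have := fun zp => Measure.isProbabilityMeasure_map (μ := Ψ1 zp) hdiag.aemeasurable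
    exact measurableSet_setOf_measure_slice_eq_one hμ
      (hpair (measurableSet_setOf_measure_eq (measurable_measure_prod hΨ1 hΨ1)
        (measurable_measure_map hΨ1 hdiag)))
  · simp_rw [exists_factorization_iff_map_eq_prod _ hf1 hf2]
    have := fun zp => Measure.isProbabilityMeasure_map (μ := Ψ1 zp) (hf1.prodMk hf2).aemeasurable
    have := fun zp => Measure.isProbabilityMeasure_map (μ := Ψ1 zp) hf1.aemeasurable
    have := fun zp => Measure.isProbabilityMeasure_map (μ := Ψ1 zp) hf2.aemeasurable
    exact measurableSet_setOf_measure_slice_eq_one hμ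
      (hpair (measurableSet_setOf_measure_eq
        (measurable_measure_map hΨ1 (hf1.prodMk hf2))
        (measurable_measure_prod (measurable_measure_map hΨ1 hf1)
          (measurable_measure_map hΨ1 hf2))))
  · have htriple : Measurable fun q : (ProbabilityMeasure (∀ i, Y i) × Θ) × (∀ i, Y i) =>
        ((fun i : I => q.2 i.1, q.1.1, q.1.2) :
          (∀ i : I, Y i) × ProbabilityMeasure (∀ i, Y i) × Θ) :=
      (hres.comp measurable_snd).prodMk measurable_fst
    exact measurableSet_setOf_measure_slice_eq_one (μ := fun pθ => pθ.1.toMeasure)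
      (hμ.comp measurable_fst)
      (htriple (measurableSet_setOf_measure_eq hΨ1' hΨ2'))

end PaperStmt
end
end
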